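/- arXiv:math/0509436 — 6 statements merged into one kernel-verified Lean document; each statement's English description precedes it below -/
import Mathlib

section
/- Let θ, ρ ∈ (0,1] and R > 0, and let u be a C^{2,1} function on B_4 × [0, 1/R^2] satisfying |Δu + ∂_t u| ≤ R^2|u| + R|∇u|, ‖u‖_{L^∞(B_4 × [0,1/R^2])} ≤ 1, ‖∇u‖_{L^∞(B_4 × [0,1/R^2])} ≤ R, and ‖u(·,0)‖_{L^2(B_ρ)} ≥ θ R^{-n/2}. Then there is a constant N = N(n,θ), depending only on the dimension n and on θ, such that √N · ‖u(·,t)‖_{L^2(B_{2ρ})} ≥ R^{-n/2} whenever 0 < t ≤ 1/R^2 and R > N/ρ. -/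
open MeasureTheory Real Set Metric

/-- The spatial Laplacian of `f : ℝⁿ → ℝ`. -/
noncomputable def slap {n : ℕ} (f : EuclideanSpace ℝ (Fin n) → ℝ)
    (x : EuclideanSpace ℝ (Fin n)) : ℝ :=
  ∑ i : Fin n, fderiv ℝ (fun y => fderiv ℝ f y (EuclideanSpace.single i 1)) x
    (EuclideanSpace.single i 1)

open Filter Topology

/-- `h` is differentiable near `0` and its derivative has derivative `q` at `0`. -/
def HasSecondDerivAtZero (h : ℝ → ℝ) (q : ℝ) : Prop :=
  ∃ d : ℝ → ℝ, (∀ᶠ σ in 𝓝 0, HasDerivAt h (d σ) σ) ∧ HasDerivAt d q 0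

namespace HasSecondDerivAtZero

lemma sub {f g : ℝ → ℝ} {p q : ℝ} (hf : HasSecondDerivAtZero f p)
    (hg : HasSecondDerivAtZero g q) :
    HasSecondDerivAtZero (fun σ => f σ - g σ) (p - q) := by
  obtain ⟨df, hf1, hf2⟩ := hf
  obtain ⟨dg, hg1, hg2⟩ := hg
  refine ⟨fun σ => df σ - dg σ, ?_, hf2.sub hg2⟩
  filter_upwards [hf1, hg1] with σ h1 h2 using h1.sub h2

lemma const_mul {f : ℝ → ℝ} {p : ℝ} (c : ℝ) (hf : HasSecondDerivAtZero f p) :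
    HasSecondDerivAtZero (fun σ => c * f σ) (c * p) := by
  obtain ⟨df, hf1, hf2⟩ := hf
  refine ⟨fun σ => c * df σ, ?_, hf2.const_mul c⟩
  filter_upwards [hf1] with σ h1 using h1.const_mul c

lemma const (c : ℝ) : HasSecondDerivAtZero (fun _ => c) 0 :=
  ⟨fun _ => 0, .of_forall fun σ => hasDerivAt_const σ c, hasDerivAt_const 0 0⟩

lemma nonpos_of_isLocalMax {f : ℝ → ℝ} {q : ℝ} (hf : HasSecondDerivAtZero f q)
    (hm : IsLocalMax f 0) : q ≤ 0 := by
  obtain ⟨d, h1, h2⟩ := hf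
  by_contra! hq
  have hd : deriv f =ᶠ[𝓝 0] d := h1.mono fun σ h => h.deriv
  have hdd : deriv (deriv f) 0 = q := by rw [hd.deriv_eq, h2.deriv]
  have hmin := isLocalMin_of_deriv_deriv_pos (f := f) (x₀ := 0) (by rw [hdd]; exact hq)
    hm.deriv_eq_zero h1.self_of_nhds.continuousAt
  have hconst : f =ᶠ[𝓝 0] fun _ => f 0 := by
    filter_upwards [hm, hmin] with σ h3 h4 using le_antisymm h3 h4
  have : deriv (deriv f) 0 = 0 := by
    rw [hconst.deriv.deriv_eq]; simp
  linarith

end HasSecondDerivAtZero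

lemma HasDerivWithinAt.nonpos_of_forall_le {f : ℝ → ℝ} {p s T : ℝ} (hs : s < T)
    (hf : HasDerivWithinAt f p (Icc s T) s) (hm : ∀ σ ∈ Icc s T, f σ ≤ f s) : p ≤ 0 := by
  have h := hf.mono Ioc_subset_Icc_self
  rw [hasDerivWithinAt_iff_tendsto_slope' (by simp)] at h
  have : (𝓝[Ioc s T] s).NeBot := by
    rw [nhdsWithin_Ioc_eq_nhdsGT hs]; infer_instance
  refine le_of_tendsto h ?_
  filter_upwards [self_mem_nhdsWithin] with σ hσ
  rw [slope_def_field]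
  exact div_nonpos_of_nonpos_of_nonneg (by linarith [hm σ ⟨hσ.1.le, hσ.2⟩])
    (by linarith [hσ.1])

/-- The maximum principle for strict subsolutions of the backward heat equation. -/
lemma backward_heat_maximum_principle {n : ℕ} {F : EuclideanSpace ℝ (Fin n) → ℝ → ℝ} {r T : ℝ}
    (hF : ContinuousOn (Function.uncurry F) (closedBall 0 r ×ˢ Icc 0 T))
    (hside : ∀ x, ‖x‖ = r → ∀ s ∈ Icc 0 T, F x s ≤ 0)
    (htop : ∀ x ∈ closedBall 0 r, F x T ≤ 0)
    (hsub : ∀ x ∈ ball 0 r, ∀ s ∈ Ico 0 T, ∃ (q : Fin n → ℝ) (p : ℝ),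
      (∀ i, HasSecondDerivAtZero
        (fun σ => F (x + σ • EuclideanSpace.single i 1) s) (q i)) ∧
      HasDerivWithinAt (F x) p (Icc s T) s ∧ 0 < p + ∑ i, q i) :
    ∀ x ∈ closedBall 0 r, ∀ s ∈ Icc 0 T, F x s ≤ 0 := by
  intro x hx s hs
  obtain ⟨⟨y, τ⟩, ⟨hy, hτ⟩, hmax⟩ :=
    ((isCompact_closedBall (0 : EuclideanSpace ℝ (Fin n)) r).prod
      (isCompact_Icc (a := 0) (b := T))).exists_isMaxOn ⟨(x, s), hx, hs⟩ hF
  have hmax' : ∀ z ∈ closedBall 0 r, ∀ t ∈ Icc 0 T, F z t ≤ F y τ :=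
    fun z hz t ht => hmax (show (z, t) ∈ _ from ⟨hz, ht⟩)
  refine (hmax' x hx s hs).trans ?_
  simp only at hy hτ
  by_cases h1 : ‖y‖ = r
  · exact hside y h1 τ hτ
  by_cases h2 : τ = T
  · rw [h2]; exact htop y hy
  exfalso
  have hyb : y ∈ ball 0 r := by
    rw [mem_ball_zero_iff]; rw [mem_closedBall_zero_iff] at hy
    exact lt_of_le_of_ne hy h1
  have hτT : τ < T := lt_of_le_of_ne hτ.2 h2
  obtain ⟨q, p, hq, hp, hpos⟩ := hsub y hyb τ ⟨hτ.1, hτT⟩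
  have hp0 : p ≤ 0 := hp.nonpos_of_forall_le hτT
    fun σ hσ => hmax' y hy σ ⟨hτ.1.trans hσ.1, hσ.2⟩
  have hq0 : ∀ i, q i ≤ 0 := by
    intro i
    refine (hq i).nonpos_of_isLocalMax ?_
    have hc : ContinuousAt (fun σ : ℝ => y + σ • EuclideanSpace.single i (1 : ℝ)) 0 := by
      fun_prop
    have := hc.preimage_mem_nhds (t := ball 0 r) (isOpen_ball.mem_nhds (by simpa using hyb))
    filter_upwards [this] with σ hσ
    simpa using hmax' _ (ball_subset_closedBall hσ) τ hτ
  have := Finset.sum_nonpos (s := Finset.univ) fun i _ => hq0 i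
  linarith

/-- The heat kernel on `ℝⁿ`. -/
noncomputable def heatKernel {n : ℕ} (z : EuclideanSpace ℝ (Fin n)) (τ : ℝ) : ℝ :=
  (4 * π * τ) ^ (-((n : ℝ) / 2)) * rexp (-‖z‖ ^ 2 / (4 * τ))

section HeatKernel

variable {n : ℕ}

lemma heatKernel_nonneg (z : EuclideanSpace ℝ (Fin n)) {τ : ℝ} (hτ : 0 < τ) :
    0 ≤ heatKernel z τ := by
  unfold heatKernel; positivity

lemma integral_heatKernel {τ : ℝ} (hτ : 0 < τ) :
    ∫ z : EuclideanSpace ℝ (Fin n), heatKernel z τ = 1 := by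
  have h := GaussianFourier.integral_rexp_neg_mul_sq_norm
    (V := EuclideanSpace ℝ (Fin n)) (b := 1 / (4 * τ)) (by positivity)
  unfold heatKernel
  rw [integral_const_mul]
  have h2 : ∀ v : EuclideanSpace ℝ (Fin n),
      rexp (-‖v‖ ^ 2 / (4 * τ)) = rexp (-(1 / (4 * τ)) * ‖v‖ ^ 2) := fun v => by
    congr 1; ring
  simp_rw [h2, h]
  have h3 : π / (1 / (4 * τ)) = 4 * π * τ := by field_simp
  rw [h3, finrank_euclideanSpace_fin, ← Real.rpow_add (by positivity)]
  simp

lemma integrable_heatKernel {τ : ℝ} (hτ : 0 < τ) :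
    Integrable fun z : EuclideanSpace ℝ (Fin n) => heatKernel z τ :=
  .of_integral_ne_zero (by rw [integral_heatKernel hτ]; exact one_ne_zero)

lemma norm_mul_heatKernel_le (z : EuclideanSpace ℝ (Fin n)) {τ : ℝ} (hτ : 0 < τ) :
    ‖z‖ * heatKernel z τ ≤ 2 * √τ * 2 ^ ((n : ℝ) / 2) * heatKernel z (2 * τ) := by
  have hs : 0 < √τ := Real.sqrt_pos.2 hτ
  have hss : √τ ^ 2 = τ := Real.sq_sqrt hτ.le
  have h1 : (4 * π * (2 * τ)) ^ (-((n : ℝ) / 2))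
      = 2 ^ (-((n : ℝ) / 2)) * (4 * π * τ) ^ (-((n : ℝ) / 2)) := by
    rw [← Real.mul_rpow (by positivity) (by positivity)]; congr 1; ring
  have h2 : (2 : ℝ) ^ ((n : ℝ) / 2) * 2 ^ (-((n : ℝ) / 2)) = 1 := by
    rw [← Real.rpow_add (by positivity)]; simp
  have h3 : rexp (-‖z‖ ^ 2 / (4 * τ)) =
      rexp (-(‖z‖ ^ 2 / (8 * τ))) * rexp (-‖z‖ ^ 2 / (4 * (2 * τ))) := by
    rw [← Real.exp_add]; congr 1; field_simp; ring
  have h4 : ‖z‖ * rexp (-(‖z‖ ^ 2 / (8 * τ))) ≤ 2 * √τ := by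
    rw [Real.exp_neg, ← div_eq_mul_inv, div_le_iff₀ (Real.exp_pos _)]
    have h5 := Real.add_one_le_exp (‖z‖ ^ 2 / (8 * τ))
    have h6 : ‖z‖ ≤ 2 * √τ * (‖z‖ ^ 2 / (8 * τ) + 1) := by
      have : 2 * √τ * (‖z‖ ^ 2 / (8 * τ) + 1) - ‖z‖ =
          (‖z‖ - 2 * √τ) ^ 2 / (4 * √τ) + √τ := by
        rw [← hss]; field_simp; rw [Real.sqrt_sq hs.le]; ring
      have h7 : 0 ≤ (‖z‖ - 2 * √τ) ^ 2 / (4 * √τ) := by positivity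
      linarith
    exact h6.trans (by gcongr)
  unfold heatKernel
  calc ‖z‖ * ((4 * π * τ) ^ (-((n : ℝ) / 2)) * rexp (-‖z‖ ^ 2 / (4 * τ)))
      = (‖z‖ * rexp (-(‖z‖ ^ 2 / (8 * τ)))) *
        ((4 * π * τ) ^ (-((n : ℝ) / 2)) * rexp (-‖z‖ ^ 2 / (4 * (2 * τ)))) := by rw [h3]; ring
    _ ≤ 2 * √τ *
        ((4 * π * τ) ^ (-((n : ℝ) / 2)) * rexp (-‖z‖ ^ 2 / (4 * (2 * τ)))) := by gcongr
    _ = _ := by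
      rw [h1]
      linear_combination -(2 * √τ * (4 * π * τ) ^ (-((n : ℝ) / 2))
        * rexp (-‖z‖ ^ 2 / (4 * (2 * τ)))) * h2

lemma norm_add_smul_single_sq (z : EuclideanSpace ℝ (Fin n)) (i : Fin n) (σ : ℝ) :
    ‖z + σ • EuclideanSpace.single i (1 : ℝ)‖ ^ 2 = ‖z‖ ^ 2 + 2 * σ * z i + σ ^ 2 := by
  rw [norm_add_sq_real, inner_smul_right, EuclideanSpace.inner_single_right, norm_smul]
  simp
  ring

lemma hasDerivAt_norm_add_smul_single_sq (z : EuclideanSpace ℝ (Fin n)) (i : Fin n) (σ : ℝ) :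
    HasDerivAt (fun σ : ℝ => ‖z + σ • EuclideanSpace.single i (1 : ℝ)‖ ^ 2)
      (2 * (z i + σ)) σ := by
  simp_rw [norm_add_smul_single_sq]
  have h := (((hasDerivAt_id σ).const_mul (2 * z i)).add ((hasDerivAt_id σ).pow 2)).const_add
    (‖z‖ ^ 2)
  refine (h.congr_deriv ?_).congr_of_eventuallyEq (.of_forall fun σ => ?_)
  · simp; ring
  · simp; ring

lemma hasDerivAt_heatKernel_space (z : EuclideanSpace ℝ (Fin n)) (τ : ℝ)
    (i : Fin n) (σ : ℝ) :
    HasDerivAt (fun σ : ℝ => heatKernel (z + σ • EuclideanSpace.single i (1 : ℝ)) τ)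
      (-((z i + σ) / (2 * τ)) * heatKernel (z + σ • EuclideanSpace.single i (1 : ℝ)) τ) σ := by
  unfold heatKernel
  have h := ((((hasDerivAt_norm_add_smul_single_sq z i σ).neg.div_const (4 * τ)).exp).const_mul
    ((4 * π * τ) ^ (-((n : ℝ) / 2))))
  refine h.congr_deriv ?_
  simp only [Pi.neg_apply]
  ring

lemma hasDerivAt_heatKernel_space_space (z : EuclideanSpace ℝ (Fin n)) {τ : ℝ} (hτ : 0 < τ)
    (i : Fin n) (σ : ℝ) :
    HasDerivAt (fun σ : ℝ =>
        -((z i + σ) / (2 * τ)) * heatKernel (z + σ • EuclideanSpace.single i (1 : ℝ)) τ)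
      (((z i + σ) ^ 2 / (4 * τ ^ 2) - 1 / (2 * τ)) *
        heatKernel (z + σ • EuclideanSpace.single i (1 : ℝ)) τ) σ := by
  have h := ((((hasDerivAt_id σ).const_add (z i)).div_const (2 * τ)).neg).mul
    (hasDerivAt_heatKernel_space z τ i σ)
  refine h.congr_deriv ?_
  simp
  field_simp
  ring

lemma hasDerivAt_heatKernel_time (z : EuclideanSpace ℝ (Fin n)) {τ : ℝ} (hτ : 0 < τ) :
    HasDerivAt (fun τ => heatKernel z τ)
      ((‖z‖ ^ 2 / (4 * τ ^ 2) - n / (2 * τ)) * heatKernel z τ) τ := by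
  unfold heatKernel
  have h1 : HasDerivAt (fun τ : ℝ => 4 * π * τ) (4 * π) τ := by
    simpa using (hasDerivAt_id τ).const_mul (4 * π)
  have h2 := h1.rpow_const (p := -((n : ℝ) / 2)) (Or.inl (by positivity))
  have h3 : HasDerivAt (fun τ : ℝ => -‖z‖ ^ 2 / (4 * τ)) (‖z‖ ^ 2 / (4 * τ ^ 2)) τ := by
    have := ((hasDerivAt_id τ).const_mul 4).fun_inv (by simpa using hτ.ne')
    refine ((this.const_mul (-‖z‖ ^ 2)).congr_deriv ?_)
    simp
    field_simp
  refine (h2.mul h3.exp).congr_deriv ?_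
  rw [Real.rpow_sub_one (by positivity)]
  field_simp
  ring

lemma continuousOn_heatKernel :
    ContinuousOn (fun p : EuclideanSpace ℝ (Fin n) × ℝ => heatKernel p.1 p.2)
      (univ ×ˢ Ioi 0) := by
  unfold heatKernel
  intro p hp
  have hp2 : 0 < p.2 := hp.2
  refine ContinuousAt.continuousWithinAt ?_
  have h1 : ContinuousAt (fun p : EuclideanSpace ℝ (Fin n) × ℝ =>
      (4 * π * p.2) ^ (-((n : ℝ) / 2))) p :=
    ContinuousAt.rpow_const (by fun_prop) (Or.inl (by positivity))
  have h2 : ContinuousAt (fun p : EuclideanSpace ℝ (Fin n) × ℝ => -‖p.1‖ ^ 2 / (4 * p.2)) p :=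
    ContinuousAt.div (by fun_prop) (by fun_prop) (by positivity)
  exact h1.mul (Real.continuous_exp.continuousAt.comp h2)

lemma continuous_heatKernel (τ : ℝ) :
    Continuous fun z : EuclideanSpace ℝ (Fin n) => heatKernel z τ := by
  unfold heatKernel; fun_prop

end HeatKernel

section ParametricIntegral

variable {P V : Type*} [PseudoMetricSpace P] [ProperSpace P] [NormedAddCommGroup V]

lemma norm_mul_le_of_support {g κ : V → ℝ} {S M : ℝ} (hg0 : ∀ y ∉ closedBall (0 : V) S, g y = 0)
    (hκ : ∀ y ∈ closedBall (0 : V) S, |κ y| ≤ M) (y : V) : ‖g y * κ y‖ ≤ |g y| * M := by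
  by_cases hy : y ∈ closedBall (0 : V) S
  · rw [norm_mul, Real.norm_eq_abs, Real.norm_eq_abs]
    exact mul_le_mul_of_nonneg_left (hκ y hy) (abs_nonneg _)
  · simp [hg0 y hy]

variable [ProperSpace V]

lemma exists_bound_near_of_continuousOn {k : P → V → ℝ} {U : Set P} {p₀ : P} (hU : U ∈ 𝓝 p₀)
    (hk : ContinuousOn (Function.uncurry k) (U ×ˢ univ)) (S : ℝ) :
    ∃ M, ∃ W ∈ 𝓝 p₀, W ⊆ U ∧ ∀ p ∈ W, ∀ y ∈ closedBall (0 : V) S, |k p y| ≤ M := by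
  obtain ⟨ε, hε, hεU⟩ := Metric.nhds_basis_closedBall.mem_iff.1 hU
  obtain ⟨M, hM⟩ := ((isCompact_closedBall p₀ ε).prod
    (isCompact_closedBall (0 : V) S)).exists_bound_of_continuousOn
      (hk.mono (prod_mono hεU (subset_univ _)))
  exact ⟨M, closedBall p₀ ε, closedBall_mem_nhds _ hε, hεU,
    fun p hp y hy => hM (p, y) ⟨hp, hy⟩⟩

variable [MeasurableSpace V] [OpensMeasurableSpace V] {μ : Measure V}

lemma integrable_mul_of_support {g κ : V → ℝ} {S : ℝ} (hg : Integrable g μ)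
    (hg0 : ∀ y ∉ closedBall (0 : V) S, g y = 0) (hκ : Continuous κ) :
    Integrable (fun y => g y * κ y) μ := by
  obtain ⟨M, hM⟩ := (isCompact_closedBall (0 : V) S).exists_bound_of_continuousOn hκ.continuousOn
  exact (hg.abs.mul_const M).mono' (hg.aestronglyMeasurable.mul hκ.aestronglyMeasurable)
    (.of_forall (norm_mul_le_of_support hg0 hM))

lemma continuousAt_integral_mul {g : V → ℝ} {S : ℝ} (hg : Integrable g μ)
    (hg0 : ∀ y ∉ closedBall (0 : V) S, g y = 0) {k : P → V → ℝ} {U : Set P} {p₀ : P}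
    (hU : U ∈ 𝓝 p₀) (hk : ContinuousOn (Function.uncurry k) (U ×ˢ univ)) :
    ContinuousAt (fun p => ∫ y, g y * k p y ∂μ) p₀ := by
  obtain ⟨M, W, hW, hWU, hM⟩ := exists_bound_near_of_continuousOn hU hk S
  have hkc : ∀ p ∈ U, Continuous (k p) := fun p hp =>
    continuousOn_univ.1 (hk.comp (f := fun y => (p, y)) (by fun_prop) fun y _ => ⟨hp, trivial⟩)
  refine continuousAt_of_dominated (bound := fun y => |g y| * M) ?_ ?_ (hg.abs.mul_const M) ?_
  · filter_upwards [hU] with p hp using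
      hg.aestronglyMeasurable.mul (hkc p hp).aestronglyMeasurable
  · filter_upwards [hW] with p hp using .of_forall (norm_mul_le_of_support hg0 (hM p hp))
  · refine .of_forall fun y => continuousAt_const.mul ?_
    have : ContinuousOn (fun p => k p y) U :=
      hk.comp (f := fun p => (p, y)) (by fun_prop) fun p hp => ⟨hp, trivial⟩
    exact this.continuousAt hU

lemma hasDerivAt_integral_mul {g : V → ℝ} {S : ℝ} (hg : Integrable g μ)
    (hg0 : ∀ y ∉ closedBall (0 : V) S, g y = 0) {k k' : ℝ → V → ℝ} {U : Set ℝ} {t₀ : ℝ}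
    (hU : U ∈ 𝓝 t₀) (hk : ContinuousOn (Function.uncurry k) (U ×ˢ univ))
    (hk' : ContinuousOn (Function.uncurry k') (U ×ˢ univ))
    (hd : ∀ t ∈ U, ∀ y, HasDerivAt (fun t => k t y) (k' t y) t) :
    HasDerivAt (fun t => ∫ y, g y * k t y ∂μ) (∫ y, g y * k' t₀ y ∂μ) t₀ := by
  obtain ⟨M, W, hW, hWU, hM⟩ := exists_bound_near_of_continuousOn hU hk' S
  obtain ⟨M', W', hW', -, hM'⟩ := exists_bound_near_of_continuousOn hU hk S
  have hkc : ∀ p ∈ U, Continuous (k p) := fun p hp =>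
    continuousOn_univ.1 (hk.comp (f := fun y => (p, y)) (by fun_prop) fun y _ => ⟨hp, trivial⟩)
  have hkc' : ∀ p ∈ U, Continuous (k' p) := fun p hp =>
    continuousOn_univ.1 (hk'.comp (f := fun y => (p, y)) (by fun_prop) fun y _ => ⟨hp, trivial⟩)
  have ht₀ : t₀ ∈ U := mem_of_mem_nhds hU
  refine (hasDerivAt_integral_of_dominated_loc_of_deriv_le (F := fun t y => g y * k t y)
    (F' := fun t y => g y * k' t y) (bound := fun y => |g y| * M) hW ?_ ?_ ?_ ?_
    (hg.abs.mul_const M) ?_).2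
  · filter_upwards [hU] with p hp using
      hg.aestronglyMeasurable.mul (hkc p hp).aestronglyMeasurable
  · exact (hg.abs.mul_const M').mono' (hg.aestronglyMeasurable.mul
      (hkc t₀ ht₀).aestronglyMeasurable)
      (.of_forall (norm_mul_le_of_support hg0 (hM' t₀ (mem_of_mem_nhds hW'))))
  · exact hg.aestronglyMeasurable.mul (hkc' t₀ ht₀).aestronglyMeasurable
  · exact .of_forall fun y p hp => norm_mul_le_of_support hg0 (hM p hp) y
  · exact .of_forall fun y p hp => (hd p (hWU hp) y).const_mul (g y)

end ParametricIntegral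

/-- The solution of the heat equation with initial value `g`, at `x` and time `τ`. -/
noncomputable def heatEvolution {n : ℕ} (g : EuclideanSpace ℝ (Fin n) → ℝ)
    (x : EuclideanSpace ℝ (Fin n)) (τ : ℝ) : ℝ :=
  ∫ y, g y * heatKernel (x - y) τ

section HeatEvolution

variable {n : ℕ} {g : EuclideanSpace ℝ (Fin n) → ℝ} {S : ℝ}

lemma heatEvolution_integrable (hg : Integrable g) {τ : ℝ} (hτ : 0 < τ) :
    Integrable fun x => heatEvolution g x τ := by
  simpa [convolution] using!
    hg.integrable_convolution (ContinuousLinearMap.mul ℝ ℝ) (integrable_heatKernel (n := n) hτ)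

lemma integral_heatEvolution (hg : Integrable g) {τ : ℝ} (hτ : 0 < τ) :
    ∫ x, heatEvolution g x τ = ∫ y, g y := by
  simpa [convolution, integral_heatKernel hτ] using!
    integral_convolution (ContinuousLinearMap.mul ℝ ℝ) hg (integrable_heatKernel (n := n) hτ)

lemma heatEvolution_nonneg (hg : ∀ y, 0 ≤ g y) (x : EuclideanSpace ℝ (Fin n)) {τ : ℝ}
    (hτ : 0 < τ) : 0 ≤ heatEvolution g x τ :=
  integral_nonneg fun y => mul_nonneg (hg y) (heatKernel_nonneg _ hτ)

lemma continuousOn_heatEvolution (hg : Integrable g)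
    (hg0 : ∀ y ∉ closedBall (0 : EuclideanSpace ℝ (Fin n)) S, g y = 0) :
    ContinuousOn (fun p : EuclideanSpace ℝ (Fin n) × ℝ => heatEvolution g p.1 p.2)
      (univ ×ˢ Ioi 0) := by
  intro p hp
  refine ContinuousAt.continuousWithinAt ?_
  refine continuousAt_integral_mul (k := fun p y => heatKernel (p.1 - y) p.2) hg hg0
    ((isOpen_univ.prod isOpen_Ioi).mem_nhds hp) ?_
  exact continuousOn_heatKernel.comp
    (f := fun q : (EuclideanSpace ℝ (Fin n) × ℝ) × EuclideanSpace ℝ (Fin n) =>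
      (q.1.1 - q.2, q.1.2)) (by fun_prop) fun q hq => ⟨trivial, hq.1.2⟩

lemma heatEvolution_solves (hg : Integrable g)
    (hg0 : ∀ y ∉ closedBall (0 : EuclideanSpace ℝ (Fin n)) S, g y = 0)
    (x : EuclideanSpace ℝ (Fin n)) {τ : ℝ} (hτ : 0 < τ) :
    ∃ q : Fin n → ℝ,
      (∀ i, HasSecondDerivAtZero
        (fun σ => heatEvolution g (x + σ • EuclideanSpace.single i 1) τ) (q i)) ∧
      HasDerivAt (heatEvolution g x) (∑ i, q i) τ := by
  refine ⟨fun i => ∫ y, g y *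
    (((x - y) i ^ 2 / (4 * τ ^ 2) - 1 / (2 * τ)) * heatKernel (x - y) τ), fun i => ?_, ?_⟩
  · have hsub : ∀ (σ : ℝ) (y : EuclideanSpace ℝ (Fin n)),
        x + σ • EuclideanSpace.single i (1 : ℝ) - y =
          (x - y) + σ • EuclideanSpace.single i (1 : ℝ) := fun σ y => by abel
    have hK : Continuous fun q : ℝ × EuclideanSpace ℝ (Fin n) =>
        heatKernel ((x - q.2) + q.1 • EuclideanSpace.single i (1 : ℝ)) τ :=
      (continuous_heatKernel τ).comp (by fun_prop)
    have hc : Continuous fun q : ℝ × EuclideanSpace ℝ (Fin n) => (x - q.2) i + q.1 := by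
      fun_prop
    have hc2 : Continuous fun q : ℝ × EuclideanSpace ℝ (Fin n) =>
        ((x - q.2) i + q.1) ^ 2 / (4 * τ ^ 2) - 1 / (2 * τ) := by
      fun_prop
    refine ⟨fun σ => ∫ y, g y * (-(((x - y) i + σ) / (2 * τ)) *
      heatKernel ((x - y) + σ • EuclideanSpace.single i (1 : ℝ)) τ), .of_forall fun σ => ?_, ?_⟩
    · unfold heatEvolution
      simp_rw [hsub]
      refine hasDerivAt_integral_mul
        (k := fun σ y => heatKernel ((x - y) + σ • EuclideanSpace.single i (1 : ℝ)) τ)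
        (k' := fun σ y => -(((x - y) i + σ) / (2 * τ)) *
          heatKernel ((x - y) + σ • EuclideanSpace.single i (1 : ℝ)) τ) hg hg0 univ_mem
        hK.continuousOn ?_ fun t _ y => hasDerivAt_heatKernel_space _ τ i t
      exact ((hc.div_const _).neg.fun_mul hK).continuousOn
    · have := hasDerivAt_integral_mul (t₀ := 0)
        (k := fun σ y => -(((x - y) i + σ) / (2 * τ)) *
          heatKernel ((x - y) + σ • EuclideanSpace.single i (1 : ℝ)) τ)
        (k' := fun σ y => (((x - y) i + σ) ^ 2 / (4 * τ ^ 2) - 1 / (2 * τ)) *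
          heatKernel ((x - y) + σ • EuclideanSpace.single i (1 : ℝ)) τ) hg hg0 univ_mem
        ((hc.div_const _).neg.fun_mul hK).continuousOn
        (hc2.fun_mul hK).continuousOn
        fun t _ y => hasDerivAt_heatKernel_space_space _ hτ i t
      simpa using this
  · have hK : ContinuousOn (fun q : ℝ × EuclideanSpace ℝ (Fin n) => heatKernel (x - q.2) q.1)
        (Ioi 0 ×ˢ univ) :=
      continuousOn_heatKernel.comp
        (f := fun q : ℝ × EuclideanSpace ℝ (Fin n) => (x - q.2, q.1)) (by fun_prop)
        fun q hq => ⟨trivial, hq.1⟩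
    have hc : ContinuousOn (fun q : ℝ × EuclideanSpace ℝ (Fin n) =>
        ‖x - q.2‖ ^ 2 / (4 * q.1 ^ 2) - n / (2 * q.1)) (Ioi 0 ×ˢ univ) := by
      refine ContinuousOn.sub (ContinuousOn.div (by fun_prop) (by fun_prop) fun q hq => ?_)
        (ContinuousOn.div (by fun_prop) (by fun_prop) fun q hq => ?_)
      · have : (0 : ℝ) < q.1 := hq.1
        positivity
      · have : (0 : ℝ) < q.1 := hq.1
        positivity
    have := hasDerivAt_integral_mul (k := fun t y => heatKernel (x - y) t)
      (k' := fun t y => (‖x - y‖ ^ 2 / (4 * t ^ 2) - n / (2 * t)) * heatKernel (x - y) t)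
      hg hg0 (Ioi_mem_nhds hτ) hK (hc.fun_mul hK) fun t ht y => hasDerivAt_heatKernel_time _ ht
    refine this.congr_deriv ?_
    rw [← integral_finsetSum]
    · refine integral_congr_ae (.of_forall fun y => ?_)
      simp only
      rw [← Finset.mul_sum, ← Finset.sum_mul, Finset.sum_sub_distrib, ← Finset.sum_div,
        EuclideanSpace.real_norm_sq_eq]
      simp
      ring_nf
      simp
    · intro i _
      refine integrable_mul_of_support hg hg0 ?_
      exact Continuous.mul (by fun_prop) ((continuous_heatKernel τ).comp (by fun_prop))

lemma sub_le_heatEvolution (hg : Integrable g)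
    (hg0 : ∀ y ∉ closedBall (0 : EuclideanSpace ℝ (Fin n)) S, g y = 0) {L : ℝ} (hL : 0 ≤ L)
    {x : EuclideanSpace ℝ (Fin n)} (hx : ∀ y, g x - g y ≤ L * ‖x - y‖) {τ : ℝ} (hτ : 0 < τ) :
    g x - L * (2 * √τ * 2 ^ ((n : ℝ) / 2)) ≤ heatEvolution g x τ := by
  have hi1 : Integrable fun y => heatKernel (x - y) τ := (integrable_heatKernel hτ).comp_sub_left x
  have hi2 : Integrable fun y => heatKernel (x - y) (2 * τ) :=
    (integrable_heatKernel (by positivity)).comp_sub_left x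
  have h1 : ∫ y, heatKernel (x - y) τ = 1 := by
    rw [integral_sub_left_eq_self (fun z => heatKernel z τ), integral_heatKernel hτ]
  have h2 : ∫ y, heatKernel (x - y) (2 * τ) = 1 := by
    rw [integral_sub_left_eq_self (fun z => heatKernel z (2 * τ)),
      integral_heatKernel (by positivity)]
  have h3 : g x - L * (2 * √τ * 2 ^ ((n : ℝ) / 2)) = ∫ y, (g x * heatKernel (x - y) τ -
      L * (2 * √τ * 2 ^ ((n : ℝ) / 2)) * heatKernel (x - y) (2 * τ)) := by
    rw [integral_sub (hi1.const_mul _) (hi2.const_mul _), integral_const_mul, integral_const_mul,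
      h1, h2]
    ring
  rw [h3]
  refine integral_mono ((hi1.const_mul _).sub (hi2.const_mul _))
    (integrable_mul_of_support hg hg0 ((continuous_heatKernel τ).comp (by fun_prop))) fun y => ?_
  have h4 := mul_le_mul_of_nonneg_left (norm_mul_heatKernel_le (x - y) hτ) hL
  have h5 := mul_le_mul_of_nonneg_right (hx y) (heatKernel_nonneg (x - y) hτ)
  simp only
  linarith

end HeatEvolution

section Subsolution

variable {n : ℕ}

lemma gradient_apply_eq_fderiv_single (f : EuclideanSpace ℝ (Fin n) → ℝ)
    (x : EuclideanSpace ℝ (Fin n)) (i : Fin n) :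
    gradient f x i = fderiv ℝ f x (EuclideanSpace.single i 1) := by
  have h : inner ℝ (gradient f x) (EuclideanSpace.single i 1) =
      fderiv ℝ f x (EuclideanSpace.single i 1) := by
    rw [gradient, InnerProductSpace.toDual_symm_apply]
  rw [← h, EuclideanSpace.inner_single_right]
  simp

lemma ContDiffOn.hasSecondDerivAtZero_sq {f : EuclideanSpace ℝ (Fin n) → ℝ}
    {O : Set (EuclideanSpace ℝ (Fin n))} (hO : IsOpen O) (hf : ContDiffOn ℝ 2 f O)
    {x : EuclideanSpace ℝ (Fin n)} (hx : x ∈ O) (e : EuclideanSpace ℝ (Fin n)) :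
    HasSecondDerivAtZero (fun σ => f (x + σ • e) ^ 2)
      (2 * fderiv ℝ f x e ^ 2 + 2 * f x * fderiv ℝ (fun y => fderiv ℝ f y e) x e) := by
  have hline : ∀ σ : ℝ, HasDerivAt (fun σ : ℝ => x + σ • e) e σ := fun σ => by
    simpa using ((hasDerivAt_id σ).smul_const e).const_add x
  have hd : ∀ y ∈ O, DifferentiableAt ℝ f y := fun y hy =>
    ((hf y hy).contDiffAt (hO.mem_nhds hy)).differentiableAt (by norm_num)
  have hder : ∀ σ : ℝ, x + σ • e ∈ O →
      HasDerivAt (fun σ : ℝ => f (x + σ • e)) (fderiv ℝ f (x + σ • e) e) σ := fun σ hσ =>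
    (hd _ hσ).hasFDerivAt.comp_hasDerivAt σ (hline σ)
  have h2 : DifferentiableAt ℝ (fun y => fderiv ℝ f y e) (x + (0 : ℝ) • e) := by
    have h3 : ContDiffOn ℝ 1 (fderiv ℝ f) O := hf.fderiv_of_isOpen hO (by norm_num)
    have h4 : DifferentiableAt ℝ (fderiv ℝ f) x :=
      ((h3 x hx).contDiffAt (hO.mem_nhds hx)).differentiableAt (by norm_num)
    simpa using h4.clm_apply (differentiableAt_const e)
  refine ⟨fun σ => 2 * f (x + σ • e) * fderiv ℝ f (x + σ • e) e, ?_, ?_⟩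
  · have hnear : ∀ᶠ σ : ℝ in 𝓝 0, x + σ • e ∈ O :=
      (hline 0).continuousAt.preimage_mem_nhds (hO.mem_nhds (by simpa using hx))
    filter_upwards [hnear] with σ hσ
    refine ((hder σ hσ).pow 2).congr_deriv ?_
    simp
  · have h5 := (h2.hasFDerivAt.comp_hasDerivAt 0 (hline 0))
    have h6 := ((hder 0 (by simpa using hx)).const_mul 2).mul h5
    refine h6.congr_deriv ?_
    simp
    ring

lemma exists_subsolution_derivs_sq {u : EuclideanSpace ℝ (Fin n) → ℝ → ℝ}
    {O : Set (EuclideanSpace ℝ (Fin n))} (hO : IsOpen O) {I : Set ℝ} {R s : ℝ}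
    {x : EuclideanSpace ℝ (Fin n)} (hx : x ∈ O) (hs : s ∈ I)
    (hspace : ContDiffOn ℝ 2 (fun y => u y s) O) (htime : ContDiffOn ℝ 1 (u x) I)
    (hpde : |slap (fun y => u y s) x + derivWithin (u x) I s| ≤
      R ^ 2 * |u x s| + R * ‖gradient (fun y => u y s) x‖) :
    ∃ (q : Fin n → ℝ) (p : ℝ),
      (∀ i, HasSecondDerivAtZero
        (fun σ => u (x + σ • EuclideanSpace.single i 1) s ^ 2) (q i)) ∧
      HasDerivWithinAt (fun s => u x s ^ 2) p I s ∧
      0 ≤ 3 * R ^ 2 * u x s ^ 2 + p + ∑ i, q i := by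
  refine ⟨_, _, fun i => hspace.hasSecondDerivAtZero_sq hO hx _,
    ((htime.differentiableOn (by norm_num) s hs).hasDerivWithinAt).pow 2, ?_⟩
  rw [Finset.sum_add_distrib, ← Finset.mul_sum, ← Finset.mul_sum]
  have hG : ∑ i, fderiv ℝ (fun y => u y s) x (EuclideanSpace.single i 1) ^ 2 =
      ‖gradient (fun y => u y s) x‖ ^ 2 := by
    rw [EuclideanSpace.real_norm_sq_eq]
    simp_rw [gradient_apply_eq_fderiv_single]
  have hL : ∑ i, fderiv ℝ (fun y => fderiv ℝ (fun y => u y s) y (EuclideanSpace.single i 1)) x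
      (EuclideanSpace.single i 1) = slap (fun y => u y s) x := rfl
  rw [hG, hL]
  set G := ‖gradient (fun y => u y s) x‖
  set A := slap (fun y => u y s) x + derivWithin (u x) I s with hA
  have h1 : |u x s * A| ≤ |u x s| * (R ^ 2 * |u x s| + R * G) := by
    rw [abs_mul]; gcongr
  have h2 := (abs_le.1 h1).1
  have h3 : |u x s| ^ 2 = u x s ^ 2 := sq_abs _
  have h4 : u x s * A = u x s * slap (fun y => u y s) x + u x s * derivWithin (u x) I s := by
    rw [hA]; ring
  simp only [Nat.cast_ofNat, Nat.add_one_sub_one, pow_one]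
  nlinarith [sq_nonneg (2 * G - R * |u x s|), sq_nonneg (R * |u x s|)]

lemma hasSecondDerivAtZero_exp_norm_sq (x : EuclideanSpace ℝ (Fin n)) (i : Fin n) (m c : ℝ) :
    HasSecondDerivAtZero
      (fun σ => rexp (m * ‖x + σ • EuclideanSpace.single i (1 : ℝ)‖ ^ 2 + c))
      ((4 * m ^ 2 * x i ^ 2 + 2 * m) * rexp (m * ‖x‖ ^ 2 + c)) := by
  have h1 : ∀ σ : ℝ, HasDerivAt
      (fun σ : ℝ => rexp (m * ‖x + σ • EuclideanSpace.single i (1 : ℝ)‖ ^ 2 + c))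
      (rexp (m * ‖x + σ • EuclideanSpace.single i (1 : ℝ)‖ ^ 2 + c) * (m * (2 * (x i + σ)))) σ :=
    fun σ => (((hasDerivAt_norm_add_smul_single_sq x i σ).const_mul m).add_const c).exp
  refine ⟨_, .of_forall h1, ?_⟩
  have h2 : HasDerivAt (fun σ : ℝ => m * (2 * (x i + σ))) (m * (2 * 1)) 0 :=
    (((hasDerivAt_id (0 : ℝ)).const_add (x i)).const_mul 2).const_mul m
  refine ((h1 0).mul h2).congr_deriv ?_
  simp
  ring

/-- Comparison of a subsolution of the backward heat equation on a cylinder with the heat evolution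
of its final value plus an exponential barrier. -/
lemma subsolution_le_heatEvolution_add_barrier {z : EuclideanSpace ℝ (Fin n) → ℝ → ℝ}
    {g : EuclideanSpace ℝ (Fin n) → ℝ} {r T S L m κ δ : ℝ} (hT : 0 ≤ T) (hL : 0 ≤ L) (hm : 0 ≤ m)
    (hδ : 0 < δ) (hκ : 4 * m ^ 2 * r ^ 2 + 2 * n * m < κ)
    (hz : ContinuousOn (Function.uncurry z) (closedBall 0 r ×ˢ Icc 0 T))
    (hz1 : ∀ x, ‖x‖ = r → ∀ s ∈ Icc 0 T, z x s ≤ 1)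
    (hsub : ∀ x ∈ ball 0 r, ∀ s ∈ Ico 0 T, ∃ (q : Fin n → ℝ) (p : ℝ),
      (∀ i, HasSecondDerivAtZero
        (fun σ => z (x + σ • EuclideanSpace.single i 1) s) (q i)) ∧
      HasDerivWithinAt (z x) p (Icc s T) s ∧ 0 ≤ p + ∑ i, q i)
    (hg : Integrable g) (hg0 : ∀ y ∉ closedBall (0 : EuclideanSpace ℝ (Fin n)) S, g y = 0)
    (hgnn : ∀ y, 0 ≤ g y) (hzg : ∀ x ∈ closedBall 0 r, z x T = g x)
    (hlip : ∀ x ∈ closedBall 0 r, ∀ y, g x - g y ≤ L * ‖x - y‖)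
    {x : EuclideanSpace ℝ (Fin n)} (hx : x ∈ closedBall 0 r) :
    z x 0 ≤ heatEvolution g x (T + δ) + rexp (m * ‖x‖ ^ 2 + (κ * T - m * r ^ 2)) +
      L * (2 * √δ * 2 ^ ((n : ℝ) / 2)) := by
  have hε : 0 ≤ L * (2 * √δ * 2 ^ ((n : ℝ) / 2)) := by positivity
  have hnr : (0 : ℝ) ≤ n := Nat.cast_nonneg n
  have hκ0 : 0 < κ := lt_of_le_of_lt (by positivity) hκ
  have key := backward_heat_maximum_principle (r := r) (T := T) (F := fun x s =>
    z x s - heatEvolution g x (T + δ - s) - rexp (m * ‖x‖ ^ 2 + (κ * (T - s) - m * r ^ 2)) -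
      L * (2 * √δ * 2 ^ ((n : ℝ) / 2))) ?_ ?_ ?_ ?_ x hx 0 ⟨le_rfl, hT⟩
  · simp only [sub_zero] at key
    linarith
  · refine ((hz.sub ?_).sub ?_).sub continuousOn_const
    · exact (continuousOn_heatEvolution hg hg0).comp
        (f := fun p : EuclideanSpace ℝ (Fin n) × ℝ => (p.1, T + δ - p.2)) (by fun_prop)
        fun p hp => ⟨trivial, show 0 < T + δ - p.2 by linarith [hp.2.2]⟩
    · exact Continuous.continuousOn (by fun_prop)
  · intro y hy s hs
    have h1 := heatEvolution_nonneg hgnn y (τ := T + δ - s) (by linarith [hs.2])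
    have h2 : 1 ≤ rexp (m * ‖y‖ ^ 2 + (κ * (T - s) - m * r ^ 2)) := by
      rw [Real.one_le_exp_iff, hy]
      have := mul_nonneg hκ0.le (sub_nonneg.2 hs.2)
      linarith
    linarith [hz1 y hy s hs]
  · intro y hy
    have h1 := sub_le_heatEvolution hg hg0 hL (hlip y hy) hδ
    have h2 := Real.exp_pos (m * ‖y‖ ^ 2 + (κ * (T - T) - m * r ^ 2))
    have h3 := hzg y hy
    simp only [add_sub_cancel_left]
    linarith
  · intro y hy s hs
    obtain ⟨q, p, hq, hp, hpq⟩ := hsub y hy s hs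
    obtain ⟨qW, hqW, hpW⟩ := heatEvolution_solves hg hg0 y (τ := T + δ - s) (by linarith [hs.2])
    have hB := fun i => hasSecondDerivAtZero_exp_norm_sq y i m (κ * (T - s) - m * r ^ 2)
    have hW' : HasDerivAt (fun s => heatEvolution g y (T + δ - s)) (-∑ i, qW i) s := by
      simpa using hpW.comp_const_sub (T + δ) s
    have hB' : HasDerivAt (fun s => rexp (m * ‖y‖ ^ 2 + (κ * (T - s) - m * r ^ 2)))
        (rexp (m * ‖y‖ ^ 2 + (κ * (T - s) - m * r ^ 2)) * -κ) s := by
      have := (((((hasDerivAt_id s).const_sub T).const_mul κ).sub_const (m * r ^ 2)).const_add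
        (m * ‖y‖ ^ 2)).exp
      simpa using this
    refine ⟨_, _, fun i => (((hq i).sub (hqW i)).sub (hB i)).sub (.const _),
      ((hp.sub hW'.hasDerivWithinAt).sub hB'.hasDerivWithinAt).sub_const _, ?_⟩
    have hn : ∑ i, y i ^ 2 = ‖y‖ ^ 2 := (EuclideanSpace.real_norm_sq_eq y).symm
    simp only [sub_zero, Finset.sum_sub_distrib, ← Finset.sum_mul, Finset.sum_add_distrib,
      ← Finset.mul_sum, hn, Finset.sum_const, Finset.card_univ, Fintype.card_fin, nsmul_eq_mul]
    have hyr : ‖y‖ ^ 2 ≤ r ^ 2 := by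
      have : ‖y‖ < r := by simpa using hy
      gcongr
    have hneg : 0 < κ - (4 * m ^ 2 * ‖y‖ ^ 2 + n * (2 * m)) := by
      have : 4 * m ^ 2 * ‖y‖ ^ 2 ≤ 4 * m ^ 2 * r ^ 2 := by gcongr
      linarith
    have := mul_pos hneg (Real.exp_pos (m * ‖y‖ ^ 2 + (κ * (T - s) - m * r ^ 2)))
    linarith

end Subsolution

lemma exp_mul_setIntegral_sq_le {n : ℕ} {ρ R : ℝ} (hρ : ρ ∈ Ioc (0 : ℝ) 1) (hR : 0 < R)
    (hρR : 1 ≤ ρ * R) {u : EuclideanSpace ℝ (Fin n) → ℝ → ℝ}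
    (hspace : ∀ t ∈ Icc (0 : ℝ) (1 / R ^ 2),
      ContDiffOn ℝ 2 (fun x => u x t) (ball (0 : EuclideanSpace ℝ (Fin n)) 4))
    (htime : ∀ x ∈ ball (0 : EuclideanSpace ℝ (Fin n)) 4,
      ContDiffOn ℝ 1 (u x) (Icc (0 : ℝ) (1 / R ^ 2)))
    (hpde : ∀ x ∈ ball (0 : EuclideanSpace ℝ (Fin n)) 4, ∀ t ∈ Icc (0 : ℝ) (1 / R ^ 2),
      |slap (fun y => u y t) x + derivWithin (u x) (Icc (0 : ℝ) (1 / R ^ 2)) t| ≤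
        R ^ 2 * |u x t| + R * ‖gradient (fun y => u y t) x‖)
    (hu : ∀ x ∈ ball (0 : EuclideanSpace ℝ (Fin n)) 4, ∀ t ∈ Icc (0 : ℝ) (1 / R ^ 2),
      |u x t| ≤ 1)
    (hgrad : ∀ x ∈ ball (0 : EuclideanSpace ℝ (Fin n)) 4, ∀ t ∈ Icc (0 : ℝ) (1 / R ^ 2),
      ‖gradient (fun y => u y t) x‖ ≤ R)
    {T : ℝ} (hT0 : 0 < T) (hT : T ≤ 1 / R ^ 2) :
    rexp (-3) * ∫ x in ball (0 : EuclideanSpace ℝ (Fin n)) ρ, u x 0 ^ 2 ≤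
      (∫ x in ball (0 : EuclideanSpace ℝ (Fin n)) (2 * ρ), u x T ^ 2) +
        rexp (2 * n + 10 - ρ * R) * volume.real (ball (0 : EuclideanSpace ℝ (Fin n)) ρ) := by
  obtain ⟨hρ0, hρ1⟩ := hρ
  have hRT : R ^ 2 * T ≤ 1 := by
    rwa [le_div_iff₀ (by positivity), mul_comm] at hT
  have hTmem : T ∈ Icc (0 : ℝ) (1 / R ^ 2) := ⟨hT0.le, hT⟩
  have h0mem : (0 : ℝ) ∈ Icc (0 : ℝ) (1 / R ^ 2) := ⟨le_rfl, by positivity⟩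
  have hsubT : Icc 0 T ⊆ Icc (0 : ℝ) (1 / R ^ 2) := Icc_subset_Icc_right hT
  have hu2 : ∀ x ∈ ball (0 : EuclideanSpace ℝ (Fin n)) 4, ∀ t ∈ Icc (0 : ℝ) (1 / R ^ 2),
      u x t ^ 2 ≤ 1 := fun x hx t ht => by
    rw [← sq_abs]; exact pow_le_one₀ (abs_nonneg _) (hu x hx t ht)
  have hlip : ∀ t ∈ Icc (0 : ℝ) (1 / R ^ 2), ∀ x ∈ ball (0 : EuclideanSpace ℝ (Fin n)) 4,
      ∀ y ∈ ball (0 : EuclideanSpace ℝ (Fin n)) 4, ‖u x t - u y t‖ ≤ R * ‖x - y‖ := by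
    intro t ht x hx y hy
    refine (convex_ball _ _).norm_image_sub_le_of_norm_fderiv_le (𝕜 := ℝ)
      (f := fun x => u x t) (fun w hw => ?_) (fun w hw => ?_) hy hx
    · exact ((hspace t ht w hw).contDiffAt (isOpen_ball.mem_nhds hw)).differentiableAt
        (by norm_num)
    · have := hgrad w hw t ht
      rwa [gradient, LinearIsometryEquiv.norm_map] at this
  have hcont : ContinuousOn (Function.uncurry u)
      (ball (0 : EuclideanSpace ℝ (Fin n)) 4 ×ˢ Icc (0 : ℝ) (1 / R ^ 2)) := by
    refine continuousOn_prod_of_continuousOn_lipschitzOnWith _ ⟨R, hR.le⟩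
      (fun x hx => (htime x hx).continuousOn) fun t ht => ?_
    refine LipschitzOnWith.of_dist_le_mul fun x hx y hy => ?_
    rw [dist_eq_norm, dist_eq_norm]
    exact hlip t ht x hx y hy
  have hint : ∀ t ∈ Icc (0 : ℝ) (1 / R ^ 2), ∀ a < 4,
      IntegrableOn (fun x => u x t ^ 2) (ball (0 : EuclideanSpace ℝ (Fin n)) a) := by
    intro t ht a ha
    refine (ContinuousOn.integrableOn_compact (isCompact_closedBall 0 a) ?_).mono_set
      ball_subset_closedBall
    exact ((hspace t ht).continuousOn.mono (closedBall_subset_ball ha)).pow 2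
  set g : EuclideanSpace ℝ (Fin n) → ℝ := (ball 0 (2 * ρ)).indicator fun x => u x T ^ 2 with hg
  have hgint : Integrable g := (integrable_indicator_iff measurableSet_ball).2
    (hint T hTmem (2 * ρ) (by linarith))
  have hg0 : ∀ y ∉ closedBall (0 : EuclideanSpace ℝ (Fin n)) (2 * ρ), g y = 0 := fun y hy =>
    indicator_of_notMem (fun h => hy (ball_subset_closedBall h)) _
  have hgnn : ∀ y, 0 ≤ g y := indicator_nonneg fun y _ => sq_nonneg _
  have hr4 : closedBall (0 : EuclideanSpace ℝ (Fin n)) (3 / 2 * ρ) ⊆ ball 0 4 :=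
    closedBall_subset_ball (by linarith)
  have hgeq : ∀ x ∈ closedBall (0 : EuclideanSpace ℝ (Fin n)) (3 / 2 * ρ), g x = u x T ^ 2 :=
    fun x hx => indicator_of_mem (closedBall_subset_ball (by linarith) hx) _
  have hglip : ∀ x ∈ closedBall (0 : EuclideanSpace ℝ (Fin n)) (3 / 2 * ρ), ∀ y,
      g x - g y ≤ (2 * R + 2 / ρ) * ‖x - y‖ := by
    intro x hx y
    rw [hgeq x hx]
    have h1 := hu x (hr4 hx) T hTmem
    by_cases hy : y ∈ ball (0 : EuclideanSpace ℝ (Fin n)) (2 * ρ)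
    · have hy4 : y ∈ ball (0 : EuclideanSpace ℝ (Fin n)) 4 := ball_subset_ball (by linarith) hy
      have h2 := hu y hy4 T hTmem
      have h3 := hlip T hTmem x (hr4 hx) y hy4
      rw [hg, indicator_of_mem hy]
      calc u x T ^ 2 - u y T ^ 2 ≤ |(u x T - u y T) * (u x T + u y T)| := by
            refine le_trans (le_of_eq (by ring)) (le_abs_self _)
        _ ≤ (R * ‖x - y‖) * 2 := by
            rw [abs_mul]
            exact mul_le_mul h3 ((abs_add_le _ _).trans (by linarith)) (abs_nonneg _)
              (by positivity)
        _ ≤ (2 * R + 2 / ρ) * ‖x - y‖ := by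
            have : 0 ≤ 2 / ρ * ‖x - y‖ := by positivity
            linarith
    · rw [hg, indicator_of_notMem hy, sub_zero]
      rw [mem_ball_zero_iff, not_lt] at hy
      rw [mem_closedBall_zero_iff] at hx
      have h2 : ρ / 2 ≤ ‖x - y‖ := by
        have := norm_sub_norm_le y x
        rw [norm_sub_rev] at this
        linarith
      calc u x T ^ 2 ≤ 1 := hu2 x (hr4 (by simpa using hx)) T hTmem
        _ = 2 / ρ * (ρ / 2) := by field_simp
        _ ≤ 2 / ρ * ‖x - y‖ := by gcongr
        _ ≤ (2 * R + 2 / ρ) * ‖x - y‖ := by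
            have : 0 ≤ R * ‖x - y‖ := by positivity
            linarith
  have hcompare : ∀ δ > 0, ∀ x ∈ ball (0 : EuclideanSpace ℝ (Fin n)) ρ,
      rexp (-3) * u x 0 ^ 2 ≤ heatEvolution g x (T + δ) + (rexp (2 * n + 10 - ρ * R) +
        (2 * R + 2 / ρ) * (2 * √δ * 2 ^ ((n : ℝ) / 2))) := by
    intro δ hδ x hx
    have hxn : ‖x‖ < ρ := by simpa using hx
    have hxr : x ∈ closedBall (0 : EuclideanSpace ℝ (Fin n)) (3 / 2 * ρ) := by
      rw [mem_closedBall_zero_iff]; linarith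
    have key := subsolution_le_heatEvolution_add_barrier
      (z := fun x s => rexp (3 * R ^ 2 * (s - T)) * u x s ^ 2) (g := g) (r := 3 / 2 * ρ) (T := T)
      (S := 2 * ρ) (L := 2 * R + 2 / ρ) (m := R / ρ) (κ := (2 * n + 10) * R ^ 2) (δ := δ) hT0.le
      (by positivity) (by positivity) hδ ?_ ?_ ?_ ?_ hgint hg0 hgnn ?_ hglip hxr
    · have h1 : rexp (-3) ≤ rexp (3 * R ^ 2 * (0 - T)) := Real.exp_le_exp.2 (by linarith)
      have h2 := mul_le_mul_of_nonneg_right h1 (sq_nonneg (u x 0))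
      have h3 : rexp (R / ρ * ‖x‖ ^ 2 + ((2 * n + 10) * R ^ 2 * T - R / ρ * (3 / 2 * ρ) ^ 2)) ≤
          rexp (2 * n + 10 - ρ * R) := by
        refine Real.exp_le_exp.2 ?_
        have h4 : R / ρ * ‖x‖ ^ 2 ≤ R / ρ * ρ ^ 2 := by gcongr
        have h5 : R / ρ * ρ ^ 2 = ρ * R := by field_simp
        have h6 : R / ρ * (3 / 2 * ρ) ^ 2 = 9 / 4 * (ρ * R) := by field_simp; ring
        have h7 : (2 * n + 10 : ℝ) * (R ^ 2 * T) ≤ (2 * n + 10) * 1 := by gcongr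
        linarith
      linarith
    · have h1 : 4 * (R / ρ) ^ 2 * (3 / 2 * ρ) ^ 2 = 9 * R ^ 2 := by field_simp; ring
      have h2 : R / ρ ≤ R ^ 2 := by
        rw [div_le_iff₀ hρ0]; nlinarith
      have h3 : 2 * (n : ℝ) * (R / ρ) ≤ 2 * n * R ^ 2 := by gcongr
      have h4 : 0 < R ^ 2 := by positivity
      linarith
    · refine ContinuousOn.mul (Continuous.continuousOn (by fun_prop)) ?_
      exact (hcont.mono (prod_mono hr4 hsubT)).pow 2
    · intro y hy s hs
      have hy4 : y ∈ ball (0 : EuclideanSpace ℝ (Fin n)) 4 := hr4 (by simpa using hy.le)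
      refine mul_le_one₀ (Real.exp_le_one_iff.2 ?_) (sq_nonneg _) (hu2 y hy4 s (hsubT hs))
      exact mul_nonpos_of_nonneg_of_nonpos (by positivity) (by linarith [hs.2])
    · intro y hy s hs
      have hy4 : y ∈ ball (0 : EuclideanSpace ℝ (Fin n)) 4 := hr4 (ball_subset_closedBall hy)
      have hs' : s ∈ Icc (0 : ℝ) (1 / R ^ 2) := hsubT ⟨hs.1, hs.2.le⟩
      obtain ⟨q, p, hq, hp, hpq⟩ := exists_subsolution_derivs_sq isOpen_ball hy4 hs'
        (hspace s hs') (htime y hy4) (hpde y hy4 s hs')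
      have hE : HasDerivAt (fun s => rexp (3 * R ^ 2 * (s - T)))
          (rexp (3 * R ^ 2 * (s - T)) * (3 * R ^ 2)) s := by
        simpa using (((hasDerivAt_id s).sub_const T).const_mul (3 * R ^ 2)).exp
      refine ⟨_, _, fun i => (hq i).const_mul _, hE.hasDerivWithinAt.mul
        (hp.mono (Icc_subset_Icc hs.1 hT)), ?_⟩
      rw [← Finset.mul_sum]
      have := mul_nonneg (Real.exp_pos (3 * R ^ 2 * (s - T))).le hpq
      linarith
    · intro y hy
      simp [hgeq y hy]
  have hgI : ∫ y, g y = ∫ x in ball (0 : EuclideanSpace ℝ (Fin n)) (2 * ρ), u x T ^ 2 :=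
    integral_indicator measurableSet_ball
  have hint0 := hint 0 h0mem ρ (by linarith)
  have hδbound : ∀ δ > 0, rexp (-3) * ∫ x in ball (0 : EuclideanSpace ℝ (Fin n)) ρ, u x 0 ^ 2 ≤
      (∫ x in ball (0 : EuclideanSpace ℝ (Fin n)) (2 * ρ), u x T ^ 2) +
        (rexp (2 * n + 10 - ρ * R) + (2 * R + 2 / ρ) * (2 * √δ * 2 ^ ((n : ℝ) / 2))) *
          volume.real (ball (0 : EuclideanSpace ℝ (Fin n)) ρ) := by
    intro δ hδ
    have hTδ : 0 < T + δ := by linarith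
    have hW := heatEvolution_integrable hgint hTδ
    have hconst : IntegrableOn (fun _ : EuclideanSpace ℝ (Fin n) => rexp (2 * n + 10 - ρ * R) +
        (2 * R + 2 / ρ) * (2 * √δ * 2 ^ ((n : ℝ) / 2))) (ball 0 ρ) :=
      integrableOn_const measure_ball_lt_top.ne
    rw [← integral_const_mul]
    refine (setIntegral_mono_on (hint0.const_mul _) (hW.integrableOn.add hconst)
      measurableSet_ball (hcompare δ hδ)).trans ?_
    simp only [Pi.add_apply]
    rw [integral_add hW.integrableOn hconst, setIntegral_const, smul_eq_mul, mul_comm]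
    gcongr
    rw [← hgI, ← integral_heatEvolution hgint hTδ]
    exact setIntegral_le_integral hW (.of_forall fun x => heatEvolution_nonneg hgnn x hTδ)
  have hlim : Tendsto (fun δ : ℝ =>
      (∫ x in ball (0 : EuclideanSpace ℝ (Fin n)) (2 * ρ), u x T ^ 2) +
        (rexp (2 * n + 10 - ρ * R) + (2 * R + 2 / ρ) * (2 * √δ * 2 ^ ((n : ℝ) / 2))) *
          volume.real (ball (0 : EuclideanSpace ℝ (Fin n)) ρ)) (𝓝[>] 0)
      (𝓝 ((∫ x in ball (0 : EuclideanSpace ℝ (Fin n)) (2 * ρ), u x T ^ 2) +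
        rexp (2 * n + 10 - ρ * R) * volume.real (ball (0 : EuclideanSpace ℝ (Fin n)) ρ))) := by
    refine tendsto_nhdsWithin_of_tendsto_nhds (Continuous.tendsto' (by fun_prop) _ _ ?_)
    simp
  exact ge_of_tendsto hlim (by filter_upwards [self_mem_nhdsWithin] with δ hδ using hδbound δ hδ)

/-- there is a constant `N = N(n,θ)` such that whenever `θ, ρ ∈ (0,1]`,
`R > 0` and `u` is `C^{2,1}` on `B₄ × [0,1/R²]` with `|Δu + ∂ₜu| ≤ R²|u| + R|∇u|`,
`‖u‖_∞ ≤ 1`, `‖∇u‖_∞ ≤ R` there and `‖u(·,0)‖_{L²(B_ρ)} ≥ θ R^{-n/2}`, one has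
`√N ‖u(·,t)‖_{L²(B_{2ρ})} ≥ R^{-n/2}` for `0 < t ≤ 1/R²` and `R > N/ρ`. -/
theorem stmt_4 (n : ℕ) : ∀ θ : ℝ, θ ∈ Ioc (0 : ℝ) 1 →
    ∃ N > 0, ∀ ρ : ℝ, ρ ∈ Ioc (0 : ℝ) 1 → ∀ R : ℝ, 0 < R →
    ∀ u : EuclideanSpace ℝ (Fin n) → ℝ → ℝ,
    (∀ t ∈ Icc (0 : ℝ) (1 / R ^ 2),
      ContDiffOn ℝ 2 (fun x => u x t) (ball (0 : EuclideanSpace ℝ (Fin n)) 4)) →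
    (∀ x ∈ ball (0 : EuclideanSpace ℝ (Fin n)) 4,
      ContDiffOn ℝ 1 (u x) (Icc (0 : ℝ) (1 / R ^ 2))) →
    (∀ x ∈ ball (0 : EuclideanSpace ℝ (Fin n)) 4, ∀ t ∈ Icc (0 : ℝ) (1 / R ^ 2),
      |slap (fun y => u y t) x + derivWithin (u x) (Icc (0 : ℝ) (1 / R ^ 2)) t| ≤
        R ^ 2 * |u x t| + R * ‖gradient (fun y => u y t) x‖) →
    (∀ x ∈ ball (0 : EuclideanSpace ℝ (Fin n)) 4, ∀ t ∈ Icc (0 : ℝ) (1 / R ^ 2),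
      |u x t| ≤ 1) →
    (∀ x ∈ ball (0 : EuclideanSpace ℝ (Fin n)) 4, ∀ t ∈ Icc (0 : ℝ) (1 / R ^ 2),
      ‖gradient (fun y => u y t) x‖ ≤ R) →
    Real.sqrt (∫ x in ball (0 : EuclideanSpace ℝ (Fin n)) ρ, u x 0 ^ 2) ≥
      θ * R ^ (-(n : ℝ) / 2) →
    ∀ t : ℝ, 0 < t → t ≤ 1 / R ^ 2 → N / ρ < R →
      Real.sqrt N *
          Real.sqrt (∫ x in ball (0 : EuclideanSpace ℝ (Fin n)) (2 * ρ), u x t ^ 2) ≥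
        R ^ (-(n : ℝ) / 2) := by
  rintro θ ⟨hθ0, -⟩
  set ω := volume.real (ball (0 : EuclideanSpace ℝ (Fin n)) 1) with hω
  have hω0 : 0 ≤ ω := measureReal_nonneg
  obtain ⟨N₁, hN₁⟩ := eventually_atTop.1 ((Real.tendsto_pow_mul_exp_neg_atTop_nhds_zero n).eventually
    (eventually_le_nhds (show 0 < rexp (-3) * θ ^ 2 / (2 * (rexp (2 * n + 10) * (ω + 1))) by
      positivity)))
  refine ⟨max N₁ (max 1 (2 * rexp 3 / θ ^ 2)), lt_max_of_lt_right (lt_max_of_lt_left one_pos), ?_⟩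
  set N := max N₁ (max 1 (2 * rexp 3 / θ ^ 2)) with hN
  have hNN₁ : N₁ ≤ N := le_max_left _ _
  have hN1 : 1 ≤ N := (le_max_left _ _).trans (le_max_right _ _)
  have hNθ : 2 * rexp 3 / θ ^ 2 ≤ N := (le_max_right _ _).trans (le_max_right _ _)
  intro ρ hρ R hR u hspace htime hpde hu hgrad hmass t ht0 ht hNR
  have hNρR : N < ρ * R := by
    rwa [div_lt_iff₀ hρ.1, mul_comm] at hNR
  have hest := exp_mul_setIntegral_sq_le hρ hR (hN1.trans hNρR.le) hspace htime hpde hu hgrad ht0 ht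
  set I := ∫ x in ball (0 : EuclideanSpace ℝ (Fin n)) (2 * ρ), u x t ^ 2 with hI
  have hI0 : 0 ≤ I := integral_nonneg fun x => sq_nonneg _
  have hRn : (R ^ (-(n : ℝ) / 2)) ^ 2 = (R ^ n)⁻¹ := by
    rw [← Real.rpow_natCast, ← Real.rpow_mul hR.le, ← Real.rpow_natCast, ← Real.rpow_neg hR.le]
    congr 1; push_cast; ring
  have hmass' : θ ^ 2 * (R ^ n)⁻¹ ≤
      ∫ x in ball (0 : EuclideanSpace ℝ (Fin n)) ρ, u x 0 ^ 2 := by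
    rw [← hRn, ← mul_pow]
    exact (Real.le_sqrt' (by positivity)).1 hmass
  have hvol : volume.real (ball (0 : EuclideanSpace ℝ (Fin n)) ρ) = ρ ^ n * ω := by
    rw [Measure.real, Measure.addHaar_ball_of_pos _ _ hρ.1, ENNReal.toReal_mul,
      finrank_euclideanSpace_fin, ENNReal.toReal_ofReal (by have := hρ.1; positivity)]
    rfl
  have htail : rexp (2 * n + 10 - ρ * R) * volume.real (ball (0 : EuclideanSpace ℝ (Fin n)) ρ) ≤
      rexp (-3) * θ ^ 2 / 2 * (R ^ n)⁻¹ := by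
    have h1 := hN₁ (ρ * R) (hNN₁.trans hNρR.le)
    rw [le_div_iff₀ (by positivity)] at h1
    have h2 : rexp (2 * n + 10 - ρ * R) * (ρ ^ n * ω) =
        ((ρ * R) ^ n * rexp (-(ρ * R))) * (rexp (2 * n + 10) * ω) * (R ^ n)⁻¹ := by
      rw [sub_eq_add_neg, Real.exp_add, mul_pow]; field_simp
    rw [hvol, h2]
    gcongr
    have h3 : 0 ≤ (ρ * R) ^ n * rexp (-(ρ * R)) * rexp (2 * n + 10) := by
      have := hρ.1
      positivity
    linarith
  have hIlow : rexp (-3) * θ ^ 2 / 2 * (R ^ n)⁻¹ ≤ I := by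
    have := mul_le_mul_of_nonneg_left hmass' (Real.exp_pos (-3)).le
    linarith
  rw [ge_iff_le, ← Real.sqrt_mul (by linarith)]
  refine Real.le_sqrt_of_sq_le ?_
  rw [hRn]
  calc (R ^ n)⁻¹ = 2 * rexp 3 / θ ^ 2 * (rexp (-3) * θ ^ 2 / 2 * (R ^ n)⁻¹) := by
        rw [Real.exp_neg]; field_simp
    _ ≤ N * I := by gcongr
end

section
/- For every h ∈ C_0^∞(ℝ^n) (smooth, compactly supported) and every a > 0, one has ∫_{ℝ^n} (|x|^2/(8a)) h(x)^2 e^{-|x|^2/(4a)} dx ≤ 2a ∫_{ℝ^n} |∇h(x)|^2 e^{-|x|^2/(4a)} dx + (n/2) ∫_{ℝ^n} h(x)^2 e^{-|x|^2/(4a)} dx. -/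
open MeasureTheory Real Set Metric

/-- The Euler vector field `x ↦ x` has divergence `card ι`, in integrated form. -/
theorem integral_fderiv_apply_self {ι : Type*} [Fintype ι]
    {g : EuclideanSpace ℝ ι → ℝ} (hg : ContDiff ℝ 1 g) (hc : HasCompactSupport g) :
    ∫ x, fderiv ℝ g x x = -(Fintype.card ι : ℝ) * ∫ x, g x := by
  classical
  have hfd : Continuous (fderiv ℝ g) := hg.continuous_fderiv one_ne_zero
  have hcfd : HasCompactSupport (fderiv ℝ g) := hc.fderiv ℝ
  have hcv (v : EuclideanSpace ℝ ι) : HasCompactSupport fun x ↦ fderiv ℝ g x v :=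
    hcfd.comp_left (g := fun L : EuclideanSpace ℝ ι →L[ℝ] ℝ ↦ L v) rfl
  have hint (i : ι) : Integrable fun x : EuclideanSpace ℝ ι ↦
      x i * fderiv ℝ g x (EuclideanSpace.single i 1) :=
    Continuous.integrable_of_hasCompactSupport (by fun_prop) (hcv _).mul_left
  have hcoord (i : ι) (x : EuclideanSpace ℝ ι) :
      HasFDerivAt (𝕜 := ℝ) (fun y : EuclideanSpace ℝ ι ↦ y i)
        (EuclideanSpace.proj i : EuclideanSpace ℝ ι →L[ℝ] ℝ) x :=
    (EuclideanSpace.proj i : EuclideanSpace ℝ ι →L[ℝ] ℝ).hasFDerivAt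
  have hone (i : ι) (x : EuclideanSpace ℝ ι) :
      fderiv ℝ (fun y : EuclideanSpace ℝ ι ↦ y i) x (EuclideanSpace.single i 1) = 1 := by
    simp [(hcoord i x).fderiv]
  have hparts (i : ι) :
      ∫ x : EuclideanSpace ℝ ι, x i * fderiv ℝ g x (EuclideanSpace.single i 1) =
        -∫ x, g x := by
    rw [integral_mul_fderiv_eq_neg_fderiv_mul_of_integrable _ (hint i) _
      (fun x _ ↦ (hcoord i x).differentiableAt)
      (fun x _ ↦ hg.differentiable one_ne_zero x)]
    · simp [hone]
    · simpa [hone] using hg.continuous.integrable_of_hasCompactSupport hc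
    · exact Continuous.integrable_of_hasCompactSupport
        (by have := hg.continuous; fun_prop) hc.mul_left
  have hsum (x : EuclideanSpace ℝ ι) :
      fderiv ℝ g x x = ∑ i, x i * fderiv ℝ g x (EuclideanSpace.single i 1) := by
    have hL (L : EuclideanSpace ℝ ι →L[ℝ] ℝ) :
        L x = ∑ i, x i * L (EuclideanSpace.single i 1) := by
      conv_lhs => rw [← (EuclideanSpace.basisFun ι ℝ).sum_repr x, map_sum]
      simp
    exact hL _
  simp_rw [hsum]
  rw [integral_finsetSum _ fun i _ ↦ hint i]
  simp [hparts]

/-- For every `h ∈ C₀^∞(ℝⁿ)` and `a > 0`,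
`∫ (|x|²/(8a)) h² e^{-|x|²/(4a)} ≤ 2a ∫ |∇h|² e^{-|x|²/(4a)} + (n/2) ∫ h² e^{-|x|²/(4a)}`. -/
theorem stmt_5 (n : ℕ) (a : ℝ) (ha : 0 < a)
    (h : EuclideanSpace ℝ (Fin n) → ℝ)
    (hsmooth : ContDiff ℝ (⊤ : ℕ∞) h) (hsupp : HasCompactSupport h) :
    (∫ x : EuclideanSpace ℝ (Fin n),
        (‖x‖ ^ 2 / (8 * a)) * h x ^ 2 * Real.exp (-‖x‖ ^ 2 / (4 * a))) ≤
      2 * a * (∫ x : EuclideanSpace ℝ (Fin n),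
          ‖gradient h x‖ ^ 2 * Real.exp (-‖x‖ ^ 2 / (4 * a))) +
        ((n : ℝ) / 2) * (∫ x : EuclideanSpace ℝ (Fin n),
          h x ^ 2 * Real.exp (-‖x‖ ^ 2 / (4 * a))) := by
  have h1 : ContDiff ℝ 1 h := hsmooth.of_le (by exact_mod_cast le_top)
  have hcont : Continuous h := h1.continuous
  have hgrad : Continuous (gradient h) :=
    (InnerProductSpace.toDual ℝ (EuclideanSpace ℝ (Fin n))).symm.continuous.comp
      (h1.continuous_fderiv one_ne_zero)
  have hgsupp : HasCompactSupport (gradient h) :=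
    (hsupp.fderiv ℝ).comp_left (map_zero (InnerProductSpace.toDual ℝ _).symm)
  set w : EuclideanSpace ℝ (Fin n) → ℝ := fun x ↦ Real.exp (-‖x‖ ^ 2 / (4 * a)) with hw
  have hwsmooth : ContDiff ℝ 1 w := ((contDiff_norm_sq ℝ).neg.div_const _).exp
  have hwcont : Continuous w := hwsmooth.continuous
  have hsq : HasCompactSupport fun x ↦ h x ^ 2 :=
    hsupp.comp_left (g := fun t : ℝ ↦ t ^ 2) (by simp)
  have hgsq : HasCompactSupport fun x ↦ ‖gradient h x‖ ^ 2 :=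
    hgsupp.comp_left (g := fun v : EuclideanSpace ℝ (Fin n) ↦ ‖v‖ ^ 2) (by simp)
  have hderiv (x : EuclideanSpace ℝ (Fin n)) :
      fderiv ℝ (fun y ↦ h y ^ 2 * w y) x x =
        2 * (h x * inner ℝ (gradient h x) x * w x) - 4 * (‖x‖ ^ 2 / (8 * a) * h x ^ 2 * w x) := by
    have hh := (h1.differentiable one_ne_zero x).hasFDerivAt
    have hn := ((hasStrictFDerivAt_norm_sq x).hasFDerivAt.neg.mul_const (4 * a)⁻¹).exp
    have hprod := (hh.pow 2).mul hn
    have hwinv : w = fun y ↦ Real.exp (-‖y‖ ^ 2 * (4 * a)⁻¹) := by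
      simp only [hw, div_eq_mul_inv]
    have hgx : inner ℝ (gradient h x) x = fderiv ℝ h x x := by
      simp [gradient]
    rw [hgx, hwinv]
    erw [hprod.fderiv]
    simp
    field_simp
    ring
  have hIsq : Integrable fun x ↦ ‖x‖ ^ 2 / (8 * a) * h x ^ 2 * w x :=
    Continuous.integrable_of_hasCompactSupport (by fun_prop) hsq.mul_left.mul_right
  have hIgrad : Integrable fun x ↦ ‖gradient h x‖ ^ 2 * w x :=
    Continuous.integrable_of_hasCompactSupport (by fun_prop) hgsq.mul_right
  have hIcross : Integrable fun x ↦ h x * inner ℝ (gradient h x) x * w x :=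
    Continuous.integrable_of_hasCompactSupport (by fun_prop) hsupp.mul_right.mul_right
  have hdiv := integral_fderiv_apply_self ((h1.pow 2).mul hwsmooth) hsq.mul_right
  simp only [hderiv, Fintype.card_fin] at hdiv
  rw [integral_sub (hIcross.const_mul _) (hIsq.const_mul _), integral_const_mul,
    integral_const_mul] at hdiv
  have hpos : 0 ≤ ∫ x, (2 * a * (‖gradient h x‖ ^ 2 * w x) -
      h x * inner ℝ (gradient h x) x * w x + ‖x‖ ^ 2 / (8 * a) * h x ^ 2 * w x) := by
    refine integral_nonneg fun x ↦ ?_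
    have hsquare : 2 * a * (‖gradient h x‖ ^ 2 * w x) -
        h x * inner ℝ (gradient h x) x * w x + ‖x‖ ^ 2 / (8 * a) * h x ^ 2 * w x =
        2 * a * ‖gradient h x - (h x / (4 * a)) • x‖ ^ 2 * w x := by
      rw [norm_sub_sq_real, inner_smul_right, norm_smul, mul_pow, Real.norm_eq_abs, sq_abs]
      field_simp
      ring
    have : 0 < w x := Real.exp_pos _
    simp only [hsquare, Pi.zero_apply]
    positivity
  have hIdiff : Integrable fun x ↦ 2 * a * (‖gradient h x‖ ^ 2 * w x) -
      h x * inner ℝ (gradient h x) x * w x := (hIgrad.const_mul _).sub hIcross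
  rw [integral_add hIdiff hIsq,
    integral_sub (hIgrad.const_mul _) hIcross, integral_const_mul] at hpos
  linarith
end

section
/- For every h ∈ C_0^∞(ℝ^n) and every a > 0, setting v(x) = h(x) e^{-|x|^2/(8a)}, one has the identity 2a ∫_{ℝ^n} |∇h(x)|^2 e^{-|x|^2/(4a)} dx + (n/2) ∫_{ℝ^n} h(x)^2 e^{-|x|^2/(4a)} dx − ∫_{ℝ^n} (|x|^2/(8a)) h(x)^2 e^{-|x|^2/(4a)} dx = 2a ∫_{ℝ^n} |∇v(x)|^2 dx. -/
open MeasureTheory Real Set Metric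

/-- The integral of the Euler field applied to a compactly supported `C¹` function `u`
on `ℝⁿ` is `-n ∫ u`. -/
theorem integral_fderiv_apply_self_s6 {n : ℕ} {u : EuclideanSpace ℝ (Fin n) → ℝ}
    (hu : ContDiff ℝ 1 u) (hc : HasCompactSupport u) :
    ∫ x, fderiv ℝ u x x = -(n : ℝ) * ∫ x, u x := by
  have hdc : HasCompactSupport (fderiv ℝ u) := hc.fderiv ℝ
  have hcont : Continuous (fderiv ℝ u) := hu.continuous_fderiv one_ne_zero
  let e := EuclideanSpace.basisFun (Fin n) ℝ
  have hint (i : Fin n) : Integrable fun x => fderiv ℝ u x (e i) * x i := by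
    refine Continuous.integrable_of_hasCompactSupport (by fun_prop) ?_
    refine hdc.mono fun x hx => ?_
    contrapose! hx
    simp [Function.notMem_support.mp hx]
  have hparts (i : Fin n) : ∫ x, fderiv ℝ u x (e i) * x i = -∫ x, u x := by
    have hcoord (x : EuclideanSpace ℝ (Fin n)) :
        fderiv ℝ (fun y : EuclideanSpace ℝ (Fin n) => y i) x (e i) = 1 := by
      have := (EuclideanSpace.proj i : EuclideanSpace ℝ (Fin n) →L[ℝ] ℝ).hasFDerivAt (x := x)
      rw [show fderiv ℝ (fun y : EuclideanSpace ℝ (Fin n) => y i) x = EuclideanSpace.proj i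
        from this.fderiv]
      simp [e]
    have key := integral_mul_fderiv_eq_neg_fderiv_mul_of_integrable (μ := volume)
      (f := u) (g := fun y : EuclideanSpace ℝ (Fin n) => y i) (v := e i) (hint i)
      (by simpa only [hcoord, mul_one] using hu.continuous.integrable_of_hasCompactSupport hc)
      ((hu.continuous.mul (by fun_prop)).integrable_of_hasCompactSupport hc.mul_right)
      (fun x _ => hu.differentiable one_ne_zero x) (fun x _ => by fun_prop)
    simp only [hcoord, mul_one] at key
    linarith
  have hsum (x : EuclideanSpace ℝ (Fin n)) :
      fderiv ℝ u x x = ∑ i, fderiv ℝ u x (e i) * x i := by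
    conv_lhs => enter [2]; rw [← e.sum_repr x]
    rw [map_sum]
    simp [e, mul_comm]
  simp_rw [hsum]
  rw [integral_finsetSum _ fun i _ => hint i]
  simp [hparts]

/-- Gradient of a function multiplied by a centred Gaussian. -/
theorem gradient_mul_exp_neg_norm_sq_div {E : Type*} [NormedAddCommGroup E]
    [InnerProductSpace ℝ E] [CompleteSpace E] {h : E → ℝ} {x : E}
    (hh : DifferentiableAt ℝ h x) (a : ℝ) :
    gradient (fun y => h y * Real.exp (-‖y‖ ^ 2 / (8 * a))) x =
      Real.exp (-‖x‖ ^ 2 / (8 * a)) • gradient h x -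
        (h x * Real.exp (-‖x‖ ^ 2 / (8 * a)) / (4 * a)) • x := by
  have h1 : HasFDerivAt (fun y : E => ‖y‖ ^ 2) (2 • innerSL ℝ x) x :=
    (hasStrictFDerivAt_norm_sq x).hasFDerivAt
  have h2 := hh.hasFDerivAt.mul ((h1.neg.mul_const (8 * a)⁻¹).exp)
  refine HasGradientAt.gradient ?_
  rw [hasGradientAt_iff_hasFDerivAt]
  simp only [div_eq_mul_inv]
  refine h2.congr_fderiv ?_
  ext y
  have hg : fderiv ℝ h x y = inner ℝ (gradient h x) y := by
    simp [gradient]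
  simp only [add_apply, smul_apply, neg_apply, Pi.neg_apply, innerSL_apply_apply, InnerProductSpace.toDual_apply_apply,
    smul_eq_mul, nsmul_eq_mul, hg, inner_sub_left, real_inner_smul_left, mul_inv]
  push_cast
  ring

/-- For every `h ∈ C₀^∞(ℝⁿ)` and `a > 0`, with `v(x) = h(x) e^{-|x|²/(8a)}`,
`2a ∫ |∇h|² e^{-|x|²/(4a)} + (n/2) ∫ h² e^{-|x|²/(4a)} − ∫ (|x|²/(8a)) h² e^{-|x|²/(4a)}
  = 2a ∫ |∇v|²`. -/
theorem stmt_6 (n : ℕ) (a : ℝ) (ha : 0 < a)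
    (h : EuclideanSpace ℝ (Fin n) → ℝ)
    (hsmooth : ContDiff ℝ (⊤ : ℕ∞) h) (hsupp : HasCompactSupport h)
    (v : EuclideanSpace ℝ (Fin n) → ℝ)
    (hv : ∀ x, v x = h x * Real.exp (-‖x‖ ^ 2 / (8 * a))) :
    2 * a * (∫ x : EuclideanSpace ℝ (Fin n),
          ‖gradient h x‖ ^ 2 * Real.exp (-‖x‖ ^ 2 / (4 * a))) +
        ((n : ℝ) / 2) * (∫ x : EuclideanSpace ℝ (Fin n),
          h x ^ 2 * Real.exp (-‖x‖ ^ 2 / (4 * a))) -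
        (∫ x : EuclideanSpace ℝ (Fin n),
          (‖x‖ ^ 2 / (8 * a)) * h x ^ 2 * Real.exp (-‖x‖ ^ 2 / (4 * a))) =
      2 * a * (∫ x : EuclideanSpace ℝ (Fin n), ‖gradient v x‖ ^ 2) := by
  have hvfun : v = fun x => h x * Real.exp (-‖x‖ ^ 2 / (8 * a)) := funext hv
  have hvsmooth : ContDiff ℝ 1 v := by
    have := hsmooth.of_le (m := 1) (by exact_mod_cast le_top)
    rw [hvfun]
    exact this.mul (((contDiff_norm_sq ℝ).neg.div_const _).exp)
  have hvsupp : HasCompactSupport v := hvfun ▸ hsupp.mul_right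
  have hgrad (x) : Real.exp (-‖x‖ ^ 2 / (8 * a)) • gradient h x =
      gradient v x + (v x / (4 * a)) • x := by
    rw [hvfun, gradient_mul_exp_neg_norm_sq_div (hsmooth.differentiable (by simp) x) a]
    simp
  have hexp (x : EuclideanSpace ℝ (Fin n)) : Real.exp (-‖x‖ ^ 2 / (4 * a)) =
      Real.exp (-‖x‖ ^ 2 / (8 * a)) ^ 2 := by
    rw [← Real.exp_nat_mul]
    congr 1
    push_cast
    field_simp
    ring
  have hsq (x) : h x ^ 2 * Real.exp (-‖x‖ ^ 2 / (4 * a)) = v x ^ 2 := by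
    rw [hexp, hv]
    ring
  have hfderiv (x) : fderiv ℝ (fun y => v y ^ 2) x x =
      2 * (v x * inner ℝ (gradient v x) x) := by
    rw [((hvsmooth.differentiable one_ne_zero x).hasFDerivAt.pow 2).fderiv]
    simp [gradient, mul_assoc]
  have hpoint (x) : ‖gradient h x‖ ^ 2 * Real.exp (-‖x‖ ^ 2 / (4 * a)) =
      ‖gradient v x‖ ^ 2 + (v x * inner ℝ (gradient v x) x / (2 * a) +
        ‖x‖ ^ 2 / (8 * a) * v x ^ 2 / (2 * a)) := by
    have hnorm : ‖gradient h x‖ ^ 2 * Real.exp (-‖x‖ ^ 2 / (4 * a)) =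
        ‖Real.exp (-‖x‖ ^ 2 / (8 * a)) • gradient h x‖ ^ 2 := by
      rw [hexp, norm_smul, Real.norm_eq_abs, mul_pow, sq_abs, mul_comm]
    rw [hnorm, hgrad, norm_add_sq_real, real_inner_smul_right, norm_smul, mul_pow,
      Real.norm_eq_abs, sq_abs]
    field_simp
    ring
  have hgcont : Continuous (gradient v) :=
    (InnerProductSpace.toDual ℝ _).symm.continuous.comp (hvsmooth.continuous_fderiv one_ne_zero)
  have hvcont := hvsmooth.continuous
  have hgsupp : HasCompactSupport (gradient v) :=
    (hvsupp.fderiv ℝ).comp_left (g := (InnerProductSpace.toDual ℝ _).symm) (map_zero _)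
  have hv2supp : HasCompactSupport fun x => v x ^ 2 :=
    hvsupp.comp_left (g := fun t : ℝ => t ^ 2) (by simp)
  have hint_grad : Integrable fun x => ‖gradient v x‖ ^ 2 :=
    Continuous.integrable_of_hasCompactSupport (by fun_prop)
      (hgsupp.comp_left (g := fun y => ‖y‖ ^ 2) (by simp))
  have hint_cross : Integrable fun x => v x * inner ℝ (gradient v x) x :=
    Continuous.integrable_of_hasCompactSupport (by fun_prop) hvsupp.mul_right
  have hint_weight : Integrable fun x => ‖x‖ ^ 2 / (8 * a) * v x ^ 2 :=
    Continuous.integrable_of_hasCompactSupport (by fun_prop) hv2supp.mul_left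
  have heuler := integral_fderiv_apply_self_s6 (hvsmooth.pow 2) hv2supp
  simp_rw [hfderiv] at heuler
  rw [integral_const_mul] at heuler
  simp_rw [mul_assoc (_ / _), hsq, hpoint]
  rw [integral_add hint_grad, integral_add (hint_cross.div_const _) (hint_weight.div_const _),
    integral_div, integral_div]
  · field_simp
    linarith
  · exact (hint_cross.div_const _).add (hint_weight.div_const _)
end

section
/- Let N > 0 and Θ > 0 satisfy N log(NΘ) ≥ 1, and let h ∈ C_0^∞(ℝ^n) be such that for every a with 0 < a ≤ 1/(12 N log(NΘ)) one has ∫_{ℝ^n} (|x|^2/(8a)) h^2 e^{-|x|^2/(4a)} dx ≤ N log(NΘ) ∫_{ℝ^n} h^2 e^{-|x|^2/(4a)} dx. Then for every r with 0 < r ≤ 1/2 and every a with 0 < a ≤ r^2/(16 N log(NΘ)), one has ∫_{ℝ^n} (|x|^2/(16a)) h^2 e^{-|x|^2/(4a)} dx ≤ N log(NΘ) ∫_{B_r} h^2 dx. -/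
open MeasureTheory Real Set Metric

/-- If `N log(NΘ) ≥ 1` and `h ∈ C₀^∞(ℝⁿ)` satisfies, for every
`0 < a ≤ 1/(12 N log(NΘ))`,
`∫ (|x|²/(8a)) h² e^{-|x|²/(4a)} ≤ N log(NΘ) ∫ h² e^{-|x|²/(4a)}`, then for every
`0 < r ≤ 1/2` and every `0 < a ≤ r²/(16 N log(NΘ))`,
`∫ (|x|²/(16a)) h² e^{-|x|²/(4a)} ≤ N log(NΘ) ∫_{B_r} h²`. -/
theorem stmt_8 (n : ℕ) (N Θ : ℝ) (hN : 0 < N) (hΘ : 0 < Θ)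
    (hlog : 1 ≤ N * Real.log (N * Θ))
    (h : EuclideanSpace ℝ (Fin n) → ℝ)
    (hsmooth : ContDiff ℝ (⊤ : ℕ∞) h) (hsupp : HasCompactSupport h)
    (hineq : ∀ a : ℝ, 0 < a → a ≤ 1 / (12 * N * Real.log (N * Θ)) →
      (∫ x : EuclideanSpace ℝ (Fin n),
          (‖x‖ ^ 2 / (8 * a)) * h x ^ 2 * Real.exp (-‖x‖ ^ 2 / (4 * a))) ≤
        N * Real.log (N * Θ) * (∫ x : EuclideanSpace ℝ (Fin n),
            h x ^ 2 * Real.exp (-‖x‖ ^ 2 / (4 * a)))) :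
    ∀ r : ℝ, 0 < r → r ≤ 1 / 2 →
      ∀ a : ℝ, 0 < a → a ≤ r ^ 2 / (16 * N * Real.log (N * Θ)) →
        (∫ x : EuclideanSpace ℝ (Fin n),
            (‖x‖ ^ 2 / (16 * a)) * h x ^ 2 * Real.exp (-‖x‖ ^ 2 / (4 * a))) ≤
          N * Real.log (N * Θ) * ∫ x in ball (0 : EuclideanSpace ℝ (Fin n)) r, h x ^ 2 := by
  intro r hr hr2 a ha har
  have hL : 0 < N * Real.log (N * Θ) := by linarith
  have h16 : 16 * N * Real.log (N * Θ) = 16 * (N * Real.log (N * Θ)) := by ring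
  have h12 : 12 * N * Real.log (N * Θ) = 12 * (N * Real.log (N * Θ)) := by ring
  rw [h16] at har
  rw [h12] at hineq
  generalize N * Real.log (N * Θ) = L at *
  have hLa : a * (16 * L) ≤ r ^ 2 := (le_div_iff₀ (by positivity)).1 har
  have key := hineq a ha <| (le_div_iff₀ (by positivity)).2 (by nlinarith)
  have hc : Continuous h := hsmooth.continuous
  have hsq : HasCompactSupport (fun x ↦ h x ^ 2) :=
    hsupp.comp_left (g := fun t : ℝ ↦ t ^ 2) (by simp)
  have hint : ∀ c : EuclideanSpace ℝ (Fin n) → ℝ, Continuous c →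
      Integrable (fun x ↦ c x * h x ^ 2) := fun c hcc ↦
    (hcc.mul (hc.pow 2)).integrable_of_hasCompactSupport hsq.mul_left
  have hF : Integrable (fun x : EuclideanSpace ℝ (Fin n) ↦
      (‖x‖ ^ 2 / (16 * a)) * h x ^ 2 * Real.exp (-‖x‖ ^ 2 / (4 * a))) := by
    refine (hint (fun x ↦ (‖x‖ ^ 2 / (16 * a)) * Real.exp (-‖x‖ ^ 2 / (4 * a)))
      (by fun_prop)).congr (.of_forall fun x ↦ ?_)
    exact mul_right_comm _ _ _
  have hG : Integrable (fun x : EuclideanSpace ℝ (Fin n) ↦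
      h x ^ 2 * Real.exp (-‖x‖ ^ 2 / (4 * a))) := by
    refine (hint (fun x ↦ Real.exp (-‖x‖ ^ 2 / (4 * a))) (by fun_prop)).congr
      (.of_forall fun x ↦ ?_)
    exact mul_comm _ _
  have hH : Integrable (indicator (ball (0 : EuclideanSpace ℝ (Fin n)) r) fun x ↦ h x ^ 2) := by
    simpa using (hint (fun _ ↦ 1) continuous_const).indicator
      (measurableSet_ball (x := (0 : EuclideanSpace ℝ (Fin n))) (ε := r))
  have hdouble : (∫ x : EuclideanSpace ℝ (Fin n),
      (‖x‖ ^ 2 / (8 * a)) * h x ^ 2 * Real.exp (-‖x‖ ^ 2 / (4 * a))) =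
      2 * ∫ x : EuclideanSpace ℝ (Fin n),
        (‖x‖ ^ 2 / (16 * a)) * h x ^ 2 * Real.exp (-‖x‖ ^ 2 / (4 * a)) := by
    rw [← integral_const_mul]
    congr 1 with x
    field_simp
    ring
  have hmono := integral_mono (hG.const_mul L) ((hH.const_mul L).add hF) (fun x ↦ by
    simp only [Pi.add_apply]
    by_cases hx : x ∈ ball (0 : EuclideanSpace ℝ (Fin n)) r
    · rw [indicator_of_mem hx]
      have hexp : Real.exp (-‖x‖ ^ 2 / (4 * a)) ≤ 1 :=
        Real.exp_le_one_iff.2 (div_nonpos_of_nonpos_of_nonneg (by simp) (by positivity))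
      have hle : L * (h x ^ 2 * Real.exp (-‖x‖ ^ 2 / (4 * a))) ≤ L * h x ^ 2 :=
        mul_le_mul_of_nonneg_left (mul_le_of_le_one_right (sq_nonneg _) hexp) hL.le
      have hnonneg : 0 ≤ (‖x‖ ^ 2 / (16 * a)) * h x ^ 2 * Real.exp (-‖x‖ ^ 2 / (4 * a)) := by
        positivity
      linarith
    · rw [indicator_of_notMem hx, mul_zero, zero_add, mul_assoc]
      have hrx : r ≤ ‖x‖ := by simpa using hx
      refine mul_le_mul_of_nonneg_right ((le_div_iff₀ (by positivity)).2 ?_) (by positivity)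
      nlinarith)
  have hadd := integral_add (hH.const_mul L) hF
  simp only [Pi.add_apply] at hmono
  rw [hadd, integral_const_mul, integral_const_mul, integral_indicator measurableSet_ball] at hmono
  linarith
end

section
/- Given α ≥ 2 + n/2, there exist a constant N = N(n) depending only on the dimension n and an increasing function σ : [0,∞) → [0,∞) satisfying t/N ≤ σ(t) ≤ t for t ∈ [0, 4/α], such that for every a with 0 < a ≤ 1/α and every f ∈ C_0^∞(ℝ^n × [0, 4/α)) the inequality α^2 ∫ σ_a^{-α} f^2 e^{-|x|^2/(4(t+a))} dX + α ∫ σ_a^{1-α} |∇f|^2 e^{-|x|^2/(4(t+a))} dX ≤ N ∫ σ_a^{1-α} (Δf + ∂_t f)^2 e^{-|x|^2/(4(t+a))} dX + σ(a)^{-α} [ −(a/N) ∫_{ℝ^n} |∇f(x,0)|^2 e^{-|x|^2/(4a)} dx + N α ∫_{ℝ^n} f(x,0)^2 e^{-|x|^2/(4a)} dx ] holds. -/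
open MeasureTheory Real Set Metric

namespace Carleman

open scoped ContDiff Topology

variable {n : ℕ}

/-- Smooth compactly supported functions on space-time. -/
def IsTest (f : EuclideanSpace ℝ (Fin n) × ℝ → ℝ) : Prop :=
  ContDiff ℝ ∞ f ∧ HasCompactSupport f

/-- The partial derivative in the `i`-th space variable. -/
noncomputable def dx (i : Fin n) (f : EuclideanSpace ℝ (Fin n) × ℝ → ℝ)
    (p : EuclideanSpace ℝ (Fin n) × ℝ) : ℝ :=
  fderiv ℝ f p (EuclideanSpace.single i 1, 0)

/-- The partial derivative in the time variable. -/
noncomputable def dt (f : EuclideanSpace ℝ (Fin n) × ℝ → ℝ)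
    (p : EuclideanSpace ℝ (Fin n) × ℝ) : ℝ :=
  fderiv ℝ f p (0, 1)

/-- The (unnormalized) Gaussian `exp (-|x|² / 4τ)`. -/
noncomputable def gauss (τ : ℝ) (x : EuclideanSpace ℝ (Fin n)) : ℝ :=
  Real.exp (-‖x‖ ^ 2 / (4 * τ))

/-- The Gaussian integral of the time slice `f (·, t)`. -/
noncomputable def gaussInt (τ : ℝ) (f : EuclideanSpace ℝ (Fin n) × ℝ → ℝ) (t : ℝ) : ℝ :=
  ∫ x, f (x, t) * gauss τ x

variable {f g : EuclideanSpace ℝ (Fin n) × ℝ → ℝ}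

namespace IsTest

theorem differentiable (hf : IsTest f) : Differentiable ℝ f := hf.1.differentiable (by simp)

theorem continuous (hf : IsTest f) : Continuous f := hf.1.continuous

theorem fderiv_apply (hf : IsTest f) (v : EuclideanSpace ℝ (Fin n) × ℝ) :
    IsTest (fun p => fderiv ℝ f p v) :=
  ⟨(hf.1.fderiv_right (m := ∞) (by simp)).clm_apply contDiff_const, hf.2.fderiv_apply ℝ v⟩

theorem dx (hf : IsTest f) (i : Fin n) : IsTest (dx i f) := hf.fderiv_apply _

theorem dt (hf : IsTest f) : IsTest (dt f) := hf.fderiv_apply _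

theorem add (hf : IsTest f) (hg : IsTest g) : IsTest (fun p => f p + g p) :=
  ⟨hf.1.add hg.1, hf.2.add hg.2⟩

theorem mul_left (hg : ContDiff ℝ ∞ g) (hf : IsTest f) : IsTest (fun p => g p * f p) :=
  ⟨hg.mul hf.1, hf.2.mul_left⟩

theorem mul (hg : IsTest g) (hf : IsTest f) : IsTest (fun p => g p * f p) :=
  hf.mul_left hg.1

theorem const_mul (hf : IsTest f) (c : ℝ) : IsTest (fun p => c * f p) :=
  hf.mul_left contDiff_const

theorem coord_mul (hf : IsTest f) (i : Fin n) : IsTest (fun p => p.1 i * f p) :=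
  hf.mul_left (by fun_prop)

theorem sum {F : Fin n → EuclideanSpace ℝ (Fin n) × ℝ → ℝ} (hF : ∀ i, IsTest (F i)) :
    IsTest (fun p => ∑ i, F i p) := by
  refine ⟨ContDiff.sum fun i _ => (hF i).1, ?_⟩
  have : ∀ s : Finset (Fin n), HasCompactSupport (fun p => ∑ i ∈ s, F i p) := by
    intro s
    induction s using Finset.induction_on with
    | empty => exact HasCompactSupport.zero
    | insert a s ha ih =>
      simp only [Finset.sum_insert ha]
      exact (hF a).2.add ih
  exact this _

end IsTest

theorem continuous_gauss (τ : ℝ) : Continuous (gauss τ : EuclideanSpace ℝ (Fin n) → ℝ) := by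
  unfold gauss; fun_prop

theorem IsTest.hasCompactSupport_slice (hf : IsTest f) (t : ℝ) :
    HasCompactSupport (fun x => f (x, t)) := by
  refine HasCompactSupport.of_support_subset_isCompact (hf.2.image continuous_fst) ?_
  intro x hx
  exact ⟨(x, t), subset_tsupport _ hx, rfl⟩

theorem IsTest.integrable (hf : IsTest f) (τ t : ℝ) :
    Integrable (fun x => f (x, t) * gauss τ x) :=
  ((by have := hf.continuous; fun_prop : Continuous fun x => f (x, t)).mul
    (continuous_gauss τ)).integrable_of_hasCompactSupport (hf.hasCompactSupport_slice t).mul_right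

theorem hasFDerivAt_slice (hf : Differentiable ℝ f) (x : EuclideanSpace ℝ (Fin n)) (t : ℝ) :
    HasFDerivAt (fun y => f (y, t))
      ((fderiv ℝ f (x, t)).comp (ContinuousLinearMap.inl ℝ _ ℝ)) x :=
  (hf (x, t)).hasFDerivAt.comp x (hasFDerivAt_prodMk_left x t)

theorem fderiv_slice (hf : Differentiable ℝ f) (x : EuclideanSpace ℝ (Fin n)) (t : ℝ) (i : Fin n) :
    fderiv ℝ (fun y => f (y, t)) x (EuclideanSpace.single i 1) = dx i f (x, t) := by
  rw [(hasFDerivAt_slice hf x t).fderiv]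
  simp [dx]

theorem hasDerivAt_slice (hf : Differentiable ℝ f) (x : EuclideanSpace ℝ (Fin n)) (t : ℝ) :
    HasDerivAt (fun s => f (x, s)) (dt f (x, t)) t := by
  have := ((hf (x, t)).hasFDerivAt.comp t (hasFDerivAt_prodMk_right x t)).hasDerivAt
  exact this.congr_deriv (by simp [dt])

theorem hasFDerivAt_gauss (τ : ℝ) (x : EuclideanSpace ℝ (Fin n)) :
    HasFDerivAt (gauss τ) ((-(1 / (2 * τ)) * gauss τ x) • innerSL ℝ x) x := by
  have h := ((hasStrictFDerivAt_norm_sq x).hasFDerivAt.const_mul (-(1 / (4 * τ)))).exp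
  have e : (gauss τ : EuclideanSpace ℝ (Fin n) → ℝ) =
      fun x => Real.exp (-(1 / (4 * τ)) * ‖x‖ ^ 2) := by
    funext y; unfold gauss; congr 1; ring
  rw [e]
  refine h.congr_fderiv (ContinuousLinearMap.ext fun y => ?_)
  simp
  ring

theorem gaussInt_dx (hf : IsTest f) (τ t : ℝ) (i : Fin n) :
    gaussInt τ (dx i f) t = 1 / (2 * τ) * gaussInt τ (fun p => p.1 i * f p) t := by
  have hg : ∀ x : EuclideanSpace ℝ (Fin n), fderiv ℝ (gauss τ) x (EuclideanSpace.single i 1) =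
      -(1 / (2 * τ)) * (x i * gauss τ x) := by
    intro x
    rw [(hasFDerivAt_gauss τ x).fderiv]
    simp [EuclideanSpace.inner_single_right]
    ring
  have key := integral_mul_fderiv_eq_neg_fderiv_mul_of_integrable (μ := volume)
    (f := fun x => f (x, t)) (g := gauss τ) (v := EuclideanSpace.single i (1 : ℝ))
    (by simpa only [fderiv_slice hf.differentiable] using (hf.dx i).integrable τ t)
    (by
      simp only [hg]
      refine (((hf.coord_mul i).integrable τ t).const_mul (-(1 / (2 * τ)))).congr (.of_forall ?_)
      intro x; simp only; ring)
    (hf.integrable τ t)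
    (fun x _ => (hasFDerivAt_slice hf.differentiable x t).differentiableAt)
    (fun x _ => (hasFDerivAt_gauss τ x).differentiableAt)
  simp only [fderiv_slice hf.differentiable, hg] at key
  unfold gaussInt
  rw [← neg_eq_iff_eq_neg] at key
  rw [← key, ← integral_neg, ← integral_const_mul]
  congr 1; funext x; ring

theorem dx_coord_mul (hf : IsTest f) (i j : Fin n) (p : EuclideanSpace ℝ (Fin n) × ℝ) :
    dx i (fun p => p.1 j * f p) p = (if j = i then f p else 0) + p.1 j * dx i f p := by
  have h : HasFDerivAt (fun p : EuclideanSpace ℝ (Fin n) × ℝ => p.1 j)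
      ((EuclideanSpace.proj j).comp (ContinuousLinearMap.fst ℝ _ ℝ)) p :=
    ((EuclideanSpace.proj j : _ →L[ℝ] ℝ).comp (ContinuousLinearMap.fst ℝ _ ℝ)).hasFDerivAt
  unfold dx
  rw [(h.fun_mul (hf.differentiable p).hasFDerivAt).fderiv]
  by_cases hij : j = i <;> simp [hij, add_comm]

theorem gaussInt_add (hf : IsTest f) (hg : IsTest g) (τ t : ℝ) :
    gaussInt τ (fun p => f p + g p) t = gaussInt τ f t + gaussInt τ g t := by
  unfold gaussInt
  rw [← integral_add (hf.integrable τ t) (hg.integrable τ t)]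
  simp only [add_mul]

theorem gaussInt_const_mul (c : ℝ) (τ t : ℝ) :
    gaussInt τ (fun p => c * f p) t = c * gaussInt τ f t := by
  unfold gaussInt
  simp only [mul_assoc, integral_const_mul]

theorem gaussInt_sum {F : Fin n → EuclideanSpace ℝ (Fin n) × ℝ → ℝ} (hF : ∀ i, IsTest (F i))
    (τ t : ℝ) : gaussInt τ (fun p => ∑ i, F i p) t = ∑ i, gaussInt τ (F i) t := by
  unfold gaussInt
  rw [← integral_finsetSum _ fun i _ => (hF i).integrable τ t]
  simp only [Finset.sum_mul]

theorem gaussInt_norm_sq_mul (hf : IsTest f) {τ : ℝ} (hτ : 0 < τ) (t : ℝ) :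
    gaussInt τ (fun p => ‖p.1‖ ^ 2 * f p) t =
      2 * τ * (n * gaussInt τ f t + ∑ i, gaussInt τ (fun p => p.1 i * dx i f p) t) := by
  have h : ∀ i : Fin n, gaussInt τ (fun p => p.1 i * (p.1 i * f p)) t =
      2 * τ * (gaussInt τ f t + gaussInt τ (fun p => p.1 i * dx i f p) t) := by
    intro i
    have := gaussInt_dx (hf.coord_mul i) τ t i
    have e : dx i (fun p => p.1 i * f p) = fun p => f p + p.1 i * dx i f p := by
      funext p; simp [dx_coord_mul hf]
    rw [e, gaussInt_add hf ((hf.dx i).coord_mul i)] at this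
    rw [this]; field_simp
  have e : (fun p : EuclideanSpace ℝ (Fin n) × ℝ => ‖p.1‖ ^ 2 * f p) =
      fun p => ∑ i, p.1 i * (p.1 i * f p) := by
    funext p
    rw [EuclideanSpace.norm_sq_eq, Finset.sum_mul]
    simp only [Real.norm_eq_abs, sq_abs]
    congr 1; funext i; ring
  rw [e, gaussInt_sum fun i => (hf.coord_mul i).coord_mul i]
  simp only [h]
  rw [← Finset.mul_sum, Finset.sum_add_distrib]
  simp

theorem hasDerivAt_gaussInt_aux (hf : IsTest f) {a t : ℝ} (ht : 0 < t + a) :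
    HasDerivAt (fun s => gaussInt (s + a) f s)
      (∫ x, (dt f (x, t) + ‖x‖ ^ 2 / (4 * (t + a) ^ 2) * f (x, t)) * gauss (t + a) x) t := by
  set K : Set (EuclideanSpace ℝ (Fin n)) := Prod.fst '' tsupport f with hK
  have hKc : IsCompact K := hf.2.image continuous_fst
  set δ := (t + a) / 2 with hδ
  have hpos : ∀ s ∈ Icc (t - δ) (t + δ), 0 < s + a := by
    intro s hs; have := hs.1; linarith
  have hcont : ContinuousOn (fun p : EuclideanSpace ℝ (Fin n) × ℝ =>
      (dt f p + ‖p.1‖ ^ 2 / (4 * (p.2 + a) ^ 2) * f p) * gauss (p.2 + a) p.1)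
      (K ×ˢ Icc (t - δ) (t + δ)) := by
    have h1 := hf.dt.continuous
    have h2 := hf.continuous
    have h3 : ∀ p ∈ K ×ˢ Icc (t - δ) (t + δ), p.2 + a ≠ 0 := fun p hp => (hpos _ hp.2).ne'
    unfold gauss
    refine ContinuousOn.mul (h1.continuousOn.add (ContinuousOn.mul (ContinuousOn.div
      (by fun_prop) (by fun_prop) ?_) h2.continuousOn)) (ContinuousOn.rexp (ContinuousOn.div
      (by fun_prop) (by fun_prop) ?_))
    · intro p hp; have := h3 p hp; positivity
    · intro p hp; have := h3 p hp; positivity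
  obtain ⟨C, hC⟩ := (hKc.prod isCompact_Icc).exists_bound_of_continuousOn hcont
  have hzero : ∀ x ∉ K, ∀ s, f (x, s) = 0 ∧ dt f (x, s) = 0 := by
    intro x hx s
    have : (x, s) ∉ tsupport f := fun h => hx ⟨_, h, rfl⟩
    exact ⟨image_eq_zero_of_notMem_tsupport this, image_eq_zero_of_notMem_tsupport
      fun h => this (tsupport_fderiv_apply_subset ℝ _ h)⟩
  refine (hasDerivAt_integral_of_dominated_loc_of_deriv_le (μ := volume)
    (s := Icc (t - δ) (t + δ)) (bound := K.indicator fun _ => C)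
    (F := fun s x => f (x, s) * gauss (s + a) x)
    (F' := fun s x => (dt f (x, s) + ‖x‖ ^ 2 / (4 * (s + a) ^ 2) * f (x, s)) * gauss (s + a) x)
    (Icc_mem_nhds (by linarith) (by linarith)) (.of_forall fun s =>
      (hf.integrable _ s).aestronglyMeasurable) (hf.integrable _ t) ?_ ?_ ?_ ?_).2
  · refine Continuous.aestronglyMeasurable ?_
    have h1 := hf.dt.continuous
    have h2 := hf.continuous
    have h3 := continuous_gauss (n := n) (t + a)
    fun_prop
  · refine .of_forall fun x s hs => ?_
    by_cases hx : x ∈ K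
    · rw [indicator_of_mem hx]; exact hC (x, s) ⟨hx, hs⟩
    · rw [indicator_of_notMem hx]; simp [hzero x hx s]
  · exact (integrable_indicator_iff hKc.measurableSet).2
      (integrableOn_const hKc.measure_lt_top.ne)
  · refine .of_forall fun x s hs => ?_
    have hs' := (hpos s hs).ne'
    have h1 := hasDerivAt_slice hf.differentiable x s
    have h2 : HasDerivAt (fun s : ℝ => gauss (s + a) x)
        (‖x‖ ^ 2 / (4 * (s + a) ^ 2) * gauss (s + a) x) s := by
      unfold gauss
      have := (((hasDerivAt_id s).add_const a).const_mul 4).fun_inv (by simpa using hs')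
      refine (this.const_mul (-‖x‖ ^ 2)).exp.congr_deriv ?_
      simp only [id, div_eq_mul_inv]
      field_simp
    refine (h1.mul h2).congr_deriv ?_
    ring

/-- Differentiation of a Gaussian integral along the self-similar flow of the backward heat
kernel. -/
theorem hasDerivAt_gaussInt (hf : IsTest f) {a t : ℝ} (ht : 0 < t + a) :
    HasDerivAt (fun s => gaussInt (s + a) f s)
      (gaussInt (t + a) (dt f) t +
        1 / (2 * (t + a)) * ∑ i, gaussInt (t + a) (fun p => p.1 i * dx i f p) t +
        n / (2 * (t + a)) * gaussInt (t + a) f t) t := by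
  refine (hasDerivAt_gaussInt_aux hf ht).congr_deriv ?_
  have h := gaussInt_norm_sq_mul hf ht t
  have hn : IsTest (fun p => ‖p.1‖ ^ 2 * f p) := hf.mul_left (by
    have : ContDiff ℝ ∞ (fun x : EuclideanSpace ℝ (Fin n) => ‖x‖ ^ 2) := contDiff_norm_sq ℝ
    exact this.comp contDiff_fst)
  have e : ∫ x, (dt f (x, t) + ‖x‖ ^ 2 / (4 * (t + a) ^ 2) * f (x, t)) * gauss (t + a) x =
      gaussInt (t + a) (fun p => dt f p + 1 / (4 * (t + a) ^ 2) * (‖p.1‖ ^ 2 * f p)) t := by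
    unfold gaussInt; congr 1; funext x; ring
  rw [e, gaussInt_add hf.dt (hn.const_mul _), gaussInt_const_mul, h]
  field_simp
  ring

theorem dx_mul (hf : IsTest f) (hg : IsTest g) (i : Fin n) (p : EuclideanSpace ℝ (Fin n) × ℝ) :
    dx i (fun p => f p * g p) p = dx i f p * g p + f p * dx i g p := by
  unfold dx
  rw [((hf.differentiable p).hasFDerivAt.fun_mul (hg.differentiable p).hasFDerivAt).fderiv]
  simp; ring

theorem dt_mul (hf : IsTest f) (hg : IsTest g) (p : EuclideanSpace ℝ (Fin n) × ℝ) :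
    dt (fun p => f p * g p) p = dt f p * g p + f p * dt g p := by
  unfold dt
  rw [((hf.differentiable p).hasFDerivAt.fun_mul (hg.differentiable p).hasFDerivAt).fderiv]
  simp; ring

theorem dx_add (hf : IsTest f) (hg : IsTest g) (i : Fin n) (p : EuclideanSpace ℝ (Fin n) × ℝ) :
    dx i (fun p => f p + g p) p = dx i f p + dx i g p := by
  unfold dx
  rw [((hf.differentiable p).hasFDerivAt.fun_add (hg.differentiable p).hasFDerivAt).fderiv]
  simp

theorem dx_const_mul (hf : IsTest f) (c : ℝ) (i : Fin n) (p : EuclideanSpace ℝ (Fin n) × ℝ) :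
    dx i (fun p => c * f p) p = c * dx i f p := by
  unfold dx
  rw [((hf.differentiable p).hasFDerivAt.const_mul c).fderiv]
  simp

theorem dx_sum {F : Fin n → EuclideanSpace ℝ (Fin n) × ℝ → ℝ} (hF : ∀ i, IsTest (F i))
    (i : Fin n) (p : EuclideanSpace ℝ (Fin n) × ℝ) :
    dx i (fun p => ∑ j, F j p) p = ∑ j, dx i (F j) p := by
  unfold dx
  rw [(HasFDerivAt.fun_sum fun j _ => ((hF j).differentiable p).hasFDerivAt).fderiv]
  simp

theorem dt_sum {F : Fin n → EuclideanSpace ℝ (Fin n) × ℝ → ℝ} (hF : ∀ i, IsTest (F i))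
    (p : EuclideanSpace ℝ (Fin n) × ℝ) :
    dt (fun p => ∑ j, F j p) p = ∑ j, dt (F j) p := by
  unfold dt
  rw [(HasFDerivAt.fun_sum fun j _ => ((hF j).differentiable p).hasFDerivAt).fderiv]
  simp

theorem fderiv_fderiv_comm (hf : IsTest f) (p v w : EuclideanSpace ℝ (Fin n) × ℝ) :
    fderiv ℝ (fun q => fderiv ℝ f q v) p w = fderiv ℝ (fun q => fderiv ℝ f q w) p v := by
  have hd : DifferentiableAt ℝ (fderiv ℝ f) p :=
    ((hf.1.fderiv_right (m := ∞) (by simp)).differentiable (by simp)) p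
  have hs := (hf.1.contDiffAt (x := p)).isSymmSndFDerivAt
    (by
      rw [minSmoothness_of_isRCLikeNormedField]
      exact WithTop.coe_le_coe.2 (le_top : (2 : ℕ∞) ≤ ⊤))
  have key : ∀ u, fderiv ℝ (fun q => fderiv ℝ f q u) p = (fderiv ℝ (fderiv ℝ f) p).flip u := by
    intro u
    rw [fderiv_clm_apply hd (differentiableAt_const u)]
    simp
  rw [key, key]
  exact hs w v

theorem dx_dx_comm (hf : IsTest f) (i j : Fin n) : dx i (dx j f) = dx j (dx i f) :=
  funext fun p => fderiv_fderiv_comm hf p _ _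

theorem dx_dt_comm (hf : IsTest f) (i : Fin n) : dx i (dt f) = dt (dx i f) :=
  funext fun p => fderiv_fderiv_comm hf p _ _

/-- The derivative along the self-similar flow `(x / 2τ, 1)`. -/
noncomputable def vel (τ : ℝ) (f : EuclideanSpace ℝ (Fin n) × ℝ → ℝ)
    (p : EuclideanSpace ℝ (Fin n) × ℝ) : ℝ :=
  dt f p + 1 / (2 * τ) * ∑ i, p.1 i * dx i f p

/-- The Ornstein-Uhlenbeck operator, symmetric with respect to `gauss τ`. -/
noncomputable def ou (τ : ℝ) (f : EuclideanSpace ℝ (Fin n) × ℝ → ℝ)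
    (p : EuclideanSpace ℝ (Fin n) × ℝ) : ℝ :=
  ∑ i, (dx i (dx i f) p + -(1 / (2 * τ)) * (p.1 i * dx i f p))

/-- The squared length of the spatial gradient. -/
noncomputable def gradSq (f : EuclideanSpace ℝ (Fin n) × ℝ → ℝ)
    (p : EuclideanSpace ℝ (Fin n) × ℝ) : ℝ :=
  ∑ i, dx i f p * dx i f p

/-- The backward heat operator. -/
noncomputable def heat (f : EuclideanSpace ℝ (Fin n) × ℝ → ℝ)
    (p : EuclideanSpace ℝ (Fin n) × ℝ) : ℝ :=
  ∑ i, dx i (dx i f) p + dt f p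

theorem IsTest.vel (hf : IsTest f) (τ : ℝ) : IsTest (vel τ f) :=
  hf.dt.add ((IsTest.sum fun i => (hf.dx i).coord_mul i).const_mul _)

theorem IsTest.ou (hf : IsTest f) (τ : ℝ) : IsTest (ou τ f) :=
  IsTest.sum fun i => ((hf.dx i).dx i).add (((hf.dx i).coord_mul i).const_mul _)

theorem IsTest.gradSq (hf : IsTest f) : IsTest (gradSq f) :=
  IsTest.sum fun i => (hf.dx i).mul (hf.dx i)

theorem IsTest.heat (hf : IsTest f) : IsTest (heat f) :=
  (IsTest.sum fun i => (hf.dx i).dx i).add hf.dt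

theorem ou_add_vel (τ : ℝ) (p : EuclideanSpace ℝ (Fin n) × ℝ) :
    ou τ f p + vel τ f p = heat f p := by
  unfold ou vel heat
  rw [Finset.sum_add_distrib, ← Finset.mul_sum]
  ring

theorem gaussInt_mul_ou (hf : IsTest f) (hg : IsTest g) (τ t : ℝ) :
    gaussInt τ (fun p => g p * ou τ f p) t =
      -gaussInt τ (fun p => ∑ i, dx i g p * dx i f p) t := by
  have h : ∀ i : Fin n, gaussInt τ (fun p => dx i g p * dx i f p) t +
      gaussInt τ (fun p => g p * (dx i (dx i f) p + -(1 / (2 * τ)) * (p.1 i * dx i f p))) t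
        = 0 := by
    intro i
    have h1 := gaussInt_dx (hg.mul (hf.dx i)) τ t i
    have e1 : dx i (fun p => g p * dx i f p) =
        fun p => dx i g p * dx i f p + g p * dx i (dx i f) p :=
      funext fun p => dx_mul hg (hf.dx i) i p
    have e2 : (fun p => g p * (dx i (dx i f) p + -(1 / (2 * τ)) * (p.1 i * dx i f p))) =
        fun p => g p * dx i (dx i f) p + -(1 / (2 * τ)) * (p.1 i * (g p * dx i f p)) := by
      funext p; ring
    rw [e1, gaussInt_add ((hg.dx i).mul (hf.dx i)) (hg.mul ((hf.dx i).dx i))] at h1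
    rw [e2, gaussInt_add (hg.mul ((hf.dx i).dx i))
      (((hg.mul (hf.dx i)).coord_mul i).const_mul _), gaussInt_const_mul]
    linarith
  unfold ou
  simp only [Finset.mul_sum]
  rw [gaussInt_sum fun i => (hg.dx i).mul (hf.dx i), gaussInt_sum fun i => hg.mul
    (((hf.dx i).dx i).add (((hf.dx i).coord_mul i).const_mul _)), eq_neg_iff_add_eq_zero,
    add_comm, ← Finset.sum_add_distrib]
  exact Finset.sum_eq_zero fun i _ => h i

theorem vel_mul (hf : IsTest f) (hg : IsTest g) (τ : ℝ) (p : EuclideanSpace ℝ (Fin n) × ℝ) :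
    vel τ (fun p => f p * g p) p = vel τ f p * g p + f p * vel τ g p := by
  unfold vel
  simp only [dx_mul hf hg, dt_mul hf hg]
  have : ∑ i, p.1 i * (dx i f p * g p + f p * dx i g p) =
      (∑ i, p.1 i * dx i f p) * g p + f p * ∑ i, p.1 i * dx i g p := by
    rw [Finset.sum_mul, Finset.mul_sum, ← Finset.sum_add_distrib]
    congr 1; funext i; ring
  rw [this]; ring

theorem vel_sum {F : Fin n → EuclideanSpace ℝ (Fin n) × ℝ → ℝ} (hF : ∀ i, IsTest (F i))
    (τ : ℝ) (p : EuclideanSpace ℝ (Fin n) × ℝ) :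
    vel τ (fun p => ∑ j, F j p) p = ∑ j, vel τ (F j) p := by
  unfold vel
  simp only [dx_sum hF, dt_sum hF, Finset.mul_sum]
  rw [Finset.sum_comm, ← Finset.sum_add_distrib]

theorem vel_dx (hf : IsTest f) (τ : ℝ) (i : Fin n) (p : EuclideanSpace ℝ (Fin n) × ℝ) :
    vel τ (dx i f) p = dx i (vel τ f) p - 1 / (2 * τ) * dx i f p := by
  unfold vel
  rw [dx_add hf.dt ((IsTest.sum fun i => (hf.dx i).coord_mul i).const_mul _),
    dx_const_mul (IsTest.sum fun i => (hf.dx i).coord_mul i),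
    dx_sum fun i => (hf.dx i).coord_mul i]
  simp only [dx_coord_mul (hf.dx _), Finset.sum_add_distrib, dx_dt_comm hf i, dx_dx_comm hf i]
  simp
  ring

theorem vel_gradSq (hf : IsTest f) (τ : ℝ) (p : EuclideanSpace ℝ (Fin n) × ℝ) :
    vel τ (gradSq f) p =
      2 * (∑ i, dx i (vel τ f) p * dx i f p) + -(1 / τ) * gradSq f p := by
  unfold gradSq
  rw [vel_sum fun i => (hf.dx i).mul (hf.dx i), Finset.mul_sum, Finset.mul_sum,
    ← Finset.sum_add_distrib]
  refine Finset.sum_congr rfl fun i _ => ?_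
  rw [vel_mul (hf.dx i) (hf.dx i), vel_dx hf]
  ring

theorem hasDerivAt_gaussInt_vel (hf : IsTest f) {a t : ℝ} (ht : 0 < t + a) :
    HasDerivAt (fun s => gaussInt (s + a) f s)
      (gaussInt (t + a) (vel (t + a) f) t + n / (2 * (t + a)) * gaussInt (t + a) f t) t := by
  refine (hasDerivAt_gaussInt hf ht).congr_deriv ?_
  have hx : ∀ i : Fin n, IsTest fun p => p.1 i * dx i f p := fun i => (hf.dx i).coord_mul i
  unfold vel
  rw [gaussInt_add hf.dt ((IsTest.sum hx).const_mul _), gaussInt_const_mul, gaussInt_sum hx]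

theorem hasDerivAt_gaussInt_sq (hf : IsTest f) {a t : ℝ} (ht : 0 < t + a) :
    HasDerivAt (fun s => gaussInt (s + a) (fun p => f p * f p) s)
      (2 * gaussInt (t + a) (fun p => vel (t + a) f p * f p) t +
        n / (2 * (t + a)) * gaussInt (t + a) (fun p => f p * f p) t) t := by
  refine (hasDerivAt_gaussInt_vel (hf.mul hf) ht).congr_deriv ?_
  have e : vel (t + a) (fun p => f p * f p) = fun p => 2 * (vel (t + a) f p * f p) :=
    funext fun p => by rw [vel_mul hf hf]; ring
  rw [e, gaussInt_const_mul]

theorem hasDerivAt_gaussInt_gradSq (hf : IsTest f) {a t : ℝ} (ht : 0 < t + a) :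
    HasDerivAt (fun s => gaussInt (s + a) (gradSq f) s)
      (-2 * gaussInt (t + a) (fun p => vel (t + a) f p * ou (t + a) f p) t +
        (n / 2 - 1) / (t + a) * gaussInt (t + a) (gradSq f) t) t := by
  refine (hasDerivAt_gaussInt_vel hf.gradSq ht).congr_deriv ?_
  have e : vel (t + a) (gradSq f) = fun p => 2 * (∑ i, dx i (vel (t + a) f) p * dx i f p) +
      -(1 / (t + a)) * gradSq f p := funext (vel_gradSq hf _)
  have h1 : IsTest fun p => ∑ i, dx i (vel (t + a) f) p * dx i f p :=
    IsTest.sum fun i => ((hf.vel _).dx i).mul (hf.dx i)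
  rw [e, gaussInt_add (h1.const_mul _) (hf.gradSq.const_mul _), gaussInt_const_mul,
    gaussInt_const_mul, gaussInt_mul_ou hf (hf.vel _)]
  field_simp
  ring

theorem gaussInt_sq_add (hf : IsTest f) (hg : IsTest g) (c τ t : ℝ) :
    gaussInt τ (fun p => (f p + c * g p) * (f p + c * g p)) t =
      gaussInt τ (fun p => f p * f p) t + 2 * c * gaussInt τ (fun p => f p * g p) t +
        c ^ 2 * gaussInt τ (fun p => g p * g p) t := by
  rw [← gaussInt_const_mul, ← gaussInt_const_mul,
    ← gaussInt_add (hf.mul hf) ((hf.mul hg).const_mul _),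
    ← gaussInt_add ((hf.mul hf).add ((hf.mul hg).const_mul _)) ((hg.mul hg).const_mul _)]
  congr 1; funext p; ring

theorem gaussInt_nonneg (hf : ∀ p, 0 ≤ f p) (τ t : ℝ) : 0 ≤ gaussInt τ f t :=
  integral_nonneg fun _ => mul_nonneg (hf _) (Real.exp_pos _).le

/-- The positive commutator estimate at a fixed time. Here `R` is the squared norm of
`ou f + b f`. -/
theorem exists_commutator_bound (hf : IsTest f) (a t b β : ℝ) (ht : 0 < t + a) :
    ∃ D' H' R : ℝ,
      HasDerivAt (fun s => gaussInt (s + a) (gradSq f) s) D' t ∧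
      HasDerivAt (fun s => gaussInt (s + a) (fun p => f p * f p) s) H' t ∧
      0 ≤ R ∧
      2 * β * gaussInt (t + a) (gradSq f) t ≤
        R + (2 * β * b + β ^ 2) * gaussInt (t + a) (fun p => f p * f p) t ∧
      R - D' + ((n / 2 - 1) / (t + a) + 2 * b) * gaussInt (t + a) (gradSq f) t + b * H' -
          (b * (n / (2 * (t + a))) + 2 * b ^ 2) * gaussInt (t + a) (fun p => f p * f p) t ≤
        gaussInt (t + a) (fun p => heat f p * heat f p) t := by
  have hv := hf.vel (t + a)
  have ho := hf.ou (t + a)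
  have hsq : ∀ g : EuclideanSpace ℝ (Fin n) × ℝ → ℝ,
      0 ≤ gaussInt (t + a) (fun p => g p * g p) t :=
    fun g => gaussInt_nonneg (fun p => mul_self_nonneg _) _ _
  refine ⟨_, _, gaussInt (t + a)
    (fun p => (ou (t + a) f p + b * f p) * (ou (t + a) f p + b * f p)) t,
    hasDerivAt_gaussInt_gradSq hf ht, hasDerivAt_gaussInt_sq hf ht, hsq _, ?_, ?_⟩
  all_goals
    have hD : gaussInt (t + a) (fun p => ou (t + a) f p * f p) t =
        -gaussInt (t + a) (gradSq f) t := by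
      simp only [mul_comm (ou _ _ _)]
      exact gaussInt_mul_ou hf hf _ _
    have hR := gaussInt_sq_add ho hf b (t + a) t
    rw [hD] at hR
  · have h := hsq fun p => ou (t + a) f p + (b + β) * f p
    rw [gaussInt_sq_add ho hf, hD] at h
    rw [hR]
    linarith
  · have h := hsq fun p => vel (t + a) f p + (-b) * f p
    rw [gaussInt_sq_add hv hf] at h
    have hQ := gaussInt_sq_add ho hv 1 (t + a) t
    simp only [one_mul, ou_add_vel] at hQ
    have hc : gaussInt (t + a) (fun p => ou (t + a) f p * vel (t + a) f p) t =
        gaussInt (t + a) (fun p => vel (t + a) f p * ou (t + a) f p) t := by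
      simp only [mul_comm]
    rw [hQ, hR, hc]
    linarith

/-- The profile `τ exp (-ατ/10)` underlying the Carleman weight. -/
noncomputable def profile (α τ : ℝ) : ℝ := τ * Real.exp (-(α / 10) * τ)

theorem profile_pos {α τ : ℝ} (hτ : 0 < τ) : 0 < profile α τ := mul_pos hτ (Real.exp_pos _)

theorem profile_le {α τ : ℝ} (hα : 0 ≤ α) (hτ : 0 ≤ τ) : profile α τ ≤ τ :=
  mul_le_of_le_one_right hτ (Real.exp_le_one_iff.2 (by nlinarith))

theorem le_profile {α τ : ℝ} (hτ : 0 ≤ τ) (h : α * τ ≤ 6) : τ / 3 ≤ profile α τ := by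
  have := Real.add_one_le_exp (-(α / 10) * τ)
  unfold profile
  rw [div_eq_mul_inv]
  exact mul_le_mul_of_nonneg_left (by linarith) hτ

theorem hasDerivAt_profile {α τ : ℝ} (hτ : 0 < τ) :
    HasDerivAt (profile α) ((1 / τ - α / 10) * profile α τ) τ := by
  have h := (hasDerivAt_id τ).mul (((hasDerivAt_id τ).const_mul (-(α / 10))).exp)
  refine h.congr_deriv ?_
  simp only [profile, id]
  field_simp
  ring

theorem hasDerivAt_profile_rpow {α a t : ℝ} (ht : 0 < t + a) :
    HasDerivAt (fun s => profile α (s + a) ^ (1 - α))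
      ((1 - α) * (1 / (t + a) - α / 10) * profile α (t + a) ^ (1 - α)) t := by
  have hp := profile_pos (α := α) ht
  have h := ((hasDerivAt_profile (α := α) ht).comp_add_const t a).rpow_const
    (p := 1 - α) (Or.inl hp.ne')
  refine h.congr_deriv ?_
  rw [Real.rpow_sub_one hp.ne']
  field_simp

theorem profile_rpow_neg {α τ : ℝ} (hτ : 0 < τ) :
    profile α τ ^ (-α) * profile α τ = profile α τ ^ (1 - α) := by
  have hp := profile_pos (α := α) hτ
  rw [← Real.rpow_add_one hp.ne', neg_add_eq_sub]

theorem carleman_interval {α a : ℝ} (hα : 2 ≤ α) (ha : 0 < a) (ha' : a ≤ 1 / α) (hf : IsTest f)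
    (hD : gaussInt (5 / α + a) (gradSq f) (5 / α) = 0)
    (hH : gaussInt (5 / α + a) (fun p => f p * f p) (5 / α) = 0) :
    α ^ 2 * (∫ t in (0 : ℝ)..5 / α, profile α (t + a) ^ (-α) *
        gaussInt (t + a) (fun p => f p * f p) t) +
      α * (∫ t in (0 : ℝ)..5 / α, profile α (t + a) ^ (1 - α) * gaussInt (t + a) (gradSq f) t) ≤
    400 * (∫ t in (0 : ℝ)..5 / α, profile α (t + a) ^ (1 - α) *
        gaussInt (t + a) (fun p => heat f p * heat f p) t) +
      profile α a ^ (-α) * (-(a / 400) * gaussInt a (gradSq f) 0 +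
        400 * α * gaussInt a (fun p => f p * f p) 0) := by
  have hα0 : 0 < α := by linarith
  have hT : 0 ≤ 5 / α := by positivity
  set H := fun t => gaussInt (t + a) (fun p => f p * f p) t with hHdef
  set D := fun t => gaussInt (t + a) (gradSq f) t with hDdef
  set Q := fun t => gaussInt (t + a) (fun p => heat f p * heat f p) t with hQdef
  set W := fun t => profile α (t + a) ^ (1 - α) with hWdef
  set V := fun t => profile α (t + a) ^ (-α) with hVdef
  set b := fun t => ((α - n / 2) * (t + a)⁻¹ - (α - 1) * (α / 10)) / 2 with hbdef
  have hpos : ∀ t ∈ Icc (0 : ℝ) (5 / α), 0 < t + a := fun t ht => by linarith [ht.1]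
  have hle : ∀ t ∈ Icc (0 : ℝ) (5 / α), α * (t + a) ≤ 6 := fun t ht => by
    have h1 := ht.2
    rw [le_div_iff₀ hα0] at h1 ha'
    linarith
  have cont : ∀ {g : EuclideanSpace ℝ (Fin n) × ℝ → ℝ}, IsTest g →
      ContinuousOn (fun t => gaussInt (t + a) g t) (Icc 0 (5 / α)) := fun hg t ht =>
    (hasDerivAt_gaussInt hg (hpos t ht)).continuousAt.continuousWithinAt
  have cH : ContinuousOn H (Icc 0 (5 / α)) := cont (hf.mul hf)
  have cD : ContinuousOn D (Icc 0 (5 / α)) := cont hf.gradSq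
  have cQ : ContinuousOn Q (Icc 0 (5 / α)) := cont (hf.heat.mul hf.heat)
  have cW : ContinuousOn W (Icc 0 (5 / α)) := fun t ht =>
    (hasDerivAt_profile_rpow (hpos t ht)).continuousAt.continuousWithinAt
  have cV : ContinuousOn V (Icc 0 (5 / α)) := fun t ht =>
    ((((hasDerivAt_profile (hpos t ht)).comp_add_const t a).rpow_const
    (p := -α) (Or.inl (profile_pos (hpos t ht)).ne'))).continuousAt.continuousWithinAt
  have db : ∀ t ∈ Icc (0 : ℝ) (5 / α),
      HasDerivAt b (-(α - n / 2) / (2 * (t + a) ^ 2)) t := by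
    intro t ht
    have := (((((hasDerivAt_id t).add_const a).fun_inv (hpos t ht).ne').const_mul
      (α - n / 2)).sub_const ((α - 1) * (α / 10))).div_const 2
    refine this.congr_deriv ?_
    have := (hpos t ht).ne'
    simp only [id]
    field_simp
  have cb : ContinuousOn b (Icc 0 (5 / α)) := fun t ht =>
    (db t ht).continuousAt.continuousWithinAt
  have hWpos : ∀ t ∈ Icc (0 : ℝ) (5 / α), 0 < W t := fun t ht =>
    Real.rpow_pos_of_pos (profile_pos (hpos t ht)) _
  have hVW : ∀ t ∈ Icc (0 : ℝ) (5 / α), V t ≤ 3 * W t * (t + a)⁻¹ := by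
    intro t ht
    have hp := hpos t ht
    have h1 : V t * profile α (t + a) = W t := profile_rpow_neg hp
    have h2 := le_profile hp.le (hle t ht)
    have h3 : 0 < V t := Real.rpow_pos_of_pos (profile_pos hp) _
    rw [← div_eq_mul_inv, le_div_iff₀ hp, ← h1]
    nlinarith
  have hHnn : ∀ t, 0 ≤ H t := fun t => gaussInt_nonneg (fun p => mul_self_nonneg _) _ _
  have hDnn : ∀ t, 0 ≤ D t := fun t =>
    gaussInt_nonneg (fun p => Finset.sum_nonneg fun i _ => mul_self_nonneg _) _ _
  have hn : (0 : ℝ) ≤ n := n.cast_nonneg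
  have key : ∀ t ∈ Icc (0 : ℝ) (5 / α), ∃ B' : ℝ,
      HasDerivAt (fun s => -(W s * D s) + b s * W s * H s) B' t ∧
      B' ≤ W t * Q t - 1 / 400 * (α ^ 2 * (V t * H t) + α * (W t * D t)) := by
    intro t ht
    have hp := hpos t ht
    have hl := hle t ht
    obtain ⟨D', H', R, hD', hH', hR, h1, h2⟩ := exists_commutator_bound hf a t (b t) α hp
    have hW' := hasDerivAt_profile_rpow (α := α) (a := a) hp
    refine ⟨_, (hW'.mul hD').neg.add (((db t ht).mul hW').mul hH'), ?_⟩
    change 2 * α * D t ≤ R + (2 * α * b t + α ^ 2) * H t at h1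
    change R - D' + ((n / 2 - 1) / (t + a) + 2 * b t) * D t + b t * H' -
      (b t * (n / (2 * (t + a))) + 2 * b t ^ 2) * H t ≤ Q t at h2
    change -((1 - α) * (1 / (t + a) - α / 10) * W t * D t + W t * D') +
      ((-(α - n / 2) / (2 * (t + a) ^ 2) * W t +
        b t * ((1 - α) * (1 / (t + a) - α / 10) * W t)) * H t + b t * W t * H') ≤ _
    have hW := hWpos t ht
    have hbv : b t = ((α - n / 2) * (t + a)⁻¹ - (α - 1) * (α / 10)) / 2 := rfl
    set r := (t + a)⁻¹ with hr
    have hrpos : 0 < r := inv_pos.2 hp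
    have hrα : α ≤ 6 * r := by
      rw [hr, ← div_eq_mul_inv, le_div_iff₀ hp]; exact hl
    have e1 : (n / 2 - 1) / (t + a) = (n / 2 - 1) * r := div_eq_mul_inv _ _
    have e2 : (n : ℝ) / (2 * (t + a)) = n / 2 * r := by rw [hr]; field_simp
    have e3 : -(α - n / 2) / (2 * (t + a) ^ 2) = -(α - n / 2) / 2 * r ^ 2 := by
      rw [hr]; field_simp
    have e4 : 1 / (t + a) = r := one_div _
    rw [e1, e2] at h2
    rw [e3, e4]
    have hmain : -((1 - α) * (r - α / 10) * W t * D t + W t * D') +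
        ((-(α - n / 2) / 2 * r ^ 2 * W t + b t * ((1 - α) * (r - α / 10) * W t)) * H t +
          b t * W t * H') =
        W t * (R - D' + ((n / 2 - 1) * r + 2 * b t) * D t + b t * H' -
          (b t * (n / 2 * r) + 2 * b t ^ 2) * H t) - W t * (R + (α - 1) * α / 20 * r * H t) := by
      rw [hbv]; ring
    rw [hmain]
    have h3 := mul_le_mul_of_nonneg_left h2 hW.le
    have hHt := hHnn t
    have hbound : 3 * α ^ 2 * r * H t + α * D t ≤ 400 * (R + (α - 1) * α / 20 * r * H t) := by
      have hb2 : 2 * α * b t + α ^ 2 ≤ 7 * α ^ 2 * r := by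
        rw [hbv]
        have : 0 ≤ n / 2 * r * α := by positivity
        have h5 : α * α ≤ 6 * r * α := mul_le_mul_of_nonneg_right hrα hα0.le
        have h6 : 6 * r * α ≤ 3 * r * α ^ 2 := by
          have : 0 ≤ 3 * r * α * (α - 2) := mul_nonneg (by positivity) (by linarith)
          linarith
        have h7 : 0 ≤ (α - 1) * (α / 10) * α :=
          mul_nonneg (mul_nonneg (by linarith) (by positivity)) hα0.le
        have h8 : 0 ≤ r * α ^ 2 := by positivity
        linarith
      have h4 := mul_le_mul_of_nonneg_right hb2 hHt
      have h5 : 0 ≤ r * H t * α * (α - 2) := mul_nonneg (by positivity) (by linarith)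
      have h6 : 0 ≤ r * H t * α ^ 2 := by positivity
      linarith
    have h4 := mul_le_mul_of_nonneg_left hbound hW.le
    have h5 : V t * H t ≤ 3 * W t * r * H t := mul_le_mul_of_nonneg_right (hVW t ht) hHt
    have h6 := mul_le_mul_of_nonneg_left h5 (sq_nonneg α)
    linarith
  choose! B' hB' hB'le using key
  have ii : ∀ {g : ℝ → ℝ}, ContinuousOn g (Icc 0 (5 / α)) →
      IntervalIntegrable g volume 0 (5 / α) := fun hg => hg.intervalIntegrable_of_Icc hT
  have ftc := intervalIntegral.sub_le_integral_of_hasDeriv_right_of_le hT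
    (φ := fun t => W t * Q t - 1 / 400 * (α ^ 2 * (V t * H t) + α * (W t * D t)))
    (fun t ht => (hB' t ht).continuousAt.continuousWithinAt)
    (fun t ht => (hB' t (Ioo_subset_Icc_self ht)).hasDerivWithinAt)
    (ContinuousOn.integrableOn_Icc (by fun_prop))
    (fun t ht => hB'le t (Ioo_subset_Icc_self ht))
  rw [intervalIntegral.integral_sub (ii (by fun_prop)) (ii (by fun_prop)),
    intervalIntegral.integral_const_mul, intervalIntegral.integral_add (ii (by fun_prop))
      (ii (by fun_prop)), intervalIntegral.integral_const_mul,
    intervalIntegral.integral_const_mul] at ftc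
  have hDT : D (5 / α) = 0 := hD
  have hHT : H (5 / α) = 0 := hH
  rw [hDT, hHT] at ftc
  have h0 : (0 : ℝ) ∈ Icc 0 (5 / α) := ⟨le_rfl, hT⟩
  have hbd : W 0 * (-D 0) + W 0 * b 0 * H 0 ≤
      profile α a ^ (-α) * (-(a / 3) * D 0 + α / 2 * H 0) := by
    have h1 : W 0 = profile α a ^ (-α) * profile α a := by
      simp only [hWdef, zero_add]; exact (profile_rpow_neg ha).symm
    have hl := hle 0 h0
    rw [zero_add] at hl
    have h2 := le_profile ha.le hl
    have h3 := profile_le hα0.le ha.le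
    have hp := profile_pos (α := α) ha
    have h4 : profile α a * b 0 ≤ α / 2 := by
      have : b 0 ≤ α / 2 * a⁻¹ := by
        simp only [hbdef, zero_add]
        have h5 : 0 ≤ n / 2 * a⁻¹ := by positivity
        have h7 : 0 ≤ (α - 1) * (α / 10) := mul_nonneg (by linarith) (by positivity)
        linarith
      calc profile α a * b 0 ≤ profile α a * (α / 2 * a⁻¹) :=
            mul_le_mul_of_nonneg_left this hp.le
        _ ≤ a * (α / 2 * a⁻¹) := mul_le_mul_of_nonneg_right h3 (by positivity)
        _ = α / 2 := by field_simp
    rw [h1]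
    have h5 := mul_le_mul_of_nonneg_right h2 (hDnn 0)
    have h6 := mul_le_mul_of_nonneg_right h4 (hHnn 0)
    have h7 := mul_le_mul_of_nonneg_left (add_le_add (neg_le_neg h5) h6)
      (Real.rpow_nonneg hp.le (-α))
    linarith
  have e1 : gaussInt a (gradSq f) 0 = D 0 := by simp only [hDdef, zero_add]
  have e2 : gaussInt a (fun p => f p * f p) 0 = H 0 := by simp only [hHdef, zero_add]
  rw [e1, e2]
  have hV0 : 0 ≤ profile α a ^ (-α) := Real.rpow_nonneg (profile_pos ha).le _
  have h8 : 0 ≤ profile α a ^ (-α) * (a * D 0) := mul_nonneg hV0 (mul_nonneg ha.le (hDnn 0))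
  have h9 : 0 ≤ profile α a ^ (-α) * (α * H 0) := mul_nonneg hV0 (mul_nonneg hα0.le (hHnn 0))
  linarith

theorem monotoneOn_profile {α : ℝ} (hα : 0 < α) :
    MonotoneOn (profile α) (Icc 0 (10 / α)) := by
  refine monotoneOn_of_deriv_nonneg (convex_Icc _ _) ?_ ?_ ?_
  · unfold profile; fun_prop
  · unfold profile; fun_prop
  · intro τ hτ
    rw [interior_Icc] at hτ
    rw [(hasDerivAt_profile hτ.1).deriv]
    refine mul_nonneg (sub_nonneg.2 ?_) (profile_pos hτ.1).le
    have h := hτ.2.le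
    rw [le_div_iff₀ hα] at h
    rw [div_le_div_iff₀ (by norm_num) hτ.1]
    linarith

theorem norm_gradient_slice_sq (hf : Differentiable ℝ f) (x : EuclideanSpace ℝ (Fin n)) (t : ℝ) :
    ‖gradient (fun y => f (y, t)) x‖ ^ 2 = gradSq f (x, t) := by
  rw [EuclideanSpace.norm_sq_eq]
  refine Finset.sum_congr rfl fun i _ => ?_
  have h : (gradient (fun y => f (y, t)) x) i = dx i f (x, t) := by
    have : inner ℝ (gradient (fun y => f (y, t)) x) (EuclideanSpace.single i 1) =
        dx i f (x, t) := by
      rw [gradient, InnerProductSpace.toDual_symm_apply, fderiv_slice hf]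
    rw [EuclideanSpace.inner_single_right] at this
    simpa only [one_mul, conj_trivial] using this
  rw [h, Real.norm_eq_abs, sq_abs, pow_two]

theorem slap_add_deriv_slice (hf : IsTest f) (x : EuclideanSpace ℝ (Fin n)) (t : ℝ) :
    slap (fun y => f (y, t)) x + deriv (fun s => f (x, s)) t = heat f (x, t) := by
  rw [(hasDerivAt_slice hf.differentiable x t).deriv]
  simp only [slap, heat, fderiv_slice hf.differentiable, fderiv_slice (hf.dx _).differentiable]

theorem fderiv_eq_zero_of_lt {T : ℝ} (h : ∀ p, T < p.2 → f p = 0)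
    (p : EuclideanSpace ℝ (Fin n) × ℝ) (hp : T < p.2) : fderiv ℝ f p = 0 := by
  have : f =ᶠ[𝓝 p] fun _ => 0 := by
    filter_upwards [(isOpen_lt continuous_const continuous_snd).mem_nhds hp] with q hq
    exact h q hq
  rw [this.fderiv_eq]; simp

theorem dx_eq_zero_of_lt {T : ℝ} (h : ∀ p, T < p.2 → f p = 0) (i : Fin n) :
    ∀ p, T < p.2 → dx i f p = 0 := fun p hp => by
  simp [dx, fderiv_eq_zero_of_lt h p hp]

theorem gradSq_eq_zero_of_lt {T : ℝ} (h : ∀ p, T < p.2 → f p = 0) :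
    ∀ p, T < p.2 → gradSq f p = 0 := fun p hp =>
  Finset.sum_eq_zero fun i _ => by rw [dx_eq_zero_of_lt h i p hp, zero_mul]

theorem heat_eq_zero_of_lt {T : ℝ} (h : ∀ p, T < p.2 → f p = 0) :
    ∀ p, T < p.2 → heat f p = 0 := fun p hp => by
  have hs : ∑ i, dx i (dx i f) p = 0 :=
    Finset.sum_eq_zero fun i _ => dx_eq_zero_of_lt (dx_eq_zero_of_lt h i) i p hp
  simp [heat, hs, dt, fderiv_eq_zero_of_lt h p hp]

theorem gaussInt_eq_zero {t : ℝ} (h : ∀ x, f (x, t) = 0) (τ : ℝ) : gaussInt τ f t = 0 := by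
  simp [gaussInt, h]

/-- Rewriting of the space-time integrals through the Gaussian integrals of time slices. -/
theorem setIntegral_Ioi_eq {α a e : ℝ} (hα : 0 < α) (ha : a ≤ 1 / α)
    (hf : ∀ p, 4 / α < p.2 → f p = 0) :
    ∫ t in Ioi (0 : ℝ), ∫ x : EuclideanSpace ℝ (Fin n),
        profile α (min (t + a) (10 / α)) ^ e * f (x, t) * Real.exp (-‖x‖ ^ 2 / (4 * (t + a))) =
      ∫ t in (0 : ℝ)..5 / α, profile α (t + a) ^ e * gaussInt (t + a) f t := by
  rw [intervalIntegral.integral_of_le (by positivity)]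
  have h1 : ∀ t, ∫ x : EuclideanSpace ℝ (Fin n),
      profile α (min (t + a) (10 / α)) ^ e * f (x, t) * Real.exp (-‖x‖ ^ 2 / (4 * (t + a))) =
      profile α (min (t + a) (10 / α)) ^ e * gaussInt (t + a) f t := by
    intro t
    simp only [mul_assoc, integral_const_mul]
    rfl
  simp only [h1]
  rw [setIntegral_eq_of_subset_of_forall_sdiff_eq_zero measurableSet_Ioi
    (Ioc_subset_Ioi_self : Ioc (0 : ℝ) (5 / α) ⊆ Ioi 0)]
  · refine setIntegral_congr_fun measurableSet_Ioc fun t ht => ?_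
    have : t + a ≤ 10 / α := by
      have h2 := ht.2
      rw [le_div_iff₀ hα] at *
      linarith
    simp only [min_eq_left this]
  · intro t ht
    have : 4 / α < t := by
      have h2 : 5 / α < t := not_le.1 fun h => ht.2 ⟨ht.1, h⟩
      refine lt_trans ?_ h2
      gcongr
      norm_num
    rw [gaussInt_eq_zero fun x => hf (x, t) this, mul_zero]

end Carleman

/-- Carleman inequality: given `α ≥ 2 + n/2` there are `N = N(n)` and an
increasing `σ : [0,∞) → [0,∞)` with `t/N ≤ σ(t) ≤ t` on `[0,4/α]`, such that for
`0 < a ≤ 1/α` and every `f ∈ C₀^∞(ℝⁿ × [0,4/α))` (formalized as a smooth compactly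
supported function on `ℝⁿ × ℝ` whose support lies in `{t < 4/α}`; the integrals only
involve `t ≥ 0`) the stated weighted inequality holds.  Here `σ_a(t) = σ(t+a)` and
`dX = dx dt` on `ℝⁿ × (0,∞)`. -/
theorem stmt_9 (n : ℕ) :
    ∃ N > (0 : ℝ), ∀ α : ℝ, 2 + (n : ℝ) / 2 ≤ α →
    ∃ σ : ℝ → ℝ, MonotoneOn σ (Ici (0 : ℝ)) ∧ (∀ t ∈ Ici (0 : ℝ), 0 ≤ σ t) ∧
      (∀ t ∈ Icc (0 : ℝ) (4 / α), t / N ≤ σ t ∧ σ t ≤ t) ∧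
      ∀ a : ℝ, 0 < a → a ≤ 1 / α →
      ∀ f : EuclideanSpace ℝ (Fin n) × ℝ → ℝ,
        ContDiff ℝ (⊤ : ℕ∞) f → HasCompactSupport f →
        (∀ p : EuclideanSpace ℝ (Fin n) × ℝ, p ∈ Function.support f → p.2 < 4 / α) →
        α ^ 2 * (∫ t in Ioi (0 : ℝ), ∫ x : EuclideanSpace ℝ (Fin n),
              σ (t + a) ^ (-α) * f (x, t) ^ 2 *
                Real.exp (-‖x‖ ^ 2 / (4 * (t + a)))) +
          α * (∫ t in Ioi (0 : ℝ), ∫ x : EuclideanSpace ℝ (Fin n),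
              σ (t + a) ^ (1 - α) * ‖gradient (fun y => f (y, t)) x‖ ^ 2 *
                Real.exp (-‖x‖ ^ 2 / (4 * (t + a)))) ≤
        N * (∫ t in Ioi (0 : ℝ), ∫ x : EuclideanSpace ℝ (Fin n),
              σ (t + a) ^ (1 - α) *
                (slap (fun y => f (y, t)) x + deriv (fun s => f (x, s)) t) ^ 2 *
                Real.exp (-‖x‖ ^ 2 / (4 * (t + a)))) +
          σ a ^ (-α) *
            (-(a / N) * (∫ x : EuclideanSpace ℝ (Fin n),
                ‖gradient (fun y => f (y, 0)) x‖ ^ 2 * Real.exp (-‖x‖ ^ 2 / (4 * a))) +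
              N * α * (∫ x : EuclideanSpace ℝ (Fin n),
                f (x, 0) ^ 2 * Real.exp (-‖x‖ ^ 2 / (4 * a)))) := by
  open Carleman in
  refine ⟨400, by norm_num, fun α hα => ?_⟩
  have hα2 : 2 ≤ α := by
    have : (0 : ℝ) ≤ n := n.cast_nonneg
    linarith
  have hα0 : 0 < α := by linarith
  have h10 : 0 ≤ 10 / α := by positivity
  refine ⟨fun t => profile α (min t (10 / α)), ?_, ?_, ?_, ?_⟩
  · intro s hs t ht hst
    exact monotoneOn_profile hα0 ⟨le_min hs h10, min_le_right _ _⟩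
      ⟨le_min ht h10, min_le_right _ _⟩ (min_le_min_right _ hst)
  · intro t ht
    exact mul_nonneg (le_min ht h10) (Real.exp_pos _).le
  · intro t ht
    have h4 := ht.2
    rw [le_div_iff₀ hα0] at h4
    have h5 : t ≤ 10 / α := by rw [le_div_iff₀ hα0]; linarith
    simp only [min_eq_left h5]
    refine ⟨le_trans ?_ (le_profile ht.1 (by linarith)), profile_le hα0.le ht.1⟩
    have := ht.1
    linarith
  · intro a ha ha' f hf hfc hsupp
    have hT : IsTest f := ⟨hf, hfc⟩
    have hz : ∀ p : EuclideanSpace ℝ (Fin n) × ℝ, 4 / α < p.2 → f p = 0 := fun p hp => by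
      by_contra h
      exact (hsupp p h).not_gt hp
    have h45 : 4 / α < 5 / α := by gcongr; norm_num
    have haα : a ≤ 10 / α := ha'.trans (by gcongr; norm_num)
    have hz2 : ∀ p : EuclideanSpace ℝ (Fin n) × ℝ, 4 / α < p.2 → f p * f p = 0 :=
      fun p hp => by rw [hz p hp, zero_mul]
    have hzq : ∀ p : EuclideanSpace ℝ (Fin n) × ℝ, 4 / α < p.2 → heat f p * heat f p = 0 :=
      fun p hp => by rw [heat_eq_zero_of_lt hz p hp, zero_mul]
    have main := carleman_interval hα2 ha ha' hT
      (gaussInt_eq_zero (fun x => gradSq_eq_zero_of_lt hz (x, 5 / α) h45) _)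
      (gaussInt_eq_zero (fun x => hz2 (x, 5 / α) h45) _)
    rw [← setIntegral_Ioi_eq hα0 ha' hz2, ← setIntegral_Ioi_eq hα0 ha' hzq,
      ← setIntegral_Ioi_eq hα0 ha' (gradSq_eq_zero_of_lt hz)] at main
    simp only [norm_gradient_slice_sq hT.differentiable, slap_add_deriv_slice hT, min_eq_left haα,
      pow_two (f _), pow_two (heat f _)]
    exact main
end

section
/- There exist a constant N = N(n) depending only on the dimension n and an increasing function h : [0,∞) → [0,∞) satisfying t/N ≤ h(t) ≤ t for t ∈ [0,6], such that for every α ≥ 2 + n/2, every a with 0 < a ≤ 1, and every u ∈ C_0^∞(ℝ^n × [0,4)), the inequality α ∫ h_a^{-α} u^2 e^{-|x|^2/(4(t+a))} dX + ∫ h_a^{1-α} |∇u|^2 e^{-|x|^2/(4(t+a))} dX ≤ N ∫ h_a^{1-α} (Δu + ∂_t u)^2 e^{-|x|^2/(4(t+a))} dX + h(a)^{-α} [ −(a/N) ∫_{ℝ^n} |∇u(x,0)|^2 e^{-|x|^2/(4a)} dx + N α ∫_{ℝ^n} u(x,0)^2 e^{-|x|^2/(4a)} dx ] holds. -/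
open MeasureTheory Real Set Metric

section CarlemanCalculus

variable {n : ℕ}

/-- The partial derivative in the `i`-th space variable. -/
noncomputable def spaceDeriv (i : Fin n) (u : EuclideanSpace ℝ (Fin n) × ℝ → ℝ) :
    EuclideanSpace ℝ (Fin n) × ℝ → ℝ :=
  fun p => fderiv ℝ u p (EuclideanSpace.single i 1, 0)

/-- The partial derivative in the time variable. -/
noncomputable def timeDeriv (u : EuclideanSpace ℝ (Fin n) × ℝ → ℝ) :
    EuclideanSpace ℝ (Fin n) × ℝ → ℝ :=
  fun p => fderiv ℝ u p (0, 1)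

/-- The squared length of the spatial gradient. -/
noncomputable def gradSq (u : EuclideanSpace ℝ (Fin n) × ℝ → ℝ)
    (p : EuclideanSpace ℝ (Fin n) × ℝ) : ℝ :=
  ∑ i, spaceDeriv i u p ^ 2

/-- The spatial Laplacian. -/
noncomputable def spaceLaplacian (u : EuclideanSpace ℝ (Fin n) × ℝ → ℝ)
    (p : EuclideanSpace ℝ (Fin n) × ℝ) : ℝ :=
  ∑ i, spaceDeriv i (spaceDeriv i u) p

/-- The radial derivative `x · ∇u`. -/
noncomputable def radialDeriv (u : EuclideanSpace ℝ (Fin n) × ℝ → ℝ)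
    (p : EuclideanSpace ℝ (Fin n) × ℝ) : ℝ :=
  ∑ i, p.1 i * spaceDeriv i u p

/-- The weight `(s e^{-s/6})^{1-α} e^{-|x|²/(4s)}` for `s > 0`. -/
noncomputable def carlemanWeight (α s : ℝ) (x : EuclideanSpace ℝ (Fin n)) : ℝ :=
  Real.exp ((1 - α) * (Real.log s - s / 6) - ‖x‖ ^ 2 / (4 * s))

theorem contDiff_spaceDeriv {u : EuclideanSpace ℝ (Fin n) × ℝ → ℝ}
    (hu : ContDiff ℝ (⊤ : ℕ∞) u) (i : Fin n) : ContDiff ℝ (⊤ : ℕ∞) (spaceDeriv i u) :=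
  (hu.fderiv_right (m := (⊤ : ℕ∞)) (by exact_mod_cast le_top)).clm_apply contDiff_const

theorem contDiff_timeDeriv {u : EuclideanSpace ℝ (Fin n) × ℝ → ℝ}
    (hu : ContDiff ℝ (⊤ : ℕ∞) u) : ContDiff ℝ (⊤ : ℕ∞) (timeDeriv u) :=
  (hu.fderiv_right (m := (⊤ : ℕ∞)) (by exact_mod_cast le_top)).clm_apply contDiff_const

theorem spaceDeriv_eq_zero {u : EuclideanSpace ℝ (Fin n) × ℝ → ℝ}
    {p : EuclideanSpace ℝ (Fin n) × ℝ} (hp : p ∉ tsupport u) (i : Fin n) :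
    spaceDeriv i u p = 0 := by
  simp [spaceDeriv, fderiv_of_notMem_tsupport ℝ hp]

theorem timeDeriv_eq_zero {u : EuclideanSpace ℝ (Fin n) × ℝ → ℝ}
    {p : EuclideanSpace ℝ (Fin n) × ℝ} (hp : p ∉ tsupport u) : timeDeriv u p = 0 := by
  simp [timeDeriv, fderiv_of_notMem_tsupport ℝ hp]

theorem tsupport_spaceDeriv_subset (u : EuclideanSpace ℝ (Fin n) × ℝ → ℝ) (i : Fin n) :
    tsupport (spaceDeriv i u) ⊆ tsupport u :=
  closure_minimal (fun _ hp => by_contra fun h => hp (spaceDeriv_eq_zero h i))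
    (isClosed_tsupport u)

theorem gradSq_eq_zero {u : EuclideanSpace ℝ (Fin n) × ℝ → ℝ}
    {p : EuclideanSpace ℝ (Fin n) × ℝ} (hp : p ∉ tsupport u) : gradSq u p = 0 := by
  simp [gradSq, spaceDeriv_eq_zero hp]

theorem radialDeriv_eq_zero {u : EuclideanSpace ℝ (Fin n) × ℝ → ℝ}
    {p : EuclideanSpace ℝ (Fin n) × ℝ} (hp : p ∉ tsupport u) : radialDeriv u p = 0 := by
  simp [radialDeriv, spaceDeriv_eq_zero hp]

theorem spaceLaplacian_eq_zero {u : EuclideanSpace ℝ (Fin n) × ℝ → ℝ}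
    {p : EuclideanSpace ℝ (Fin n) × ℝ} (hp : p ∉ tsupport u) : spaceLaplacian u p = 0 :=
  Finset.sum_eq_zero fun i _ =>
    spaceDeriv_eq_zero (fun h => hp (tsupport_spaceDeriv_subset u i h)) i

theorem fderiv_fderiv_apply_comm {u : EuclideanSpace ℝ (Fin n) × ℝ → ℝ}
    (hu : ContDiff ℝ (⊤ : ℕ∞) u) (p v w : EuclideanSpace ℝ (Fin n) × ℝ) :
    fderiv ℝ (fun q => fderiv ℝ u q v) p w = fderiv ℝ (fun q => fderiv ℝ u q w) p v := by
  have hd : DifferentiableAt ℝ (fderiv ℝ u) p :=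
    ((hu.fderiv_right (m := (⊤ : ℕ∞)) (by exact_mod_cast le_top)).differentiable
      (by simp)).differentiableAt
  have hsymm : IsSymmSndFDerivAt ℝ u p :=
    hu.contDiffAt.isSymmSndFDerivAt 
      (by rw [minSmoothness_of_isRCLikeNormedField]; exact WithTop.coe_le_coe.2 le_top)
  rw [fderiv_clm_apply hd (differentiableAt_const v),
    fderiv_clm_apply hd (differentiableAt_const w)]
  simpa using hsymm.eq w v

theorem spaceDeriv_comm {u : EuclideanSpace ℝ (Fin n) × ℝ → ℝ} (hu : ContDiff ℝ (⊤ : ℕ∞) u)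
    (i j : Fin n) (p : EuclideanSpace ℝ (Fin n) × ℝ) :
    spaceDeriv i (spaceDeriv j u) p = spaceDeriv j (spaceDeriv i u) p :=
  fderiv_fderiv_apply_comm hu p _ _

theorem timeDeriv_spaceDeriv_comm {u : EuclideanSpace ℝ (Fin n) × ℝ → ℝ}
    (hu : ContDiff ℝ (⊤ : ℕ∞) u) (i : Fin n) (p : EuclideanSpace ℝ (Fin n) × ℝ) :
    timeDeriv (spaceDeriv i u) p = spaceDeriv i (timeDeriv u) p :=
  fderiv_fderiv_apply_comm hu p _ _

theorem hasDerivAt_time {v : EuclideanSpace ℝ (Fin n) × ℝ → ℝ} (hv : Differentiable ℝ v)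
    (x : EuclideanSpace ℝ (Fin n)) (t : ℝ) :
    HasDerivAt (fun s => v (x, s)) (timeDeriv v (x, t)) t :=
  (hv (x, t)).hasFDerivAt.comp_hasDerivAt t
    ((hasDerivAt_const t x).prodMk (hasDerivAt_id t))

theorem hasDerivAt_space {v : EuclideanSpace ℝ (Fin n) × ℝ → ℝ} (hv : Differentiable ℝ v)
    (x : EuclideanSpace ℝ (Fin n)) (t : ℝ) (j : Fin n) :
    HasDerivAt (fun r : ℝ => v (x + r • EuclideanSpace.single j (1 : ℝ), t))
      (spaceDeriv j v (x, t)) 0 := by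
  have h1 : HasDerivAt (fun r : ℝ => x + r • EuclideanSpace.single j (1 : ℝ))
      (EuclideanSpace.single j (1 : ℝ)) 0 := by
    simpa using ((hasDerivAt_id (0 : ℝ)).smul_const (EuclideanSpace.single j (1 : ℝ))).const_add x
  exact HasFDerivAt.comp_hasDerivAt_of_eq (x := (0 : ℝ)) (hv (x, t)).hasFDerivAt
    (h1.prodMk (hasDerivAt_const 0 t)) (by simp)

theorem hasDerivAt_coord (x : EuclideanSpace ℝ (Fin n)) (i j : Fin n) :
    HasDerivAt (fun r : ℝ => (x + r • EuclideanSpace.single j (1 : ℝ)) i)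
      (if i = j then 1 else 0) 0 := by
  simpa [Pi.single_apply] using
    ((hasDerivAt_id (0 : ℝ)).mul_const ((EuclideanSpace.single j (1 : ℝ)) i)).const_add (x i)

theorem hasDerivAt_norm_sq (x : EuclideanSpace ℝ (Fin n)) (j : Fin n) :
    HasDerivAt (fun r : ℝ => ‖x + r • EuclideanSpace.single j (1 : ℝ)‖ ^ 2) (2 * x j) 0 := by
  have h := HasDerivAt.fun_sum (u := Finset.univ)
    fun i _ => (hasDerivAt_coord x i j).pow 2
  simp only [EuclideanSpace.norm_sq_eq, Real.norm_eq_abs, sq_abs]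
  convert! h using 1
  simp

theorem hasDerivAt_carlemanWeight_space (α s : ℝ) (x : EuclideanSpace ℝ (Fin n)) (j : Fin n) :
    HasDerivAt (fun r : ℝ => carlemanWeight α s (x + r • EuclideanSpace.single j (1 : ℝ)))
      (carlemanWeight α s x * (-(x j / (2 * s)))) 0 := by
  have h := (((hasDerivAt_norm_sq x j).div_const (4 * s)).const_sub
    ((1 - α) * (Real.log s - s / 6))).exp
  convert! h using 1
  simp only [carlemanWeight, zero_smul, add_zero]
  ring

theorem hasDerivAt_carlemanWeight_time (α : ℝ) {s : ℝ} (hs : s ≠ 0)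
    (x : EuclideanSpace ℝ (Fin n)) :
    HasDerivAt (fun r : ℝ => carlemanWeight α r x)
      (carlemanWeight α s x * ((1 - α) * (1 / s - 1 / 6) + ‖x‖ ^ 2 / (4 * s ^ 2))) s := by
  have h := ((((Real.hasDerivAt_log hs).sub ((hasDerivAt_id s).div_const 6)).const_mul
    (1 - α)).sub (((hasDerivAt_id s).const_mul 4).fun_inv (by simpa using hs) |>.const_mul
      (‖x‖ ^ 2))).exp
  convert! h using 1
  simp only [carlemanWeight, id, Pi.sub_apply, div_eq_mul_inv]
  field_simp
  ring

theorem hasDerivAt_gradSq_space {u : EuclideanSpace ℝ (Fin n) × ℝ → ℝ}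
    (hu : ContDiff ℝ (⊤ : ℕ∞) u) (x : EuclideanSpace ℝ (Fin n)) (t : ℝ) (j : Fin n) :
    HasDerivAt (fun r : ℝ => gradSq u (x + r • EuclideanSpace.single j (1 : ℝ), t))
      (∑ i, 2 * spaceDeriv i u (x, t) * spaceDeriv j (spaceDeriv i u) (x, t)) 0 := by
  have h := HasDerivAt.fun_sum (u := Finset.univ) fun i _ =>
    (hasDerivAt_space ((contDiff_spaceDeriv hu i).differentiable (by simp)) x t j).pow 2
  convert! h using 1
  simp

theorem hasDerivAt_gradSq_time {u : EuclideanSpace ℝ (Fin n) × ℝ → ℝ}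
    (hu : ContDiff ℝ (⊤ : ℕ∞) u) (x : EuclideanSpace ℝ (Fin n)) (t : ℝ) :
    HasDerivAt (fun r : ℝ => gradSq u (x, r))
      (2 * ∑ i, spaceDeriv i (timeDeriv u) (x, t) * spaceDeriv i u (x, t)) t := by
  have h := HasDerivAt.fun_sum (u := Finset.univ) fun i _ =>
    (hasDerivAt_time ((contDiff_spaceDeriv hu i).differentiable (by simp)) x t).pow 2
  convert! h using 1
  rw [Finset.mul_sum]
  refine Finset.sum_congr rfl fun i _ => ?_
  rw [timeDeriv_spaceDeriv_comm hu]
  simp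
  ring

theorem hasDerivAt_radialDeriv {u : EuclideanSpace ℝ (Fin n) × ℝ → ℝ}
    (hu : ContDiff ℝ (⊤ : ℕ∞) u) (x : EuclideanSpace ℝ (Fin n)) (t : ℝ) (j : Fin n) :
    HasDerivAt (fun r : ℝ => radialDeriv u (x + r • EuclideanSpace.single j (1 : ℝ), t))
      (spaceDeriv j u (x, t) + ∑ i, x i * spaceDeriv j (spaceDeriv i u) (x, t)) 0 := by
  have h := HasDerivAt.fun_sum (u := Finset.univ) fun i _ => (hasDerivAt_coord x i j).mul
    (hasDerivAt_space ((contDiff_spaceDeriv hu i).differentiable (by simp)) x t j)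
  convert! h using 1
  simp [Finset.sum_add_distrib]

/-- The `j`-th component of the vector field whose spatial divergence carries all the
integrations by parts of the Carleman inequality. -/
noncomputable def carlemanFlux (u : EuclideanSpace ℝ (Fin n) × ℝ → ℝ) (α s l t : ℝ) (j : Fin n)
    (x : EuclideanSpace ℝ (Fin n)) : ℝ :=
  carlemanWeight α s x *
    (2 * timeDeriv u (x, t) * spaceDeriv j u (x, t)
      + radialDeriv u (x, t) * spaceDeriv j u (x, t) / s
      - x j * (gradSq u (x, t) - l * u (x, t) ^ 2) / (2 * s)
      - 2 * l * (u (x, t) * spaceDeriv j u (x, t)))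

/-- The derivative of the `j`-th component of `carlemanFlux` in the `j`-th variable. -/
noncomputable def carlemanFluxDeriv (u : EuclideanSpace ℝ (Fin n) × ℝ → ℝ) (α s l t : ℝ)
    (j : Fin n) (x : EuclideanSpace ℝ (Fin n)) : ℝ :=
  carlemanWeight α s x *
    (2 * (spaceDeriv j (timeDeriv u) (x, t) * spaceDeriv j u (x, t))
      + 2 * timeDeriv u (x, t) * spaceDeriv j (spaceDeriv j u) (x, t)
      + (spaceDeriv j u (x, t) + ∑ i, x i * spaceDeriv j (spaceDeriv i u) (x, t))
          * spaceDeriv j u (x, t) / s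
      + radialDeriv u (x, t) * spaceDeriv j (spaceDeriv j u) (x, t) / s
      - (gradSq u (x, t) - l * u (x, t) ^ 2) / (2 * s)
      - x j * ((∑ i, 2 * spaceDeriv i u (x, t) * spaceDeriv j (spaceDeriv i u) (x, t))
          - 2 * l * u (x, t) * spaceDeriv j u (x, t)) / (2 * s)
      - 2 * l * (spaceDeriv j u (x, t) ^ 2 + u (x, t) * spaceDeriv j (spaceDeriv j u) (x, t))
      - x j / (2 * s) * (2 * timeDeriv u (x, t) * spaceDeriv j u (x, t)
        + radialDeriv u (x, t) * spaceDeriv j u (x, t) / s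
        - x j * (gradSq u (x, t) - l * u (x, t) ^ 2) / (2 * s)
        - 2 * l * (u (x, t) * spaceDeriv j u (x, t))))

theorem hasLineDerivAt_carlemanFlux {u : EuclideanSpace ℝ (Fin n) × ℝ → ℝ}
    (hu : ContDiff ℝ (⊤ : ℕ∞) u) (α s l t : ℝ) (j : Fin n) (x : EuclideanSpace ℝ (Fin n)) :
    HasLineDerivAt ℝ (carlemanFlux u α s l t j) (carlemanFluxDeriv u α s l t j x) x
      (EuclideanSpace.single j 1) := by
  have hw := hasDerivAt_carlemanWeight_space α s x j
  have hU := hasDerivAt_space (hu.differentiable (by simp)) x t j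
  have hT := hasDerivAt_space ((contDiff_timeDeriv hu).differentiable (by simp)) x t j
  have hJ := hasDerivAt_space ((contDiff_spaceDeriv hu j).differentiable (by simp)) x t j
  have hG := hasDerivAt_gradSq_space hu x t j
  have hR := hasDerivAt_radialDeriv hu x t j
  have hX := hasDerivAt_coord x j j
  have h := hw.fun_mul
    (((((hT.const_mul 2).fun_mul hJ).fun_add ((hR.fun_mul hJ).div_const s)).fun_sub
    ((hX.fun_mul (hG.fun_sub ((hU.fun_pow 2).const_mul l))).div_const (2 * s))).fun_sub
    ((hU.fun_mul hJ).const_mul (2 * l)))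
  simp only [HasLineDerivAt]
  convert! h using 1
  simp only [carlemanFluxDeriv, zero_smul, add_zero, if_true]
  ring

/-- The derivative of `carlemanWeight α (t + a) x * (gradSq u (x, t) - l * u (x, t) ^ 2)` in time
when `l` depends on `t` with derivative `l'`. -/
noncomputable def carlemanEnergyDeriv (u : EuclideanSpace ℝ (Fin n) × ℝ → ℝ) (α s l l' t : ℝ)
    (x : EuclideanSpace ℝ (Fin n)) : ℝ :=
  carlemanWeight α s x *
    (((1 - α) * (1 / s - 1 / 6) + ‖x‖ ^ 2 / (4 * s ^ 2)) * (gradSq u (x, t) - l * u (x, t) ^ 2)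
      + 2 * (∑ i, spaceDeriv i (timeDeriv u) (x, t) * spaceDeriv i u (x, t))
      - l' * u (x, t) ^ 2 - 2 * l * u (x, t) * timeDeriv u (x, t))

theorem hasDerivAt_carlemanEnergy {u : EuclideanSpace ℝ (Fin n) × ℝ → ℝ}
    (hu : ContDiff ℝ (⊤ : ℕ∞) u) (α : ℝ) {a t l' : ℝ} {l : ℝ → ℝ} (hs : t + a ≠ 0)
    (hl : HasDerivAt l l' (t + a)) (x : EuclideanSpace ℝ (Fin n)) :
    HasDerivAt (fun r => carlemanWeight α (r + a) x *
        (gradSq u (x, r) - l (r + a) * u (x, r) ^ 2))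
      (carlemanEnergyDeriv u α (t + a) (l (t + a)) l' t x) t := by
  have hw := (hasDerivAt_carlemanWeight_time α hs x).comp_add_const t a
  have hl' := hl.comp_add_const t a
  have hU := hasDerivAt_time (hu.differentiable (by simp)) x t
  have h := hw.fun_mul ((hasDerivAt_gradSq_time hu x t).fun_sub (hl'.fun_mul (hU.fun_pow 2)))
  convert! h using 1
  simp only [carlemanEnergyDeriv]
  ring

/-- The integrand that remains from `carlemanEnergyDeriv` after removing a divergence. -/
noncomputable def carlemanBulk (u : EuclideanSpace ℝ (Fin n) × ℝ → ℝ) (α s l l' t : ℝ)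
    (x : EuclideanSpace ℝ (Fin n)) : ℝ :=
  carlemanWeight α s x *
    (2 * (spaceLaplacian u (x, t) - radialDeriv u (x, t) / (2 * s)
        - (spaceLaplacian u (x, t) + timeDeriv u (x, t)) / 2 + l * u (x, t)) ^ 2
      - (spaceLaplacian u (x, t) + timeDeriv u (x, t)) ^ 2 / 2
      + ((1 - α) * (1 / s - 1 / 6) + n / (2 * s) + 2 * l - 1 / s) * gradSq u (x, t)
      - (l' + l * ((1 - α) * (1 / s - 1 / 6) + n / (2 * s) + 2 * l)) * u (x, t) ^ 2)

theorem carlemanEnergyDeriv_eq {u : EuclideanSpace ℝ (Fin n) × ℝ → ℝ}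
    (hu : ContDiff ℝ (⊤ : ℕ∞) u) (α : ℝ) {s : ℝ} (hs : s ≠ 0) (l l' t : ℝ)
    (x : EuclideanSpace ℝ (Fin n)) :
    carlemanEnergyDeriv u α s l l' t x = ∑ j, carlemanFluxDeriv u α s l t j x +
      carlemanBulk u α s l l' t x := by
  have hterm : ∀ j, carlemanFluxDeriv u α s l t j x = carlemanWeight α s x *
      (2 * (spaceDeriv j (timeDeriv u) (x, t) * spaceDeriv j u (x, t))
      + (2 * timeDeriv u (x, t) + radialDeriv u (x, t) / s - 2 * l * u (x, t)) *
          spaceDeriv j (spaceDeriv j u) (x, t)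
      + (1 / s - 2 * l) * spaceDeriv j u (x, t) ^ 2
      + (1 / s) * ((∑ i, x i * spaceDeriv j (spaceDeriv i u) (x, t)) * spaceDeriv j u (x, t))
      - (1 / s) * (x j * ∑ i, spaceDeriv i u (x, t) * spaceDeriv j (spaceDeriv i u) (x, t))
      + (2 * l * u (x, t) / s - timeDeriv u (x, t) / s - radialDeriv u (x, t) / (2 * s ^ 2)) *
          (x j * spaceDeriv j u (x, t))
      + ((gradSq u (x, t) - l * u (x, t) ^ 2) / (4 * s ^ 2)) * x j ^ 2
      - (gradSq u (x, t) - l * u (x, t) ^ 2) / (2 * s) * 1) := by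
    intro j
    have : (∑ i, 2 * spaceDeriv i u (x, t) * spaceDeriv j (spaceDeriv i u) (x, t)) =
        2 * ∑ i, spaceDeriv i u (x, t) * spaceDeriv j (spaceDeriv i u) (x, t) := by
      rw [Finset.mul_sum]; exact Finset.sum_congr rfl fun i _ => by ring
    rw [carlemanFluxDeriv, this]
    field_simp
    ring
  have hB : ∑ j, (∑ i, x i * spaceDeriv j (spaceDeriv i u) (x, t)) * spaceDeriv j u (x, t) =
      ∑ j, x j * ∑ i, spaceDeriv i u (x, t) * spaceDeriv j (spaceDeriv i u) (x, t) := by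
    simp only [Finset.sum_mul, Finset.mul_sum]
    rw [Finset.sum_comm]
    refine Finset.sum_congr rfl fun i _ => Finset.sum_congr rfl fun j _ => ?_
    rw [spaceDeriv_comm hu j i]
    ring
  have hN : ∑ j, x j ^ 2 = ‖x‖ ^ 2 := by simp [EuclideanSpace.norm_sq_eq]
  have hR : ∑ j, x j * spaceDeriv j u (x, t) = radialDeriv u (x, t) := rfl
  have hG : ∑ j, spaceDeriv j u (x, t) ^ 2 = gradSq u (x, t) := rfl
  have hL : ∑ j, spaceDeriv j (spaceDeriv j u) (x, t) = spaceLaplacian u (x, t) := rfl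
  rw [Finset.sum_congr rfl fun j _ => hterm j, ← Finset.mul_sum]
  simp only [Finset.sum_add_distrib, Finset.sum_sub_distrib, ← Finset.mul_sum]
  rw [hB, hN, hR, hG, hL, carlemanEnergyDeriv, carlemanBulk]
  simp only [Finset.sum_const, Finset.card_univ, Fintype.card_fin, nsmul_eq_mul, mul_one]
  field_simp
  ring

theorem continuous_gradSq {u : EuclideanSpace ℝ (Fin n) × ℝ → ℝ}
    (hu : ContDiff ℝ (⊤ : ℕ∞) u) : Continuous (gradSq u) :=
  continuous_finsetSum _ fun i _ => (contDiff_spaceDeriv hu i).continuous.pow 2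

theorem continuous_radialDeriv {u : EuclideanSpace ℝ (Fin n) × ℝ → ℝ}
    (hu : ContDiff ℝ (⊤ : ℕ∞) u) : Continuous (radialDeriv u) :=
  continuous_finsetSum _ fun i _ => Continuous.mul (by fun_prop)
    (contDiff_spaceDeriv hu i).continuous

theorem continuous_spaceLaplacian {u : EuclideanSpace ℝ (Fin n) × ℝ → ℝ}
    (hu : ContDiff ℝ (⊤ : ℕ∞) u) : Continuous (spaceLaplacian u) :=
  continuous_finsetSum _ fun i _ =>
    (contDiff_spaceDeriv (contDiff_spaceDeriv hu i) i).continuous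

theorem hasCompactSupport_slice {K : Set (EuclideanSpace ℝ (Fin n) × ℝ)} (hK : IsCompact K)
    (t : ℝ) {F : EuclideanSpace ℝ (Fin n) → ℝ} (hF : ∀ x, (x, t) ∉ K → F x = 0) :
    HasCompactSupport F :=
  HasCompactSupport.intro (hK.image continuous_fst) fun x hx =>
    hF x fun h => hx ⟨(x, t), h, rfl⟩

theorem integral_lineDeriv_eq_zero {F F' : EuclideanSpace ℝ (Fin n) → ℝ}
    {v : EuclideanSpace ℝ (Fin n)} (hF : Integrable F) (hF' : Integrable F')
    (h : ∀ x, HasLineDerivAt ℝ F (F' x) x v) : ∫ x, F' x = 0 := by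
  have := integral_bilinear_hasLineDerivAt_right_eq_neg_left_of_integrable
    (μ := volume) (f := fun _ : EuclideanSpace ℝ (Fin n) => (1 : ℝ)) (f' := fun _ => 0)
    (g := F) (g' := F') (v := v) (B := ContinuousLinearMap.mul ℝ ℝ)
    (by simp) (by simpa using hF') (by simpa using hF)
    (fun x _ => hasDerivAt_const (0 : ℝ) (1 : ℝ)) (fun x _ => h x)
  simpa using this

theorem continuous_carlemanWeight (α s : ℝ) :
    Continuous (carlemanWeight (n := n) α s) := by
  unfold carlemanWeight
  fun_prop

theorem continuous_carlemanFlux {u : EuclideanSpace ℝ (Fin n) × ℝ → ℝ}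
    (hu : ContDiff ℝ (⊤ : ℕ∞) u) (α s l t : ℝ) (j : Fin n) :
    Continuous (carlemanFlux u α s l t j) := by
  have hw := continuous_carlemanWeight (n := n) α s
  have h0 := hu.continuous
  have h1 := (contDiff_timeDeriv hu).continuous
  have h2 := (contDiff_spaceDeriv hu j).continuous
  have h3 := continuous_gradSq hu
  have h4 := continuous_radialDeriv hu
  unfold carlemanFlux
  fun_prop

theorem continuous_carlemanFluxDeriv {u : EuclideanSpace ℝ (Fin n) × ℝ → ℝ}
    (hu : ContDiff ℝ (⊤ : ℕ∞) u) (α s l t : ℝ) (j : Fin n) :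
    Continuous (carlemanFluxDeriv u α s l t j) := by
  have hw := continuous_carlemanWeight (n := n) α s
  have h0 := hu.continuous
  have h1 := (contDiff_timeDeriv hu).continuous
  have h2 := fun i => (contDiff_spaceDeriv hu i).continuous
  have h3 := continuous_gradSq hu
  have h4 := continuous_radialDeriv hu
  have h5 := (contDiff_spaceDeriv (contDiff_timeDeriv hu) j).continuous
  have h6 := fun i => (contDiff_spaceDeriv (contDiff_spaceDeriv hu i) j).continuous
  unfold carlemanFluxDeriv
  fun_prop

theorem integrable_carlemanFluxDeriv {u : EuclideanSpace ℝ (Fin n) × ℝ → ℝ}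
    (hu : ContDiff ℝ (⊤ : ℕ∞) u) (hc : HasCompactSupport u) (α s l t : ℝ) (j : Fin n) :
    Integrable (carlemanFluxDeriv u α s l t j) := by
  refine (continuous_carlemanFluxDeriv hu α s l t j).integrable_of_hasCompactSupport
    (hasCompactSupport_slice hc t fun x hx => ?_)
  have h2 : ∀ i, spaceDeriv j (spaceDeriv i u) (x, t) = 0 := fun i =>
    spaceDeriv_eq_zero (fun h => hx (tsupport_spaceDeriv_subset u i h)) j
  simp [carlemanFluxDeriv, spaceDeriv_eq_zero hx, timeDeriv_eq_zero hx, radialDeriv_eq_zero hx,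
    gradSq_eq_zero hx, image_eq_zero_of_notMem_tsupport hx, h2]

theorem integral_carlemanFluxDeriv {u : EuclideanSpace ℝ (Fin n) × ℝ → ℝ}
    (hu : ContDiff ℝ (⊤ : ℕ∞) u) (hc : HasCompactSupport u) (α s l t : ℝ) (j : Fin n) :
    ∫ x, carlemanFluxDeriv u α s l t j x = 0 := by
  refine integral_lineDeriv_eq_zero ?_ (integrable_carlemanFluxDeriv hu hc α s l t j)
    (hasLineDerivAt_carlemanFlux hu α s l t j)
  refine (continuous_carlemanFlux hu α s l t j).integrable_of_hasCompactSupport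
    (hasCompactSupport_slice hc t fun x hx => ?_)
  simp [carlemanFlux, spaceDeriv_eq_zero hx, radialDeriv_eq_zero hx,
    gradSq_eq_zero hx, image_eq_zero_of_notMem_tsupport hx]

theorem integrable_halfSpace {K : Set (EuclideanSpace ℝ (Fin n) × ℝ)} (hK : IsCompact K)
    {F : EuclideanSpace ℝ (Fin n) × ℝ → ℝ} (hF : ContinuousOn F {p | 0 ≤ p.2})
    (h0 : ∀ p, p ∉ K → F p = 0) :
    Integrable F ((volume : Measure (EuclideanSpace ℝ (Fin n))).prod
      (volume.restrict (Ioi (0 : ℝ)))) := by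
  have hclosed : IsClosed {p : EuclideanSpace ℝ (Fin n) × ℝ | 0 ≤ p.2} :=
    isClosed_le continuous_const continuous_snd
  have hKc : IsCompact (K ∩ {p | 0 ≤ p.2}) := hK.inter_right hclosed
  have h1 : IntegrableOn F (K ∩ {p | 0 ≤ p.2}) :=
    (hF.mono inter_subset_right).integrableOn_compact hKc
  have h2 : IntegrableOn F {p | 0 ≤ p.2} :=
    h1.of_forall_sdiff_eq_zero hclosed.measurableSet fun p hp => h0 p fun h => hp.2 ⟨h, hp.1⟩
  have h3 : (volume : Measure (EuclideanSpace ℝ (Fin n))).prod (volume.restrict (Ioi (0 : ℝ))) =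
      (volume : Measure (EuclideanSpace ℝ (Fin n) × ℝ)).restrict (univ ×ˢ Ioi 0) := by
    conv_lhs => rw [← Measure.restrict_univ (μ := (volume : Measure (EuclideanSpace ℝ (Fin n))))]
    rw [Measure.prod_restrict]
    rfl
  rw [h3]
  exact h2.mono_set fun p hp => le_of_lt (a := (0 : ℝ)) hp.2

theorem continuousOn_carlemanWeight (α : ℝ) {a : ℝ} (ha : 0 < a) :
    ContinuousOn (fun p : EuclideanSpace ℝ (Fin n) × ℝ => carlemanWeight α (p.2 + a) p.1)
      {p | 0 ≤ p.2} := by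
  unfold carlemanWeight
  have hne : ∀ p ∈ {p : EuclideanSpace ℝ (Fin n) × ℝ | 0 ≤ p.2}, p.2 + a ≠ 0 := fun p hp =>
    (add_pos_of_nonneg_of_pos hp ha).ne'
  have h4 : ∀ p ∈ {p : EuclideanSpace ℝ (Fin n) × ℝ | 0 ≤ p.2}, 4 * (p.2 + a) ≠ 0 := fun p hp =>
    mul_ne_zero (by norm_num) (hne p hp)
  fun_prop (disch := assumption)

theorem integrable_carlemanBulk {u : EuclideanSpace ℝ (Fin n) × ℝ → ℝ}
    (hu : ContDiff ℝ (⊤ : ℕ∞) u) (hc : HasCompactSupport u) (α : ℝ) {a : ℝ} (ha : 0 < a)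
    {l l' : ℝ → ℝ} (hl : ContinuousOn l (Ioi 0)) (hl' : ContinuousOn l' (Ioi 0)) :
    Integrable (fun p : EuclideanSpace ℝ (Fin n) × ℝ =>
        carlemanBulk u α (p.2 + a) (l (p.2 + a)) (l' (p.2 + a)) p.2 p.1)
      (volume.prod (volume.restrict (Ioi (0 : ℝ)))) := by
  refine integrable_halfSpace hc ?_ fun p hp => ?_
  · have hw := continuousOn_carlemanWeight (n := n) α ha
    have hpos : ∀ p ∈ {p : EuclideanSpace ℝ (Fin n) × ℝ | 0 ≤ p.2}, 0 < p.2 + a := fun p hp =>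
      add_pos_of_nonneg_of_pos hp ha
    have hne : ∀ p ∈ {p : EuclideanSpace ℝ (Fin n) × ℝ | 0 ≤ p.2}, p.2 + a ≠ 0 := fun p hp =>
      (hpos p hp).ne'
    have h2 : ∀ p ∈ {p : EuclideanSpace ℝ (Fin n) × ℝ | 0 ≤ p.2}, 2 * (p.2 + a) ≠ 0 :=
      fun p hp => mul_ne_zero (by norm_num) (hne p hp)
    have hlc := hl.comp (f := fun p : EuclideanSpace ℝ (Fin n) × ℝ => p.2 + a)
      (s := {p | 0 ≤ p.2}) (by fun_prop) hpos
    have hlc' := hl'.comp (f := fun p : EuclideanSpace ℝ (Fin n) × ℝ => p.2 + a)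
      (s := {p | 0 ≤ p.2}) (by fun_prop) hpos
    simp only [Function.comp_def] at hlc hlc'
    have h0 := hu.continuous
    have h1 := (contDiff_timeDeriv hu).continuous
    have h3 := continuous_gradSq hu
    have h4 := continuous_radialDeriv hu
    have h5 := continuous_spaceLaplacian hu
    unfold carlemanBulk
    fun_prop (disch := assumption)
  · simp [carlemanBulk, timeDeriv_eq_zero hp, radialDeriv_eq_zero hp, spaceLaplacian_eq_zero hp,
      gradSq_eq_zero hp, image_eq_zero_of_notMem_tsupport hp]

theorem integrable_carlemanEnergyDeriv {u : EuclideanSpace ℝ (Fin n) × ℝ → ℝ}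
    (hu : ContDiff ℝ (⊤ : ℕ∞) u) (hc : HasCompactSupport u) (α : ℝ) {a : ℝ} (ha : 0 < a)
    {l l' : ℝ → ℝ} (hl : ContinuousOn l (Ioi 0)) (hl' : ContinuousOn l' (Ioi 0)) :
    Integrable (fun p : EuclideanSpace ℝ (Fin n) × ℝ =>
        carlemanEnergyDeriv u α (p.2 + a) (l (p.2 + a)) (l' (p.2 + a)) p.2 p.1)
      (volume.prod (volume.restrict (Ioi (0 : ℝ)))) := by
  refine integrable_halfSpace hc ?_ fun p hp => ?_
  · have hw := continuousOn_carlemanWeight (n := n) α ha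
    have hpos : ∀ p ∈ {p : EuclideanSpace ℝ (Fin n) × ℝ | 0 ≤ p.2}, 0 < p.2 + a := fun p hp =>
      add_pos_of_nonneg_of_pos hp ha
    have hne : ∀ p ∈ {p : EuclideanSpace ℝ (Fin n) × ℝ | 0 ≤ p.2}, p.2 + a ≠ 0 := fun p hp =>
      (hpos p hp).ne'
    have h2 : ∀ p ∈ {p : EuclideanSpace ℝ (Fin n) × ℝ | 0 ≤ p.2}, 4 * (p.2 + a) ^ 2 ≠ 0 :=
      fun p hp => mul_ne_zero (by norm_num) (pow_ne_zero 2 (hne p hp))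
    have hlc := hl.comp (f := fun p : EuclideanSpace ℝ (Fin n) × ℝ => p.2 + a)
      (s := {p | 0 ≤ p.2}) (by fun_prop) hpos
    have hlc' := hl'.comp (f := fun p : EuclideanSpace ℝ (Fin n) × ℝ => p.2 + a)
      (s := {p | 0 ≤ p.2}) (by fun_prop) hpos
    simp only [Function.comp_def] at hlc hlc'
    have h0 := hu.continuous
    have h1 := (contDiff_timeDeriv hu).continuous
    have h3 := continuous_gradSq hu
    have h4 := fun i => (contDiff_spaceDeriv hu i).continuous
    have h5 := fun i => (contDiff_spaceDeriv (contDiff_timeDeriv hu) i).continuous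
    unfold carlemanEnergyDeriv
    fun_prop (disch := assumption)
  · simp [carlemanEnergyDeriv, timeDeriv_eq_zero hp, spaceDeriv_eq_zero hp,
      gradSq_eq_zero hp, image_eq_zero_of_notMem_tsupport hp]

theorem integral_carlemanBulk {u : EuclideanSpace ℝ (Fin n) × ℝ → ℝ}
    (hu : ContDiff ℝ (⊤ : ℕ∞) u) (hc : HasCompactSupport u) (α : ℝ) {a : ℝ} (ha : 0 < a)
    {l l' : ℝ → ℝ} (hl : ∀ s, 0 < s → HasDerivAt l (l' s) s) (hl' : ContinuousOn l' (Ioi 0)) :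
    ∫ p : EuclideanSpace ℝ (Fin n) × ℝ,
        carlemanBulk u α (p.2 + a) (l (p.2 + a)) (l' (p.2 + a)) p.2 p.1
        ∂(volume.prod (volume.restrict (Ioi (0 : ℝ)))) =
      -∫ x, carlemanWeight α a x * (gradSq u (x, 0) - l a * u (x, 0) ^ 2) := by
  have hlc : ContinuousOn l (Ioi 0) := fun s hs => (hl s hs).continuousAt.continuousWithinAt
  have hE := integrable_carlemanEnergyDeriv hu hc α ha hlc hl'
  have hB := integrable_carlemanBulk hu hc α ha hlc hl'
  have htime : ∀ x, IntegrableOn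
      (fun t => carlemanEnergyDeriv u α (t + a) (l (t + a)) (l' (t + a)) t x) (Ioi 0) →
      ∫ t in Ioi (0 : ℝ), carlemanEnergyDeriv u α (t + a) (l (t + a)) (l' (t + a)) t x =
        -(carlemanWeight α a x * (gradSq u (x, 0) - l a * u (x, 0) ^ 2)) := by
    intro x hx
    obtain ⟨T, hT⟩ := (hc.image continuous_snd).bddAbove
    have hlim : Filter.Tendsto (fun r => carlemanWeight α (r + a) x *
        (gradSq u (x, r) - l (r + a) * u (x, r) ^ 2)) Filter.atTop (nhds 0) := by
      refine tendsto_const_nhds.congr' ?_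
      filter_upwards [Filter.eventually_gt_atTop T] with r hr
      have hp : (x, r) ∉ tsupport u := fun h => (hT ⟨(x, r), h, rfl⟩).not_gt hr
      simp [gradSq_eq_zero hp, image_eq_zero_of_notMem_tsupport hp]
    rw [integral_Ioi_of_hasDerivAt_of_tendsto' (fun t ht => hasDerivAt_carlemanEnergy hu α
      (add_pos_of_nonneg_of_pos ht ha).ne' (hl (t + a) (add_pos_of_nonneg_of_pos ht ha)) x)
      hx hlim]
    simp
  have h1 : ∫ p : EuclideanSpace ℝ (Fin n) × ℝ,
      carlemanEnergyDeriv u α (p.2 + a) (l (p.2 + a)) (l' (p.2 + a)) p.2 p.1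
        ∂(volume.prod (volume.restrict (Ioi (0 : ℝ)))) =
      -∫ x, carlemanWeight α a x * (gradSq u (x, 0) - l a * u (x, 0) ^ 2) := by
    rw [integral_prod _ hE, ← integral_neg]
    refine integral_congr_ae ?_
    filter_upwards [hE.prod_right_ae] with x hx using htime x hx
  rw [← h1, integral_prod_symm _ hE, integral_prod_symm _ hB]
  refine integral_congr_ae ?_
  filter_upwards [hB.prod_left_ae, ae_restrict_mem measurableSet_Ioi] with t hBt ht
  have hs : t + a ≠ 0 := (add_pos ht ha).ne'
  simp only [carlemanEnergyDeriv_eq hu α hs]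
  rw [integral_add (integrable_finsetSum _ fun j _ => integrable_carlemanFluxDeriv hu hc _ _ _ _ j)
    hBt, integral_finsetSum _ fun j _ => integrable_carlemanFluxDeriv hu hc _ _ _ _ j]
  simp [integral_carlemanFluxDeriv hu hc]

theorem fderiv_slice {v : EuclideanSpace ℝ (Fin n) × ℝ → ℝ} (hv : Differentiable ℝ v)
    (x : EuclideanSpace ℝ (Fin n)) (t : ℝ) (i : Fin n) :
    fderiv ℝ (fun y => v (y, t)) x (EuclideanSpace.single i 1) = spaceDeriv i v (x, t) := by
  have h : HasFDerivAt (𝕜 := ℝ) (fun y => (y, t)) _ x :=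
    (hasFDerivAt_id x).prodMk (hasFDerivAt_const t x)
  have h' : HasFDerivAt (fun y => v (y, t)) _ x := HasFDerivAt.comp x (hv (x, t)).hasFDerivAt h
  rw [h'.fderiv]
  simp [spaceDeriv]

theorem norm_gradient_slice_sq {u : EuclideanSpace ℝ (Fin n) × ℝ → ℝ} (hu : Differentiable ℝ u)
    (x : EuclideanSpace ℝ (Fin n)) (t : ℝ) :
    ‖gradient (fun y => u (y, t)) x‖ ^ 2 = gradSq u (x, t) := by
  rw [EuclideanSpace.norm_sq_eq, gradSq]
  refine Finset.sum_congr rfl fun i _ => ?_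
  rw [← fderiv_slice hu, ← inner_gradient_left, EuclideanSpace.inner_single_right]
  simp

theorem slap_slice {u : EuclideanSpace ℝ (Fin n) × ℝ → ℝ} (hu : ContDiff ℝ (⊤ : ℕ∞) u)
    (x : EuclideanSpace ℝ (Fin n)) (t : ℝ) :
    slap (fun y => u (y, t)) x = spaceLaplacian u (x, t) := by
  refine Finset.sum_congr rfl fun i _ => ?_
  simp only [fderiv_slice (hu.differentiable (by simp))]
  exact fderiv_slice ((contDiff_spaceDeriv hu i).differentiable (by simp)) x t i

/-- The function `t ↦ t e^{-t/6}`, made constant from its maximum at `t = 6` on. -/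
noncomputable def carlemanTime (t : ℝ) : ℝ :=
  min t 6 * Real.exp (-(min t 6) / 6)

theorem carlemanTime_of_le {t : ℝ} (ht : t ≤ 6) : carlemanTime t = t * Real.exp (-t / 6) := by
  rw [carlemanTime, min_eq_left ht]

theorem carlemanTime_pos {t : ℝ} (ht : 0 < t) : 0 < carlemanTime t :=
  mul_pos (lt_min ht (by norm_num)) (Real.exp_pos _)

theorem carlemanTime_le {t : ℝ} (h0 : 0 ≤ t) (ht : t ≤ 6) : carlemanTime t ≤ t := by
  rw [carlemanTime_of_le ht]
  exact mul_le_of_le_one_right h0 (Real.exp_le_one_iff.2 (by linarith))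

theorem le_three_mul_carlemanTime {t : ℝ} (h0 : 0 ≤ t) (ht : t ≤ 6) :
    t ≤ 3 * carlemanTime t := by
  rw [carlemanTime_of_le ht]
  have h1 : Real.exp (-1) ≤ Real.exp (-t / 6) := Real.exp_le_exp.2 (by linarith)
  have h2 : 1 / 3 ≤ Real.exp (-1) := by
    have := Real.exp_neg_one_gt_d9
    linarith
  nlinarith [mul_le_mul_of_nonneg_left (h2.trans h1) h0]

theorem monotoneOn_carlemanTime : MonotoneOn carlemanTime (Ici 0) := by
  intro x hx y _ hxy
  have h0 : 0 ≤ min x 6 := le_min hx (by norm_num)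
  have hle : min x 6 ≤ min y 6 := min_le_min_right 6 hxy
  have h6 : min y 6 ≤ 6 := min_le_right _ _
  unfold carlemanTime
  generalize min x 6 = p at *
  generalize min y 6 = q at *
  have hexp : Real.exp (-q / 6) = Real.exp (-p / 6) * Real.exp (-(q - p) / 6) := by
    rw [← Real.exp_add]; ring_nf
  have hlow := Real.add_one_le_exp (-(q - p) / 6)
  have hq := mul_le_mul_of_nonneg_left hlow (h0.trans hle)
  have key : p ≤ q * Real.exp (-(q - p) / 6) := by
    nlinarith [mul_nonneg (sub_nonneg.2 hle) (sub_nonneg.2 h6)]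
  calc p * Real.exp (-p / 6) ≤ (q * Real.exp (-(q - p) / 6)) * Real.exp (-p / 6) :=
        mul_le_mul_of_nonneg_right key (Real.exp_pos _).le
    _ = q * Real.exp (-q / 6) := by rw [hexp]; ring

theorem carlemanWeight_eq (α : ℝ) {s : ℝ} (hs : 0 < s) (h6 : s ≤ 6)
    (x : EuclideanSpace ℝ (Fin n)) :
    carlemanWeight α s x = carlemanTime s ^ (1 - α) * Real.exp (-‖x‖ ^ 2 / (4 * s)) := by
  rw [Real.rpow_def_of_pos (carlemanTime_pos hs), carlemanTime_of_le h6,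
    Real.log_mul hs.ne' (Real.exp_pos _).ne', Real.log_exp, ← Real.exp_add, carlemanWeight]
  ring_nf

theorem carlemanTime_rpow_neg (α : ℝ) {s : ℝ} (hs : 0 < s) (h6 : s ≤ 6) :
    carlemanTime s ^ (-α) = carlemanTime s ^ (1 - α) * (Real.exp (s / 6) / s) := by
  have hp := carlemanTime_pos hs
  have h : carlemanTime s * (Real.exp (s / 6) / s) = 1 := by
    rw [carlemanTime_of_le h6, neg_div, Real.exp_neg]
    field_simp
  rw [show (1 : ℝ) - α = 1 + -α by ring, Real.rpow_add hp, Real.rpow_one]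
  linear_combination (-carlemanTime s ^ (-α)) * h

/-- The multiplier `λ` in the completed square of the Carleman inequality. -/
noncomputable def carlemanMultiplier (n : ℕ) (α s : ℝ) : ℝ :=
  ((α - n / 2) / s - (α - 1) / 6 + 1 / 36) / 2

theorem hasDerivAt_carlemanMultiplier (n : ℕ) (α : ℝ) {s : ℝ} (hs : 0 < s) :
    HasDerivAt (carlemanMultiplier n α) (-(α - n / 2) / (2 * s ^ 2)) s := by
  have h := ((((hasDerivAt_inv hs.ne').const_mul (α - n / 2)).sub_const
    ((α - 1) / 6)).add_const (1 / 36)).div_const 2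
  convert! h using 1
  field_simp

theorem weighted_le_carlemanBulk (u : EuclideanSpace ℝ (Fin n) × ℝ → ℝ) {α s : ℝ}
    (hα : 2 + (n : ℝ) / 2 ≤ α) (hs : 0 < s) (h5 : s ≤ 5) (t : ℝ)
    (x : EuclideanSpace ℝ (Fin n)) :
    α * (carlemanWeight α s x * (Real.exp (s / 6) / s) * u (x, t) ^ 2) +
        carlemanWeight α s x * gradSq u (x, t) ≤
      82 * (carlemanWeight α s x * (spaceLaplacian u (x, t) + timeDeriv u (x, t)) ^ 2) +
        164 * carlemanBulk u α s (carlemanMultiplier n α s) (-(α - n / 2) / (2 * s ^ 2)) t x := by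
  have hw : 0 < carlemanWeight α s x := Real.exp_pos _
  have hn : (0 : ℝ) ≤ n := Nat.cast_nonneg n
  have hG : 0 ≤ gradSq u (x, t) := Finset.sum_nonneg fun _ _ => sq_nonneg _
  have hexp : Real.exp (s / 6) ≤ 2.7182818286 :=
    (Real.exp_le_exp.2 (by linarith)).trans Real.exp_one_lt_d9.le
  have hgrad : (1 - α) * (1 / s - 1 / 6) + n / (2 * s) + 2 * carlemanMultiplier n α s - 1 / s =
      1 / 36 := by
    unfold carlemanMultiplier; field_simp; ring
  have hzero : -(-(α - n / 2) / (2 * s ^ 2) + carlemanMultiplier n α s *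
      ((1 - α) * (1 / s - 1 / 6) + n / (2 * s) + 2 * carlemanMultiplier n α s)) =
      ((α - 1) / 6 - (1 + (α - n / 2)) / 36 - s / 1296 + (α - 1) * s / 216) / (2 * s) := by
    unfold carlemanMultiplier; field_simp; ring
  have hcoef : α * (Real.exp (s / 6) / s) ≤
      164 * (((α - 1) / 6 - (1 + (α - n / 2)) / 36 - s / 1296 + (α - 1) * s / 216) /
        (2 * s)) := by
    rw [← mul_div_assoc, ← mul_div_assoc, div_le_div_iff₀ hs (by positivity)]
    have h1 := mul_le_mul_of_nonneg_left hexp (by linarith : 0 ≤ α)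
    have h2 : 0 ≤ (α - 1) * s := mul_nonneg (by linarith) hs.le
    have h3 : 2 * (α * Real.exp (s / 6)) ≤ 164 *
        ((α - 1) / 6 - (1 + (α - n / 2)) / 36 - s / 1296 + (α - 1) * s / 216) := by linarith
    nlinarith [mul_le_mul_of_nonneg_right h3 hs.le]
  have hU := mul_le_mul_of_nonneg_right hcoef (sq_nonneg (u (x, t)))
  have hS := sq_nonneg (spaceLaplacian u (x, t) - radialDeriv u (x, t) / (2 * s)
    - (spaceLaplacian u (x, t) + timeDeriv u (x, t)) / 2 + carlemanMultiplier n α s * u (x, t))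
  rw [carlemanBulk, hgrad, sub_eq_add_neg _ (_ * u (x, t) ^ 2), ← neg_mul, hzero]
  have := mul_le_mul_of_nonneg_left (a := carlemanWeight α s x)
    (b := α * (Real.exp (s / 6) / s) * u (x, t) ^ 2 + gradSq u (x, t))
    (c := 82 * (spaceLaplacian u (x, t) + timeDeriv u (x, t)) ^ 2 + 164 *
    (2 * (spaceLaplacian u (x, t) - radialDeriv u (x, t) / (2 * s)
        - (spaceLaplacian u (x, t) + timeDeriv u (x, t)) / 2
        + carlemanMultiplier n α s * u (x, t)) ^ 2
      - (spaceLaplacian u (x, t) + timeDeriv u (x, t)) ^ 2 / 2 + 1 / 36 * gradSq u (x, t)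
      + ((α - 1) / 6 - (1 + (α - n / 2)) / 36 - s / 1296 + (α - 1) * s / 216) / (2 * s)
        * u (x, t) ^ 2)) (by linarith) hw.le
  linarith

theorem integral_halfSpace_eq {K : Set (EuclideanSpace ℝ (Fin n) × ℝ)} (hK : IsCompact K)
    {F : EuclideanSpace ℝ (Fin n) × ℝ → ℝ} (hF : ContinuousOn F {p | 0 ≤ p.2})
    (h0 : ∀ p, p ∉ K → F p = 0) {g : EuclideanSpace ℝ (Fin n) → ℝ → ℝ}
    (hg : ∀ x t, 0 < t → g x t = F (x, t)) :
    ∫ t in Ioi (0 : ℝ), ∫ x, g x t =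
      ∫ p, F p ∂((volume : Measure (EuclideanSpace ℝ (Fin n))).prod
        (volume.restrict (Ioi (0 : ℝ)))) := by
  rw [integral_prod_symm _ (integrable_halfSpace hK hF h0)]
  exact setIntegral_congr_fun measurableSet_Ioi fun t ht =>
    integral_congr_ae (Filter.Eventually.of_forall fun x => hg x t ht)

theorem carleman_boundary_le {u : EuclideanSpace ℝ (Fin n) × ℝ → ℝ}
    (hu : ContDiff ℝ (⊤ : ℕ∞) u) (hc : HasCompactSupport u) {α a : ℝ}
    (hα : 2 + (n : ℝ) / 2 ≤ α) (ha : 0 < a) (ha1 : a ≤ 1) :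
    164 * -∫ x, carlemanWeight α a x *
        (gradSq u (x, 0) - carlemanMultiplier n α a * u (x, 0) ^ 2) ≤
      carlemanTime a ^ (-α) *
        (-(a / 200) * (∫ x, gradSq u (x, 0) * Real.exp (-‖x‖ ^ 2 / (4 * a))) +
          200 * α * ∫ x, u (x, 0) ^ 2 * Real.exp (-‖x‖ ^ 2 / (4 * a))) := by
  have hn : (0 : ℝ) ≤ n := Nat.cast_nonneg n
  have hp := carlemanTime_pos ha
  have hgrad := continuous_gradSq hu
  have hcont := hu.continuous
  have hGi : Integrable fun x : EuclideanSpace ℝ (Fin n) =>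
      gradSq u (x, 0) * Real.exp (-‖x‖ ^ 2 / (4 * a)) :=
    Continuous.integrable_of_hasCompactSupport (by fun_prop)
      (hasCompactSupport_slice hc 0 fun x hx => by simp [gradSq_eq_zero hx])
  have hUi : Integrable fun x : EuclideanSpace ℝ (Fin n) =>
      u (x, 0) ^ 2 * Real.exp (-‖x‖ ^ 2 / (4 * a)) :=
    Continuous.integrable_of_hasCompactSupport (by fun_prop)
      (hasCompactSupport_slice hc 0 fun x hx => by simp [image_eq_zero_of_notMem_tsupport hx])
  have hG0 : 0 ≤ ∫ x : EuclideanSpace ℝ (Fin n),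
      gradSq u (x, 0) * Real.exp (-‖x‖ ^ 2 / (4 * a)) :=
    integral_nonneg fun x => mul_nonneg (Finset.sum_nonneg fun _ _ => sq_nonneg _)
      (Real.exp_pos _).le
  have hU0 : 0 ≤ ∫ x : EuclideanSpace ℝ (Fin n), u (x, 0) ^ 2 * Real.exp (-‖x‖ ^ 2 / (4 * a)) :=
    integral_nonneg fun x => mul_nonneg (sq_nonneg _) (Real.exp_pos _).le
  have hpow : carlemanTime a ^ (1 - α) = carlemanTime a ^ (-α) * carlemanTime a := by
    rw [show (1 : ℝ) - α = -α + 1 by ring, Real.rpow_add hp, Real.rpow_one]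
  have hsplit : ∫ x, carlemanWeight α a x *
      (gradSq u (x, 0) - carlemanMultiplier n α a * u (x, 0) ^ 2) =
      carlemanTime a ^ (-α) * (carlemanTime a *
        (∫ x, gradSq u (x, 0) * Real.exp (-‖x‖ ^ 2 / (4 * a))) -
        carlemanTime a * carlemanMultiplier n α a *
          ∫ x, u (x, 0) ^ 2 * Real.exp (-‖x‖ ^ 2 / (4 * a))) := by
    rw [← integral_const_mul, ← integral_const_mul, ← integral_sub (hGi.const_mul _)
      (hUi.const_mul _), ← integral_const_mul]
    refine integral_congr_ae (Filter.Eventually.of_forall fun x => ?_)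
    simp only [carlemanWeight_eq α ha (by linarith : a ≤ 6), hpow]
    ring
  have hle := carlemanTime_le ha.le (by linarith)
  have hge := le_three_mul_carlemanTime ha.le (by linarith)
  have hmul : carlemanTime a * carlemanMultiplier n α a ≤ α := by
    have h1 : carlemanMultiplier n α a ≤ (α / a + 1 / 36) / 2 := by
      unfold carlemanMultiplier
      have : (α - n / 2) / a ≤ α / a := by gcongr; linarith
      linarith
    have h2 : 0 ≤ (α / a + 1 / 36) / 2 := by
      have : 0 ≤ α / a := div_nonneg (by linarith) ha.le
      linarith
    calc carlemanTime a * carlemanMultiplier n α a ≤ carlemanTime a * ((α / a + 1 / 36) / 2) :=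
          mul_le_mul_of_nonneg_left h1 hp.le
      _ ≤ a * ((α / a + 1 / 36) / 2) := mul_le_mul_of_nonneg_right hle h2
      _ = (α + a / 36) / 2 := by field_simp
      _ ≤ α := by linarith
  rw [hsplit, ← mul_neg, mul_left_comm]
  refine mul_le_mul_of_nonneg_left ?_ (Real.rpow_nonneg hp.le _)
  generalize (∫ x : EuclideanSpace ℝ (Fin n),
    gradSq u (x, 0) * Real.exp (-‖x‖ ^ 2 / (4 * a))) = D at *
  generalize (∫ x : EuclideanSpace ℝ (Fin n),
    u (x, 0) ^ 2 * Real.exp (-‖x‖ ^ 2 / (4 * a))) = H at *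
  have h1 := mul_le_mul_of_nonneg_right hmul hU0
  have h2 := mul_le_mul_of_nonneg_right hge hG0
  have h3 := mul_nonneg (mul_nonneg (by linarith : 0 ≤ α) hU0) zero_le_one
  have h4 := mul_nonneg ha.le hG0
  linarith

end CarlemanCalculus

/-- there are `N = N(n)` and an increasing `h : [0,∞) → [0,∞)` with
`t/N ≤ h(t) ≤ t` on `[0,6]`, such that for every `α ≥ 2 + n/2`, `0 < a ≤ 1`, and
`u ∈ C₀^∞(ℝⁿ × [0,4))` (formalized as a smooth compactly supported function on `ℝⁿ × ℝ`
whose support lies in `{t < 4}`; the integrals only involve `t ≥ 0`) the stated weighted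
inequality holds.  Here `h_a(t) = h(t+a)` and `dX = dx dt` on `ℝⁿ × (0,∞)`. -/
theorem stmt_10 (n : ℕ) :
    ∃ N > (0 : ℝ), ∃ h : ℝ → ℝ, MonotoneOn h (Ici (0 : ℝ)) ∧
      (∀ t ∈ Ici (0 : ℝ), 0 ≤ h t) ∧
      (∀ t ∈ Icc (0 : ℝ) 6, t / N ≤ h t ∧ h t ≤ t) ∧
      ∀ α : ℝ, 2 + (n : ℝ) / 2 ≤ α → ∀ a : ℝ, 0 < a → a ≤ 1 →
      ∀ u : EuclideanSpace ℝ (Fin n) × ℝ → ℝ,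
        ContDiff ℝ (⊤ : ℕ∞) u → HasCompactSupport u →
        (∀ p : EuclideanSpace ℝ (Fin n) × ℝ, p ∈ Function.support u → p.2 < 4) →
        α * (∫ t in Ioi (0 : ℝ), ∫ x : EuclideanSpace ℝ (Fin n),
              h (t + a) ^ (-α) * u (x, t) ^ 2 *
                Real.exp (-‖x‖ ^ 2 / (4 * (t + a)))) +
          (∫ t in Ioi (0 : ℝ), ∫ x : EuclideanSpace ℝ (Fin n),
              h (t + a) ^ (1 - α) * ‖gradient (fun y => u (y, t)) x‖ ^ 2 *
                Real.exp (-‖x‖ ^ 2 / (4 * (t + a)))) ≤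
        N * (∫ t in Ioi (0 : ℝ), ∫ x : EuclideanSpace ℝ (Fin n),
              h (t + a) ^ (1 - α) *
                (slap (fun y => u (y, t)) x + deriv (fun s => u (x, s)) t) ^ 2 *
                Real.exp (-‖x‖ ^ 2 / (4 * (t + a)))) +
          h a ^ (-α) *
            (-(a / N) * (∫ x : EuclideanSpace ℝ (Fin n),
                ‖gradient (fun y => u (y, 0)) x‖ ^ 2 * Real.exp (-‖x‖ ^ 2 / (4 * a))) +
              N * α * (∫ x : EuclideanSpace ℝ (Fin n),
                u (x, 0) ^ 2 * Real.exp (-‖x‖ ^ 2 / (4 * a)))) := by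
  refine ⟨200, by norm_num, carlemanTime, monotoneOn_carlemanTime, fun t ht => ?_,
    fun t ht => ⟨?_, carlemanTime_le ht.1 ht.2⟩, ?_⟩
  · exact mul_nonneg (le_min ht (by norm_num)) (Real.exp_pos _).le
  · linarith [le_three_mul_carlemanTime ht.1 ht.2, ht.1]
  intro α hα a ha ha1 u hu hc hsupp
  have hdiff := hu.differentiable (by simp)
  have htsupp : ∀ p, p ∈ tsupport u → p.2 ≤ 4 := fun p hp =>
    closure_minimal (t := {p : EuclideanSpace ℝ (Fin n) × ℝ | p.2 ≤ 4})
      (fun q hq => (hsupp q hq).le)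
      (isClosed_le continuous_snd continuous_const) hp
  have hw := continuousOn_carlemanWeight (n := n) α ha
  have hcont := hu.continuous
  have hgc := continuous_gradSq hu
  have hlc := continuous_spaceLaplacian hu
  have htc := (contDiff_timeDeriv hu).continuous
  have hne : ∀ p ∈ {p : EuclideanSpace ℝ (Fin n) × ℝ | 0 ≤ p.2}, p.2 + a ≠ 0 := fun p hp =>
    (add_pos_of_nonneg_of_pos hp ha).ne'
  have hUc : ContinuousOn (fun p : EuclideanSpace ℝ (Fin n) × ℝ =>
      carlemanWeight α (p.2 + a) p.1 * (Real.exp ((p.2 + a) / 6) / (p.2 + a)) * u p ^ 2)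
      {p | 0 ≤ p.2} := by fun_prop (disch := assumption)
  have hGc : ContinuousOn (fun p : EuclideanSpace ℝ (Fin n) × ℝ =>
      carlemanWeight α (p.2 + a) p.1 * gradSq u p) {p | 0 ≤ p.2} := by fun_prop
  have hFc : ContinuousOn (fun p : EuclideanSpace ℝ (Fin n) × ℝ =>
      carlemanWeight α (p.2 + a) p.1 * (spaceLaplacian u p + timeDeriv u p) ^ 2)
      {p | 0 ≤ p.2} := by fun_prop
  have hU0 : ∀ p, p ∉ tsupport u →
      carlemanWeight α (p.2 + a) p.1 * (Real.exp ((p.2 + a) / 6) / (p.2 + a)) * u p ^ 2 = 0 :=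
    fun p hp => by simp [image_eq_zero_of_notMem_tsupport hp]
  have hG0 : ∀ p, p ∉ tsupport u → carlemanWeight α (p.2 + a) p.1 * gradSq u p = 0 :=
    fun p hp => by simp [gradSq_eq_zero hp]
  have hF0 : ∀ p, p ∉ tsupport u →
      carlemanWeight α (p.2 + a) p.1 * (spaceLaplacian u p + timeDeriv u p) ^ 2 = 0 :=
    fun p hp => by simp [spaceLaplacian_eq_zero hp, timeDeriv_eq_zero hp]
  have hUint := integral_halfSpace_eq hc hUc hU0 (g := fun x t => carlemanTime (t + a) ^ (-α) *
    u (x, t) ^ 2 * Real.exp (-‖x‖ ^ 2 / (4 * (t + a)))) fun x t ht => by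
      by_cases hp : (x, t) ∈ tsupport u
      · have h4 : t ≤ 4 := htsupp _ hp
        rw [carlemanWeight_eq α (by linarith) (by linarith),
          carlemanTime_rpow_neg α (by linarith) (by linarith)]
        ring
      · rw [hU0 _ hp, image_eq_zero_of_notMem_tsupport hp]
        simp
  have hGint := integral_halfSpace_eq hc hGc hG0 (g := fun x t => carlemanTime (t + a) ^ (1 - α) *
    ‖gradient (fun y => u (y, t)) x‖ ^ 2 * Real.exp (-‖x‖ ^ 2 / (4 * (t + a)))) fun x t ht => by
      rw [norm_gradient_slice_sq hdiff]
      by_cases hp : (x, t) ∈ tsupport u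
      · have h4 : t ≤ 4 := htsupp _ hp
        rw [carlemanWeight_eq α (by linarith) (by linarith)]
        ring
      · rw [gradSq_eq_zero hp]
        simp
  have hFint := integral_halfSpace_eq hc hFc hF0 (g := fun x t => carlemanTime (t + a) ^ (1 - α) *
    (slap (fun y => u (y, t)) x + deriv (fun s => u (x, s)) t) ^ 2 *
      Real.exp (-‖x‖ ^ 2 / (4 * (t + a)))) fun x t ht => by
      rw [slap_slice hu, (hasDerivAt_time hdiff x t).deriv]
      by_cases hp : (x, t) ∈ tsupport u
      · have h4 : t ≤ 4 := htsupp _ hp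
        rw [carlemanWeight_eq α (by linarith) (by linarith)]
        ring
      · rw [spaceLaplacian_eq_zero hp, timeDeriv_eq_zero hp]
        simp
  have hl : ∀ s, 0 < s → HasDerivAt (carlemanMultiplier n α) (-(α - n / 2) / (2 * s ^ 2)) s :=
    fun s hs => hasDerivAt_carlemanMultiplier n α hs
  have hl' : ContinuousOn (fun s : ℝ => -(α - n / 2) / (2 * s ^ 2)) (Ioi 0) :=
    continuousOn_const.div (by fun_prop) fun s hs =>
      mul_ne_zero two_ne_zero (pow_ne_zero 2 (ne_of_gt hs))
  have hbulk := integral_carlemanBulk hu hc α ha hl hl'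
  have hBi := integrable_carlemanBulk hu hc α ha
    (fun s hs => (hl s hs).continuousAt.continuousWithinAt) hl'
  have hUi := integrable_halfSpace hc hUc hU0
  have hGi := integrable_halfSpace hc hGc hG0
  have hFi := integrable_halfSpace hc hFc hF0
  have hbdry := carleman_boundary_le hu hc hα ha ha1
  have hmono := integral_mono_ae ((hUi.const_mul α).add hGi)
    ((hFi.const_mul 82).add (hBi.const_mul 164)) (by
      have hpos : ∀ᵐ p ∂((volume : Measure (EuclideanSpace ℝ (Fin n))).prod
          (volume.restrict (Ioi (0 : ℝ)))), 0 < p.2 :=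
        Measure.quasiMeasurePreserving_snd.ae (ae_restrict_mem measurableSet_Ioi)
      filter_upwards [hpos] with p ht
      by_cases hp : p ∈ tsupport u
      · have h4 := htsupp _ hp
        exact weighted_le_carlemanBulk u hα (by linarith) (by linarith) p.2 p.1
      · simp [hp, carlemanBulk, timeDeriv_eq_zero, radialDeriv_eq_zero, spaceLaplacian_eq_zero,
          gradSq_eq_zero, image_eq_zero_of_notMem_tsupport])
  simp only [Pi.add_apply] at hmono
  rw [integral_add (hUi.const_mul α) hGi, integral_add (hFi.const_mul 82) (hBi.const_mul 164),
    integral_const_mul, integral_const_mul, integral_const_mul, hbulk] at hmono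
  have hFnonneg : 0 ≤ ∫ p : EuclideanSpace ℝ (Fin n) × ℝ,
      carlemanWeight α (p.2 + a) p.1 * (spaceLaplacian u p + timeDeriv u p) ^ 2
        ∂(volume.prod (volume.restrict (Ioi (0 : ℝ)))) :=
    integral_nonneg fun p => mul_nonneg (Real.exp_pos _).le (sq_nonneg _)
  simp only [norm_gradient_slice_sq hdiff _ 0]
  rw [hUint, hGint, hFint]
  linarith
end
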